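/- Let S³ be the unit sphere in ℝ⁴ with basepoint N₃, and let Map_*(S³,S³) be the space of continuous maps f : S³ → S³ with f(N₃) = N₃, equipped with the compact-open topology. Then for every f ∈ Map_*(S³,S³), the fundamental group π₁(Map_*(S³,S³), f) is isomorphic to ℤ/2ℤ. -/

import Mathlib

/-- The basepoint `N₃ = (1,0,0,0)` of the unit sphere `S³ ⊆ ℝ⁴`. -/
noncomputable def NPole : Metric.sphere (0 : EuclideanSpace ℝ (Fin 4)) 1 :=
  ⟨EuclideanSpace.single 0 1, by
    simp [mem_sphere_zero_iff_norm, EuclideanSpace.norm_single]⟩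

/-- The space `Map_*(S³, S³)` of based continuous self-maps of the 3-sphere, with the
compact-open topology (as a subspace of `C(S³, S³)`). -/
abbrev BasedMaps : Type :=
  {f : C(Metric.sphere (0 : EuclideanSpace ℝ (Fin 4)) 1,
          Metric.sphere (0 : EuclideanSpace ℝ (Fin 4)) 1) // f NPole = NPole}

section
set_option autoImplicit false
set_option linter.unusedSectionVars false
open Metric Set unitInterval Module

namespace Sk

/-- unit sphere -/
abbrev Sph (E : Type*) [NormedAddCommGroup E] := sphere (0 : E) 1

section basic
variable {T Y : Type*} [TopologicalSpace T] [TopologicalSpace Y]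

theorem homRel_mk {F G : C(T, Y)} {Z : Set T} (K : I × T → Y) (hK : Continuous K)
    (h0 : ∀ x, K (0, x) = F x) (h1 : ∀ x, K (1, x) = G x)
    (hZ : ∀ s, ∀ x ∈ Z, K (s, x) = F x) : ContinuousMap.HomotopicRel F G Z :=
  ⟨{ toFun := K, continuous_toFun := hK, map_zero_left := h0, map_one_left := h1, prop' := hZ }⟩

variable {E : Type*} [NormedAddCommGroup E] [NormedSpace ℝ E]

theorem nrm_mem (v : E) (h : v ≠ 0) : ‖v‖⁻¹ • v ∈ sphere (0 : E) 1 := by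
  have := norm_pos_iff.mpr h
  rw [mem_sphere_zero_iff_norm, norm_smul, norm_inv, norm_norm, inv_mul_cancel₀ this.ne']

/-- normalization of a nonvanishing map -/
noncomputable def nrm (f : T → E) (hf : Continuous f) (h : ∀ x, f x ≠ 0) : C(T, Sph E) :=
  ⟨fun x => ⟨‖f x‖⁻¹ • f x, nrm_mem _ (h x)⟩,
    Continuous.subtype_mk ((hf.norm.inv₀ (fun x => (norm_pos_iff.mpr (h x)).ne')).smul hf) _⟩

theorem nrm_coe (f : T → E) (hf : Continuous f) (h : ∀ x, f x ≠ 0) (x : T) :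
    (nrm f hf h x : E) = ‖f x‖⁻¹ • f x := rfl

theorem nrm_eq (f : T → E) (hf : Continuous f) (h : ∀ x, f x ≠ 0) (x : T) (y : Sph E)
    (hy : f x = y) : nrm f hf h x = y := by
  ext
  rw [nrm_coe, hy]; simp [norm_eq_of_mem_sphere]

theorem norm_lemma {u v : E} (hu : ‖u‖ = 1) (hv : ‖v‖ = 1) (h : u ≠ -v) (s : I) :
    (1 - (s : ℝ)) • u + (s : ℝ) • v ≠ 0 := by
  intro h0
  have h1 : (1 - (s : ℝ)) • u = -((s : ℝ) • v) := eq_neg_of_add_eq_zero_left h0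
  have h2 := congrArg norm h1
  rw [norm_neg, norm_smul, norm_smul, hu, hv, Real.norm_of_nonneg (by linarith [s.2.2]),
    Real.norm_of_nonneg s.2.1] at h2
  have h3 : (s : ℝ) = 1 / 2 := by linarith
  rw [h3] at h1
  apply h
  have : ((1 : ℝ) / 2) • u = ((1 : ℝ) / 2) • (-v) := by
    rw [smul_neg, ← h1]; norm_num
  exact smul_right_injective E (by norm_num : (1 : ℝ) / 2 ≠ 0) this

/-- NL -/
theorem homRel_of_ne_neg (F G : C(T, Sph E)) (Z : Set T) (h : ∀ x, (F x : E) ≠ -(G x : E))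
    (hZ : ∀ x ∈ Z, F x = G x) : ContinuousMap.HomotopicRel F G Z := by
  let f : I × T → E := fun p => (1 - (p.1 : ℝ)) • (F p.2 : E) + (p.1 : ℝ) • (G p.2 : E)
  have hf : Continuous f := by fun_prop
  have h0 : ∀ p, f p ≠ 0 := fun p =>
    norm_lemma (norm_eq_of_mem_sphere _) (norm_eq_of_mem_sphere _) (h p.2) p.1
  refine homRel_mk (nrm f hf h0) (nrm f hf h0).continuous ?_ ?_ ?_
  · intro x; apply nrm_eq; simp [f]
  · intro x; apply nrm_eq; simp [f]
  · intro s x hx; apply nrm_eq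
    simp only [f, ← hZ x hx, ← add_smul]; simp
end basic

section FL1
variable {E : Type*} [NormedAddCommGroup E] [InnerProductSpace ℝ E] [FiniteDimensional ℝ E]
variable {G : Type*} [NormedAddCommGroup G] [NormedSpace ℝ G] [FiniteDimensional ℝ G]

/-- real valued smooth approximation -/
theorem approx_real {X : Type*} [TopologicalSpace X] [CompactSpace X] (j : C(X, G))
    (hj : Function.Injective j) (f : C(X, ℝ)) (ε : ℝ) (hε : 0 < ε) :
    ∃ P : G → ℝ, ContDiff ℝ 1 P ∧ ∀ x, |P (j x) - f x| < ε := by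
  let A : Subalgebra ℝ C(X, ℝ) :=
    { carrier := {g | ∃ P : G → ℝ, ContDiff ℝ 1 P ∧ ∀ x, g x = P (j x)}
      mul_mem' := by
        rintro a b ⟨P, hP, h⟩ ⟨Q, hQ, h'⟩
        exact ⟨fun x => P x * Q x, hP.mul hQ, fun x => by simp [h, h']⟩
      add_mem' := by
        rintro a b ⟨P, hP, h⟩ ⟨Q, hQ, h'⟩
        exact ⟨fun x => P x + Q x, hP.add hQ, fun x => by simp [h, h']⟩
      algebraMap_mem' := by
        intro r
        exact ⟨fun _ => r, contDiff_const, fun x => by simp⟩ }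
  have hA : A.SeparatesPoints := by
    intro x y hxy
    obtain ⟨φ, hφ⟩ := SeparatingDual.exists_separating_of_ne (R := ℝ) (hj.ne hxy)
    refine ⟨_, ⟨(φ : C(G, ℝ)).comp j, ⟨φ, φ.contDiff, fun x => rfl⟩, rfl⟩, hφ⟩
  obtain ⟨⟨g, P, hP, hg⟩, h⟩ :=
    ContinuousMap.exists_mem_subalgebra_near_continuous_of_separatesPoints A hA f f.continuous ε hε
  refine ⟨P, hP, fun x => ?_⟩
  have := h x
  simpa [hg] using this

theorem approx_vec {X : Type*} [TopologicalSpace X] [CompactSpace X] (j : C(X, G))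
    (hj : Function.Injective j) (f : C(X, E)) (ε : ℝ) (hε : 0 < ε) :
    ∃ P : G → E, ContDiff ℝ 1 P ∧ ∀ x, ‖P (j x) - f x‖ < ε := by
  let b := stdOrthonormalBasis ℝ E
  set N : ℝ := (Fintype.card (Fin (finrank ℝ E)) : ℝ) + 1 with hN
  have hNpos : 0 < N := by positivity
  have key : ∀ i, ∃ P : G → ℝ, ContDiff ℝ 1 P ∧ ∀ x, |P (j x) - inner ℝ (b i) (f x)| < ε / N := by
    intro i
    exact approx_real j hj ⟨fun x => inner ℝ (b i) (f x), by fun_prop⟩ (ε / N) (by positivity)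
  choose P hP h using key
  refine ⟨fun x => ∑ i, P i x • b i, ContDiff.sum fun i _ => (hP i).smul contDiff_const, ?_⟩
  intro x
  have e1 : f x = ∑ i, (inner ℝ (b i) (f x) : ℝ) • b i := (b.sum_repr' (f x)).symm
  have e2 : (∑ i, P i (j x) • b i) - f x
      = ∑ i, (P i (j x) - inner ℝ (b i) (f x)) • b i := by
    conv_lhs => rw [e1]
    rw [← Finset.sum_sub_distrib]
    simp only [sub_smul]
  simp only [e2]
  calc ‖∑ i, (P i (j x) - inner ℝ (b i) (f x)) • b i‖
      ≤ ∑ i, ‖(P i (j x) - inner ℝ (b i) (f x)) • b i‖ := norm_sum_le _ _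
    _ ≤ ∑ i : Fin (finrank ℝ E), ε / N := by
        apply Finset.sum_le_sum
        intro i _
        rw [norm_smul, b.norm_eq_one, mul_one, Real.norm_eq_abs]
        exact (h i x).le
    _ < ε := by
        rw [Finset.sum_const, Finset.card_univ, nsmul_eq_mul, mul_div_assoc', div_lt_iff₀ hNpos]
        rw [hN]; nlinarith
end FL1
end Sk
end

section
set_option autoImplicit false
set_option linter.unusedSectionVars false
open Metric Set unitInterval Module

namespace Sk
section FL1
variable {E : Type*} [NormedAddCommGroup E] [InnerProductSpace ℝ E] [FiniteDimensional ℝ E]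
variable {G : Type*} [NormedAddCommGroup G] [NormedSpace ℝ G] [FiniteDimensional ℝ G]

theorem exists_small_avoid (e : E) (P : G × ℝ → E) (hP : ContDiff ℝ 1 P)
    (hdim : finrank ℝ G + 2 < 2 * finrank ℝ (ℝ ∙ e)ᗮ) (ε : ℝ) (hε : 0 < ε) :
    ∃ a c : E, inner ℝ e a = 0 ∧ inner ℝ e c = 0 ∧ ‖a‖ < ε ∧ ‖c‖ < ε ∧
      ∀ (x : G) (t t' : ℝ) (r r' : ℝ), ¬ (P (x, t) - a = r • e ∧ P (x, t') - c = r' • e) := by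
  let V := (ℝ ∙ e)ᗮ
  let f : G × ℝ × ℝ → V × V := fun p =>
    (V.orthogonalProjectionOnto (P (p.1, p.2.1)), V.orthogonalProjectionOnto (P (p.1, p.2.2)))
  have hf : ContDiff ℝ 1 f := by
    refine ContDiff.prodMk ?_ ?_
    · exact V.orthogonalProjectionOnto.contDiff.comp (hP.comp (by fun_prop))
    · exact V.orthogonalProjectionOnto.contDiff.comp (hP.comp (by fun_prop))
  have hd : Dense (range f)ᶜ := by
    apply hf.dense_compl_range_of_finrank_lt_finrank
    simp only [finrank_prod, finrank_self]
    show _ < finrank ℝ (ℝ ∙ e)ᗮ + finrank ℝ (ℝ ∙ e)ᗮ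
    omega
  obtain ⟨⟨a, c⟩, hac, hb⟩ := hd.exists_dist_lt (0 : V × V) hε
  rw [dist_zero_left, Prod.norm_def, max_lt_iff] at hb
  refine ⟨a, c, ?_, ?_, hb.1, hb.2, ?_⟩
  · exact Submodule.mem_orthogonal_singleton_iff_inner_right.mp a.2
  · exact Submodule.mem_orthogonal_singleton_iff_inner_right.mp c.2
  · rintro x t t' r r' ⟨h1, h2⟩
    apply hac
    have he : V.orthogonalProjectionOnto e = 0 := by
      rw [Submodule.orthogonalProjectionOnto_eq_zero_iff, Submodule.orthogonal_orthogonal]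
      exact Submodule.mem_span_singleton_self e
    have key : ∀ (p : E) (w : V) (s : ℝ), p - w = s • e → V.orthogonalProjectionOnto p = w := by
      intro p w s h
      have := congrArg V.orthogonalProjectionOnto h
      rw [map_sub, map_smul, he, smul_zero, sub_eq_zero] at this
      rw [this]; simp
    exact ⟨(x, t, t'), Prod.ext (key _ _ _ h1) (key _ _ _ h2)⟩

/-- cutoff: `0` for `s ≤ 1/2`, `1` for `s ≥ 3/4` -/
noncomputable def cut (s : ℝ) : ℝ := max 0 (min 1 (4 * s - 2))
theorem cut_cont : Continuous cut := by unfold cut; fun_prop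
theorem cut_nonneg (s : ℝ) : 0 ≤ cut s := le_max_left _ _
theorem cut_le (s : ℝ) : cut s ≤ 1 := max_le (by norm_num) (min_le_left _ _)
theorem cut_one {s : ℝ} (h : 3 / 4 ≤ s) : cut s = 1 := by
  unfold cut; rw [min_eq_left (by linarith)]; norm_num
theorem cut_zero {s : ℝ} (h : s ≤ 1 / 2) : cut s = 0 := by
  unfold cut; rw [max_eq_left]; exact (min_le_right _ _).trans (by linarith)

theorem FL1 {X : Type*} [TopologicalSpace X] [CompactSpace X] (j : C(X, G))
    (hj : Function.Injective j) (e : E) (he : ‖e‖ = 1)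
    (hdim : finrank ℝ G + 2 < 2 * finrank ℝ (ℝ ∙ e)ᗮ) (F : C(X × I, Sph E)) (Z : Set (X × I))
    (hZ : ∀ z ∈ Z, inner ℝ e (F z : E) = 0) :
    ∃ F' : C(X × I, Sph E), ContinuousMap.HomotopicRel F F' Z ∧
      ∀ x t t', ¬ ((F' (x, t) : E) = e ∧ (F' (x, t') : E) = -e) := by
  have hj' : Function.Injective (fun p : X × I => (j p.1, (p.2 : ℝ))) := by
    rintro ⟨x, t⟩ ⟨x', t'⟩ h
    simp only [Prod.mk.injEq] at h
    exact Prod.ext (hj h.1) (Subtype.ext h.2)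
  obtain ⟨P, hP, hPF⟩ := approx_vec (E := E) (G := G × ℝ) (X := X × I)
    ⟨fun p => (j p.1, (p.2 : ℝ)), by fun_prop⟩ hj' ⟨fun p => (F p : E), by fun_prop⟩ (1 / 100)
    (by norm_num)
  obtain ⟨a, c, ha, hc, hna, hnc, hac⟩ := exists_small_avoid e P hP hdim (1 / 100) (by norm_num)
  simp only [ContinuousMap.coe_mk] at hPF
  let Q : X × I → E := fun p => P (j p.1, (p.2 : ℝ))
  have hQ : Continuous Q := hP.continuous.comp (by fun_prop)
  let u : X × I → ℝ := fun p => inner ℝ e (F p : E)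
  have hu : Continuous u := by fun_prop
  let F1 : X × I → E := fun p => (F p : E) + cut (u p) • (Q p - a - F p)
    + cut (- u p) • (Q p - c - F p)
  have hcu : Continuous fun p => cut (u p) := cut_cont.comp hu
  have hcu' : Continuous fun p => cut (- u p) := cut_cont.comp hu.neg
  have hF1 : Continuous F1 := by fun_prop
  have nF : ∀ p, ‖(F p : E)‖ = 1 := fun p => norm_eq_of_mem_sphere _
  have hsmall : ∀ p, ‖F1 p - F p‖ ≤ 1 / 25 := by
    intro p
    have e1 : F1 p - F p = cut (u p) • (Q p - a - F p) + cut (- u p) • (Q p - c - F p) := by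
      simp only [F1]; abel
    have q : ∀ (s : ℝ) (w : E), ‖w‖ < 1 / 100 → ‖cut s • (Q p - w - F p)‖ ≤ 1 / 50 := by
      intro s w hw
      rw [norm_smul, Real.norm_of_nonneg (cut_nonneg _)]
      have e2 : Q p - w - F p = (Q p - F p) - w := by abel
      have : ‖Q p - w - F p‖ ≤ 1 / 50 := by
        rw [e2]; refine (norm_sub_le _ _).trans ?_
        have := hPF p
        simp only [Q]; linarith
      have := cut_le s; have := cut_nonneg s
      nlinarith [norm_nonneg (Q p - w - F p)]
    rw [e1]; refine (norm_add_le _ _).trans ?_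
    have := q (u p) a hna; have := q (-u p) c hnc
    linarith
  have hnF1 : ∀ p, 24 / 25 ≤ ‖F1 p‖ := by
    intro p
    have : ‖(F p : E)‖ ≤ ‖F1 p‖ + ‖F1 p - F p‖ := by
      have := norm_sub_le (F1 p) (F1 p - F p); simpa using this
    have := hsmall p; rw [nF] at *; linarith
  have hF10 : ∀ p, F1 p ≠ 0 := fun p => norm_pos_iff.mp (by linarith [hnF1 p])
  have sc : ∀ p (w : E), (nrm F1 hF1 hF10 p : E) = w → F1 p = ‖F1 p‖ • w := by
    intro p w h
    rw [← h, nrm_coe, smul_smul, mul_inv_cancel₀ (norm_ne_zero_iff.mpr (hF10 p)), one_smul]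
  refine ⟨nrm F1 hF1 hF10, ?_, ?_⟩
  · apply homRel_of_ne_neg
    · intro p h
      have h1 := sc p (-(F p : E)) (by rw [h, neg_neg])
      have h2 : F1 p - F p = -((‖F1 p‖ + 1) • (F p : E)) := by
        conv_lhs => rw [h1]
        rw [add_smul, smul_neg, one_smul]; abel
      have h3 := hsmall p
      rw [h2, norm_neg, norm_smul, nF, mul_one, Real.norm_of_nonneg (by positivity)] at h3
      linarith [norm_nonneg (F1 p)]
    · intro z hz
      symm; apply nrm_eq
      have : u z = 0 := hZ z hz
      simp only [F1, this, neg_zero, cut_zero (show (0 : ℝ) ≤ 1 / 2 by norm_num)]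
      simp
  · rintro x t t' ⟨h1, h2⟩
    have hin : ∀ p, |inner ℝ e (F1 p) - u p| ≤ 1 / 25 := by
      intro p
      have : inner ℝ e (F1 p) - u p = inner ℝ e (F1 p - F p) := by
        simp only [u]; rw [inner_sub_right]
      rw [this]
      refine (abs_real_inner_le_norm _ _).trans ?_
      rw [he, one_mul]; exact hsmall p
    have hee : inner ℝ e e = (1 : ℝ) := by rw [real_inner_self_eq_norm_sq, he]; norm_num
    have e1 := sc _ _ h1
    have e2 := sc _ _ h2
    have i1 : inner ℝ e (F1 (x, t)) = ‖F1 (x, t)‖ := by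
      conv_lhs => rw [e1]
      rw [inner_smul_right, hee, mul_one]
    have i2 : inner ℝ e (F1 (x, t')) = -‖F1 (x, t')‖ := by
      conv_lhs => rw [e2]
      rw [inner_smul_right, inner_neg_right, hee]; ring
    have b1 := abs_le.mp (hin (x, t)); have b2 := abs_le.mp (hin (x, t'))
    rw [i1] at b1; rw [i2] at b2
    have n1 := hnF1 (x, t); have n2 := hnF1 (x, t')
    have f1 : F1 (x, t) = Q (x, t) - a := by
      simp only [F1]
      rw [cut_one (by linarith), cut_zero (by linarith)]
      simp
    have f2 : F1 (x, t') = Q (x, t') - c := by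
      simp only [F1]
      rw [cut_zero (by linarith), cut_one (by linarith)]
      simp
    refine hac (j x) t t' ‖F1 (x, t)‖ (-‖F1 (x, t')‖) ⟨?_, ?_⟩
    · rw [← e1, f1]
    · rw [neg_smul, ← smul_neg, ← e2, f2]
end FL1
end Sk
end

section
set_option autoImplicit false
set_option linter.unusedSectionVars false
open Metric Set unitInterval Module

namespace Sk
section FL2
variable {E : Type*} [NormedAddCommGroup E] [InnerProductSpace ℝ E]

/-- the boundary set -/
def Zc {X : Type*} (A : Set X) : Set (X × I) := {p | p.1 ∈ A ∨ p.2 = 0 ∨ p.2 = 1}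

theorem FL2 {X : Type*} [TopologicalSpace X] [CompactSpace X] [T2Space X] (A : Set X)
    (e : E) (b : Sph E) (hb : inner ℝ e (b : E) = 0) (he : ‖e‖ = 1)
    (F : C(X × I, Sph E)) (hF : ∀ z ∈ Zc A, F z = b)
    (hne : ∀ x t t', ¬ ((F (x, t) : E) = e ∧ (F (x, t') : E) = -e)) :
    ∃ F' : C(X × I, Sph E), ContinuousMap.HomotopicRel F F' (Zc A) ∧
      (∀ x (t : I), (t : ℝ) ≤ 1 / 2 → (F' (x, t) : E) ≠ -e) ∧
      (∀ x (t : I), 1 / 2 ≤ (t : ℝ) → (F' (x, t) : E) ≠ e) := by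
  have hbe : (b : E) ≠ e := by
    intro h; rw [h, real_inner_self_eq_norm_sq, he] at hb; norm_num at hb
  have hbe' : (b : E) ≠ -e := by
    intro h; rw [h, inner_neg_right, real_inner_self_eq_norm_sq, he] at hb; norm_num at hb
  let cl : E → Set X := fun w => Prod.fst '' {p : X × I | (F p : E) = w}
  have hcl : ∀ w, IsClosed (cl w) := by
    intro w
    apply IsCompact.isClosed
    apply IsCompact.image _ continuous_fst
    exact (isClosed_eq (by fun_prop) continuous_const).isCompact
  obtain ⟨lam, h0, h1, h01⟩ := exists_continuous_zero_one_of_isClosed (hcl e) (hcl (-e)) (by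
    rw [Set.disjoint_left]
    rintro _ ⟨⟨x, t⟩, ht, rfl⟩ ⟨⟨x', t'⟩, ht', rfl⟩
    exact hne _ _ _ ⟨ht, ht'⟩)
  let r : X × I → I := fun p => projIcc 0 1 zero_le_one (2 * (p.2 : ℝ) - lam p.1)
  have hr : Continuous r := continuous_projIcc.comp (by fun_prop)
  have r0 : ∀ p : X × I, 2 * (p.2 : ℝ) - lam p.1 ≤ 0 → r p = 0 := fun p h => projIcc_of_le_left _ h
  have r1 : ∀ p : X × I, 1 ≤ 2 * (p.2 : ℝ) - lam p.1 → r p = 1 := fun p h => projIcc_of_right_le _ h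
  let F' : C(X × I, Sph E) := ⟨fun p => F (p.1, r p), by fun_prop⟩
  refine ⟨F', ?_, ?_, ?_⟩
  · let m : I × (X × I) → I := fun q => ⟨(1 - (q.1 : ℝ)) * q.2.2 + q.1 * r q.2, by
      have := q.1.2; have := q.2.2.2; have := (r q.2).2
      simp only [mem_Icc] at *
      constructor <;> nlinarith⟩
    have hm : Continuous m := Continuous.subtype_mk (by fun_prop) _
    refine homRel_mk (fun q => F (q.2.1, m q)) (by fun_prop) ?_ ?_ ?_
    · rintro ⟨x, t⟩; congr 2; simp [m]
    · rintro ⟨x, t⟩; simp only [F', ContinuousMap.coe_mk]; congr 2; simp [m]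
    · rintro s ⟨x, t⟩ hz
      have hz' := hz
      rw [hF _ hz]
      apply hF
      rcases hz with h | h | h
      · exact Or.inl h
      · right; left
        simp only at h
        have := r0 (x, t) (by have := (h01 x).1; simp [h]; linarith)
        subst h; ext; simp [m, this]
      · right; right
        simp only at h
        have := r1 (x, t) (by have := (h01 x).2; simp [h]; linarith)
        subst h; ext; simp [m, this]
  · intro x t ht h
    simp only [F', ContinuousMap.coe_mk] at h
    have hx : lam x = 1 := h1 ⟨_, h, rfl⟩
    rw [r0 (x, t) (by simp only [hx]; linarith), hF _ (Or.inr (Or.inl rfl))] at h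
    exact hbe' h
  · intro x t ht h
    simp only [F', ContinuousMap.coe_mk] at h
    have hx : lam x = 0 := h0 ⟨_, h, rfl⟩
    rw [r1 (x, t) (by simp only [hx]; linarith), hF _ (Or.inr (Or.inr rfl))] at h
    exact hbe h

/-- one half -/
noncomputable def hf : I := ⟨1 / 2, by norm_num, by norm_num⟩

theorem FL3a {X : Type*} [TopologicalSpace X] [CompactSpace X] [T2Space X] (A : Set X)
    (e : E) (b : Sph E) (hb : inner ℝ e (b : E) = 0) (he : ‖e‖ = 1)
    (F : C(X × I, Sph E)) (hF : ∀ z ∈ Zc A, F z = b)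
    (h1 : ∀ x (t : I), (t : ℝ) ≤ 1 / 2 → (F (x, t) : E) ≠ -e)
    (h2 : ∀ x (t : I), 1 / 2 ≤ (t : ℝ) → (F (x, t) : E) ≠ e) :
    ∃ F' : C(X × I, Sph E), ContinuousMap.HomotopicRel F F' (Zc A) ∧
      (∀ x (t : I), (t : ℝ) ≤ 1 / 2 → (F' (x, t) : E) ≠ -e) ∧
      (∀ x (t : I), 1 / 2 ≤ (t : ℝ) → (F' (x, t) : E) ≠ e) ∧
      ∀ x, inner ℝ e (F' (x, hf) : E) = 0 := by
  have hee : inner ℝ e e = (1 : ℝ) := by rw [real_inner_self_eq_norm_sq, he]; norm_num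
  obtain ⟨u, u0, u1, h01⟩ := exists_continuous_zero_one_of_isClosed
    (s := {p : X × I | (F p : E) = e} ∪ {p | (F p : E) = -e}) (t := {p : X × I | p.2 = hf})
    ((isClosed_eq (by fun_prop) continuous_const).union
      (isClosed_eq (by fun_prop) continuous_const))
    (isClosed_eq continuous_snd continuous_const) (by
    rw [Set.disjoint_left]
    rintro ⟨x, t⟩ h (rfl : t = hf)
    rcases h with h | h
    · exact h2 x hf (by simp [hf]) h
    · exact h1 x hf (by simp [hf]) h)
  let f : X × I → E := fun p => (F p : E) - (u p * inner ℝ e (F p : E)) • e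
  have hf0 : Continuous f := by fun_prop
  have nF : ∀ p, ‖(F p : E)‖ = 1 := fun p => norm_eq_of_mem_sphere _
  -- if f p is a multiple of e then f p = F p
  have key : ∀ p (r : ℝ), (F p : E) = r • e → f p = F p := by
    intro p r h
    have : |r| = 1 := by
      have := nF p; rwa [h, norm_smul, he, mul_one, Real.norm_eq_abs] at this
    have hu : u p = 0 := by
      apply u0
      rcases (abs_eq zero_le_one).mp this with h' | h'
      · left; simp [h, h']
      · right; simp [h, h']
    simp [f, hu]
  have key2 : ∀ p (r : ℝ), f p = r • e → f p = F p := by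
    intro p r h
    apply key p (r + u p * inner ℝ e (F p : E))
    rw [add_smul, ← h]; simp [f]
  have hne : ∀ p, f p ≠ 0 := by
    intro p h
    have := key2 p 0 (by simpa using h)
    have h' := nF p
    rw [← this, h] at h'; simp at h'
  have key3 : ∀ p, ∀ r : ℝ, (nrm f hf0 hne p : E) = r • e → (F p : E) = r • e := by
    intro p r h
    have e1 : f p = F p := by
      apply key2 p (‖f p‖ * r)
      rw [mul_smul, ← h, nrm_coe, smul_smul, mul_inv_cancel₀ (norm_ne_zero_iff.mpr (hne p)), one_smul]
    rw [← h, nrm_coe, e1, nF]; simp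
  refine ⟨nrm f hf0 hne, ?_, ?_, ?_, ?_⟩
  · apply homRel_of_ne_neg
    · intro p h
      -- F p = - ‖f‖⁻¹ f p
      have e0 : (F p : E) = (‖f p‖⁻¹ * (u p * inner ℝ e (F p : E)) / (1 + ‖f p‖⁻¹)) • e := by
        have h' : (1 + ‖f p‖⁻¹) • (F p : E) = (‖f p‖⁻¹ * (u p * inner ℝ e (F p : E))) • e := by
          have hh : (F p : E) + ‖f p‖⁻¹ • f p = 0 := by
            rw [← nrm_coe f hf0 hne, ← neg_eq_iff_eq_neg.mpr h]; abel
          have h4 : f p = (F p : E) - (u p * inner ℝ e (F p : E)) • e := rfl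
          have h5 : ‖f p‖⁻¹ • f p = ‖f p‖⁻¹ • (F p : E) - ‖f p‖⁻¹ • (u p * inner ℝ e (F p : E)) • e := by
            conv_lhs => rw [h4]
            rw [smul_sub]
          rw [h5] at hh
          rw [add_smul, one_smul, mul_smul, ← sub_eq_zero, ← hh]
          abel
        have hp : 0 < 1 + ‖f p‖⁻¹ := by positivity
        rw [div_eq_inv_mul, mul_smul, ← h', smul_smul, inv_mul_cancel₀ hp.ne', one_smul]
      have e1 := key p _ e0
      rw [nrm_coe, e1, nF, inv_one, one_smul] at h
      have : (F p : E) = 0 := by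
        have h6 : (2 : ℝ) • (F p : E) = 0 := by rw [two_smul]; nth_rewrite 1 [h]; abel
        exact (smul_eq_zero.mp h6).resolve_left (by norm_num)
      have h' := nF p
      rw [this] at h'; simp at h'
    · intro z hz
      symm; apply nrm_eq
      simp [f, hF z hz, hb]
  · intro x t ht h
    exact h1 x t ht (by have := key3 (x, t) (-1) (by simpa using h); simpa using this)
  · intro x t ht h
    exact h2 x t ht (by have := key3 (x, t) 1 (by simpa using h); simpa using this)
  · intro x
    rw [nrm_coe, inner_smul_right]
    have : u (x, hf) = 1 := u1 rfl
    simp [f, this, inner_sub_right, inner_smul_right, he]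

theorem FL3b {X : Type*} [TopologicalSpace X] (A : Set X)
    (e : E) (he : ‖e‖ = 1) (F G : C(X × I, Sph E)) (hZ : ∀ z ∈ Zc A, F z = G z)
    (h1 : ∀ x (t : I), (t : ℝ) ≤ 1 / 2 → (F (x, t) : E) ≠ -e)
    (h2 : ∀ x (t : I), 1 / 2 ≤ (t : ℝ) → (F (x, t) : E) ≠ e)
    (h1' : ∀ x (t : I), (t : ℝ) ≤ 1 / 2 → (G (x, t) : E) ≠ -e)
    (h2' : ∀ x (t : I), 1 / 2 ≤ (t : ℝ) → (G (x, t) : E) ≠ e)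
    (hh : ∀ x, F (x, hf) = G (x, hf)) : ContinuousMap.HomotopicRel F G (Zc A) := by
  have he' : ‖-e‖ = 1 := by rwa [norm_neg]
  -- generic piece
  have piece : ∀ (v : E) (hv : ‖v‖ = 1) (ρ : I → I), Continuous ρ →
      (∀ x t, (F (x, ρ t) : E) ≠ v) → (∀ x t, (G (x, ρ t) : E) ≠ v) →
      ∃ K : I × (X × I) → Sph E, Continuous K ∧ (∀ p, K (0, p) = F (p.1, ρ p.2)) ∧
        (∀ p, K (1, p) = G (p.1, ρ p.2)) ∧
        (∀ s p, F (p.1, ρ p.2) = G (p.1, ρ p.2) → K (s, p) = F (p.1, ρ p.2)) := by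
    intro v hv ρ hρ hFv hGv
    let S := stereographic hv
    have src : ∀ y : Sph E, (y : E) ≠ v → y ∈ S.source := by
      intro y hy
      simp only [S, stereographic_source, mem_compl_iff, mem_singleton_iff]
      intro h; exact hy (by rw [h])
    have cF : Continuous fun p : X × I => S (F (p.1, ρ p.2)) :=
      S.continuousOn.comp_continuous (by fun_prop) (fun p => src _ (hFv _ _))
    have cG : Continuous fun p : X × I => S (G (p.1, ρ p.2)) :=
      S.continuousOn.comp_continuous (by fun_prop) (fun p => src _ (hGv _ _))
    refine ⟨fun q => S.symm ((1 - (q.1 : ℝ)) • S (F (q.2.1, ρ q.2.2)) +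
      (q.1 : ℝ) • S (G (q.2.1, ρ q.2.2))), ?_, ?_, ?_, ?_⟩
    · refine S.continuousOn_symm.comp_continuous ?_ (fun q => by simp [S])
      exact ((by fun_prop : Continuous fun q : I × (X × I) => 1 - (q.1 : ℝ)).smul
        (cF.comp continuous_snd)).add
        ((by fun_prop : Continuous fun q : I × (X × I) => (q.1 : ℝ)).smul
        (cG.comp continuous_snd))
    · intro p; simp [S.left_inv (src _ (hFv p.1 p.2))]
    · intro p; simp [S.left_inv (src _ (hGv p.1 p.2))]
    · intro s p h
      simp only [← h, ← add_smul]
      simp [S.left_inv (src _ (hFv p.1 p.2))]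
  obtain ⟨K1, cK1, K10, K11, K1e⟩ := piece (-e) he' (fun t => min t hf) (by fun_prop)
    (fun x t => h1 _ _ (min_le_right t hf)) (fun x t => h1' _ _ (min_le_right t hf))
  obtain ⟨K2, cK2, K20, K21, K2e⟩ := piece e he (fun t => max t hf) (by fun_prop)
    (fun x t => h2 _ _ (le_max_right t hf)) (fun x t => h2' _ _ (le_max_right t hf))
  refine homRel_mk (fun q => if q.2.2 ≤ hf then K1 q else K2 q) ?_ ?_ ?_ ?_
  · refine Continuous.if_le cK1 cK2 (by fun_prop) continuous_const ?_
    rintro ⟨s, x, t⟩ (rfl : t = hf)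
    rw [K1e _ _ (by simp [hh]), K2e _ _ (by simp [hh])]
    simp
  · rintro ⟨x, t⟩
    by_cases h : t ≤ hf
    · simp [h, K10]
    · simp [h, K20, (not_le.mp h).le]
  · rintro ⟨x, t⟩
    by_cases h : t ≤ hf
    · simp [h, K11]
    · simp [h, K21, (not_le.mp h).le]
  · rintro s ⟨x, t⟩ hz
    have := hZ _ hz
    by_cases h : t ≤ hf
    · simp only [h, if_true]; rw [K1e _ _ (by simp [h, this])]; simp [h]
    · simp only [h, if_false]; rw [K2e _ _ (by simp [(not_le.mp h).le, this])]; simp [(not_le.mp h).le]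
end FL2
end Sk
end

section
set_option autoImplicit false
set_option linter.unusedSectionVars false
open Metric Set unitInterval Module

namespace Sk
section sus
variable {E : Type*} [NormedAddCommGroup E] [InnerProductSpace ℝ E]
variable {E' : Type*} [NormedAddCommGroup E'] [InnerProductSpace ℝ E']

/-- the equator -/
abbrev Equ (e : E) := {y : E // ‖y‖ = 1 ∧ inner ℝ e y = 0}

/-- inclusion of the equator -/
def Equ.toSph {e : E} (y : Equ e) : Sph E := ⟨y.1, by simp [y.2.1]⟩

/-- parameter -/
noncomputable def sp (t : ℝ) : ℝ := 1 - |1 - 2 * t|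

/-- unnormalized suspension -/
noncomputable def susVec (e b y : E) (t : ℝ) : E :=
  (1 - sp t) • b + sp t • y + (sp t * (1 - 2 * t) * (1 - inner ℝ b y)) • e

theorem susVec_map (L : E →ₗᵢ[ℝ] E') (e b y : E) (t : ℝ) :
    L (susVec e b y t) = susVec (L e) (L b) (L y) t := by
  simp [susVec]

theorem sp_symm (t : ℝ) : sp (1 - t) = sp t := by
  unfold sp; congr 1; rw [← abs_neg]; congr 1; ring

theorem susVec_symm (e b y : E) (t : ℝ) : susVec e b y (1 - t) = susVec (-e) b y t := by
  unfold susVec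
  rw [sp_symm, smul_neg, ← neg_smul]; congr 2; ring

theorem sp_cont : Continuous sp := by unfold sp; fun_prop

theorem inner_susVec {e b y : E} (he : ‖e‖ = 1) (hb : inner ℝ e b = 0) (hy : inner ℝ e y = 0)
    (t : ℝ) : inner ℝ e (susVec e b y t) = sp t * (1 - 2 * t) * (1 - inner ℝ b y) := by
  simp [susVec, inner_add_right, inner_smul_right, hb, hy, he]

theorem susVec_ne {e b y : E} (he : ‖e‖ = 1) (hb : ‖b‖ = 1 ∧ inner ℝ e b = 0)
    (hy : ‖y‖ = 1 ∧ inner ℝ e y = 0) (t : ℝ) : susVec e b y t ≠ 0 := by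
  intro h
  have h1 := inner_susVec he hb.2 hy.2 t
  rw [h, inner_zero_right] at h1
  have h2 : (1 - sp t) • b + sp t • y = 0 := by
    rw [← h, susVec, ← h1]; simp
  rcases mul_eq_zero.mp h1.symm with h3 | h3
  · rcases mul_eq_zero.mp h3 with h4 | h4
    · rw [h4] at h2; simp at h2; have := hb.1; rw [h2] at this; simp at this
    · have : sp t = 1 := by unfold sp; rw [h4]; simp
      rw [this] at h2; simp at h2; have := hy.1; rw [h2] at this; simp at this
  · have h5 := congrArg (inner ℝ b) h2
    rw [inner_add_right, inner_smul_right, inner_smul_right, real_inner_self_eq_norm_sq, hb.1,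
      inner_zero_right] at h5
    have : inner ℝ b y = (1 : ℝ) := by linarith
    rw [this] at h5; norm_num at h5

/-- suspension -/
noncomputable def Sus (e : E) (he : ‖e‖ = 1) (b : Equ e) : C(Equ e × I, Sph E) :=
  nrm (fun p => susVec e b.1 p.1.1 p.2) (by
    unfold susVec
    have : Continuous fun p : Equ e × I => sp p.2 := sp_cont.comp (by fun_prop)
    fun_prop) (fun p => susVec_ne he b.2 p.1.2 p.2)

variable (e : E) (he : ‖e‖ = 1) (b : Equ e)

theorem Sus_coe (p : Equ e × I) : (Sus e he b p : E) =
    ‖susVec e b.1 p.1.1 p.2‖⁻¹ • susVec e b.1 p.1.1 p.2 := rfl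

theorem Sus_zero (y : Equ e) : Sus e he b (y, 0) = b.toSph := by
  apply nrm_eq; simp [susVec, sp, Equ.toSph]

theorem Sus_one (y : Equ e) : Sus e he b (y, 1) = b.toSph := by
  apply nrm_eq; simp [susVec, sp, Equ.toSph]; norm_num

theorem Sus_base (t : I) : Sus e he b (b, t) = b.toSph := by
  apply nrm_eq; simp [susVec, Equ.toSph, b.2.1, ← add_smul]

theorem Sus_half (y : Equ e) : Sus e he b (y, hf) = y.toSph := by
  apply nrm_eq; simp [susVec, sp, Equ.toSph, hf]

theorem sp_nonneg (t : I) : 0 ≤ sp t := by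
  have := t.2.1; have := t.2.2
  unfold sp; rw [sub_nonneg, abs_le]; constructor <;> linarith

theorem inner_Sus (y : Equ e) (t : I) :
    inner ℝ e (Sus e he b (y, t) : E) = ‖susVec e b.1 y.1 t‖⁻¹ * (sp t * (1 - 2 * t) *
      (1 - inner ℝ b.1 y.1)) := by
  rw [Sus_coe, inner_smul_right, inner_susVec he b.2.2 y.2.2]

theorem inner_b_le (y : Equ e) : 0 ≤ 1 - inner ℝ b.1 y.1 := by
  have := real_inner_le_norm b.1 y.1
  rw [b.2.1, y.2.1] at this; linarith

theorem Sus_ne1 (y : Equ e) (t : I) (ht : (t : ℝ) ≤ 1 / 2) : (Sus e he b (y, t) : E) ≠ -e := by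
  intro h
  have h1 := inner_Sus e he b y t
  rw [h, inner_neg_right, real_inner_self_eq_norm_sq, he] at h1
  have h2 : 0 ≤ ‖susVec e b.1 y.1 t‖⁻¹ * (sp t * (1 - 2 * t) * (1 - inner ℝ b.1 y.1)) :=
    mul_nonneg (by positivity) (mul_nonneg (mul_nonneg (sp_nonneg t) (by linarith))
      (inner_b_le e b y))
  linarith

theorem Sus_ne2 (y : Equ e) (t : I) (ht : 1 / 2 ≤ (t : ℝ)) : (Sus e he b (y, t) : E) ≠ e := by
  intro h
  have h1 := inner_Sus e he b y t
  rw [h, real_inner_self_eq_norm_sq, he] at h1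
  have h2 : 0 ≤ ‖susVec e b.1 y.1 t‖⁻¹ * (sp t * (2 * t - 1) * (1 - inner ℝ b.1 y.1)) :=
    mul_nonneg (by positivity) (mul_nonneg (mul_nonneg (sp_nonneg t) (by linarith))
      (inner_b_le e b y))
  nlinarith

/-- the suspension of a map -/
noncomputable def susMap {X : Type*} [TopologicalSpace X] (h : C(X, Equ e)) : C(X × I, Sph E) :=
  (Sus e he b).comp ⟨fun p => (h p.1, p.2), by fun_prop⟩

theorem susMap_apply {X : Type*} [TopologicalSpace X] (h : C(X, Equ e)) (x : X) (t : I) :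
    susMap e he b h (x, t) = Sus e he b (h x, t) := rfl

theorem susMap_Zc {X : Type*} [TopologicalSpace X] (h : C(X, Equ e)) (A : Set X)
    (hA : ∀ x ∈ A, h x = b) : ∀ z ∈ Zc A, susMap e he b h z = b.toSph := by
  rintro ⟨x, t⟩ (hx | hx | hx)
  · rw [susMap_apply, hA x hx, Sus_base]
  · simp only at hx; rw [hx, susMap_apply, Sus_zero]
  · simp only at hx; rw [hx, susMap_apply, Sus_one]

theorem susMap_homRel {X : Type*} [TopologicalSpace X] {h h' : C(X, Equ e)} {A : Set X}
    (hA : ∀ x ∈ A, h x = b) (H : ContinuousMap.HomotopicRel h h' A) :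
    ContinuousMap.HomotopicRel (susMap e he b h) (susMap e he b h') (Zc A) := by
  obtain ⟨K⟩ := H
  refine homRel_mk (fun q => Sus e he b (K (q.1, q.2.1), q.2.2)) (by fun_prop) ?_ ?_ ?_
  · rintro ⟨x, t⟩; simp [susMap_apply]
  · rintro ⟨x, t⟩; simp [susMap_apply]
  · rintro s ⟨x, t⟩ hz
    rw [susMap_Zc e he b h A hA _ hz]
    rcases hz with hx | hx | hx
    · simp only at hx ⊢
      rw [K.eq_fst s hx, hA x hx, Sus_base]
    · simp only at hx ⊢; rw [hx, Sus_zero]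
    · simp only at hx ⊢; rw [hx, Sus_one]

/-- Freudenthal lemma -/
theorem FL [FiniteDimensional ℝ E]
    {G : Type*} [NormedAddCommGroup G] [NormedSpace ℝ G] [FiniteDimensional ℝ G]
    {X : Type*} [TopologicalSpace X] [CompactSpace X] [T2Space X] (A : Set X) (j : C(X, G))
    (hj : Function.Injective j)
    (hdim : finrank ℝ G + 2 < 2 * finrank ℝ (ℝ ∙ e)ᗮ) (F : C(X × I, Sph E))
    (hF : ∀ z ∈ Zc A, F z = b.toSph) :
    ∃ h : C(X, Equ e), (∀ x ∈ A, h x = b) ∧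
      ContinuousMap.HomotopicRel F (susMap e he b h) (Zc A) := by
  have hb : inner ℝ e (b.toSph : E) = 0 := b.2.2
  obtain ⟨F1, H1, n1⟩ := FL1 j hj e he hdim F (Zc A) (fun z hz => by rw [hF z hz]; exact hb)
  have z1 : ∀ z ∈ Zc A, F1 z = b.toSph := fun z hz => by rw [← H1.fst_eq_snd hz, hF z hz]
  obtain ⟨F2, H2, n2, n2'⟩ := FL2 A e b.toSph hb he F1 z1 n1
  have z2 : ∀ z ∈ Zc A, F2 z = b.toSph := fun z hz => by rw [← H2.fst_eq_snd hz, z1 z hz]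
  obtain ⟨F3, H3, n3, n3', h3⟩ := FL3a A e b.toSph hb he F2 z2 n2 n2'
  have z3 : ∀ z ∈ Zc A, F3 z = b.toSph := fun z hz => by rw [← H3.fst_eq_snd hz, z2 z hz]
  let h : C(X, Equ e) := ⟨fun x => ⟨(F3 (x, hf) : E), norm_eq_of_mem_sphere _, h3 x⟩, by fun_prop⟩
  have hA : ∀ x ∈ A, h x = b := by
    intro x hx
    apply Subtype.ext
    have := z3 (x, hf) (Or.inl hx)
    simp only [h, ContinuousMap.coe_mk, this]; rfl
  refine ⟨h, hA, (H1.trans H2).trans (H3.trans ?_)⟩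
  apply FL3b A e he
  · intro z hz; rw [z3 z hz, susMap_Zc e he b h A hA z hz]
  · exact n3
  · exact n3'
  · intro x t; exact Sus_ne1 e he b _ t
  · intro x t; exact Sus_ne2 e he b _ t
  · intro x; rw [susMap_apply, Sus_half]; rfl
end sus
end Sk
end

section
set_option autoImplicit false
set_option linter.unusedSectionVars false
open Metric Set unitInterval Module Quaternion

namespace Sk
/-- subdivision points -/
noncomputable def tau (n k : ℕ) : I := projIcc 0 1 zero_le_one ((k : ℝ) / n)

theorem tau_zero (n : ℕ) : tau n 0 = 0 := by
  unfold tau; apply projIcc_of_le_left; simp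
theorem tau_self (n : ℕ) (hn : 0 < n) : tau n n = 1 := by
  unfold tau; apply projIcc_of_right_le
  rw [div_self (by positivity)]
theorem tau_dist (n k : ℕ) : |(tau n (k + 1) : ℝ) - tau n k| ≤ 1 / n := by
  have := (LipschitzWith.projIcc (zero_le_one : (0 : ℝ) ≤ 1)).dist_le_mul
    (((k + 1 : ℕ) : ℝ) / n) ((k : ℝ) / n)
  rw [Subtype.dist_eq, Real.dist_eq, Real.dist_eq] at this
  refine this.trans ?_
  simp only [NNReal.coe_one, one_mul]
  rw [← sub_div]; push_cast
  rw [add_sub_cancel_left, abs_of_nonneg (by positivity)]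

theorem exists_subdiv {X Y : Type*} [PseudoMetricSpace X] [CompactSpace X] [PseudoMetricSpace Y]
    (v : C(X × I, Y)) (ε : ℝ) (hε : 0 < ε) :
    ∃ n : ℕ, 0 < n ∧ ∀ x (t : I) k, dist (v (x, t * tau n (k + 1))) (v (x, t * tau n k)) < ε := by
  have := CompactSpace.uniformContinuous_of_continuous v.continuous
  obtain ⟨δ, hδ, h⟩ := Metric.uniformContinuous_iff.mp this ε hε
  obtain ⟨n, hn⟩ := exists_nat_one_div_lt hδ
  refine ⟨n + 1, by omega, fun x t k => h ?_⟩
  rw [Prod.dist_eq, dist_self, max_lt_iff]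
  refine ⟨hδ, ?_⟩
  rw [Subtype.dist_eq, Real.dist_eq]
  simp only [Set.Icc.coe_mul]
  rw [← mul_sub, abs_mul, abs_of_nonneg t.2.1]
  have h1 := tau_dist (n + 1) k
  have h2 := t.2.2
  have h3 := t.2.1
  push_cast at h1
  have : (t : ℝ) * |(tau (n + 1) (k + 1) : ℝ) - tau (n + 1) k| ≤ 1 / (n + 1) := by
    nlinarith [abs_nonneg ((tau (n + 1) (k + 1) : ℝ) - tau (n + 1) k)]
  linarith

/-- circle lifting -/
theorem circle_lift {X : Type*} [PseudoMetricSpace X] [CompactSpace X] (w : C(X × I, ℂ))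
    (hw : ∀ p, ‖w p‖ = 1) (h0 : ∀ x, w (x, 0) = 1) :
    ∃ θ : C(X × I, ℝ), (∀ p, Complex.exp (θ p * Complex.I) = w p) ∧ (∀ x, θ (x, 0) = 0) ∧
      ∀ x, (∀ t, w (x, t) = 1) → ∀ t, θ (x, t) = 0 := by
  obtain ⟨n, hn, hs⟩ := exists_subdiv w 1 one_pos
  have key : ∀ k : ℕ, ∃ θ : C(X × I, ℝ),
      (∀ p, Complex.exp (θ p * Complex.I) = w (p.1, p.2 * tau n k)) ∧ (∀ x, θ (x, 0) = 0) ∧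
      ∀ x, (∀ t, w (x, t) = 1) → ∀ t, θ (x, t) = 0 := by
    intro k
    induction k with
    | zero =>
      refine ⟨⟨fun _ => 0, continuous_const⟩, ?_, ?_, ?_⟩
      · intro p; simp [tau_zero, h0]
      · simp
      · simp
    | succ k ih =>
      obtain ⟨θ, h1, h2, h3⟩ := ih
      let z : X × I → ℂ := fun p => w (p.1, p.2 * tau n (k + 1)) *
        (starRingEnd ℂ) (w (p.1, p.2 * tau n k))
      have hz : Continuous z := by fun_prop
      have nz : ∀ p, ‖z p‖ = 1 := fun p => by simp [z, hw]
      have hsl : ∀ p, z p ∈ Complex.slitPlane := by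
        intro p
        rw [Complex.mem_slitPlane_iff]; left
        have h5 : ‖z p - 1‖ < 1 := by
          have e1 : (1 : ℂ) = w (p.1, p.2 * tau n k) * (starRingEnd ℂ) (w (p.1, p.2 * tau n k)) := by
            rw [Complex.mul_conj, Complex.normSq_eq_norm_sq, hw]; simp
          rw [e1]; simp only [z]
          rw [← sub_mul, norm_mul, RCLike.norm_conj, hw, mul_one, ← dist_eq_norm]
          exact hs _ _ _
        have h6 := (abs_le.mp (Complex.abs_re_le_norm (z p - 1))).1
        simp only [Complex.sub_re, Complex.one_re] at h6
        linarith
      have ca : Continuous fun p => Complex.arg (z p) := by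
        rw [continuous_iff_continuousAt]
        intro p
        exact ContinuousAt.comp (Complex.continuousAt_arg (hsl p)) hz.continuousAt
      refine ⟨⟨fun p => θ p + Complex.arg (z p), by fun_prop⟩, ?_, ?_, ?_⟩
      · intro p
        simp only [ContinuousMap.coe_mk]
        push_cast
        have e2 : Complex.exp (Complex.arg (z p) * Complex.I) = z p := by
          have := Complex.norm_mul_exp_arg_mul_I (z p)
          rwa [nz, Complex.ofReal_one, one_mul] at this
        rw [add_mul, Complex.exp_add, h1, e2]
        simp only [z]
        rw [mul_comm, mul_assoc, mul_comm ((starRingEnd ℂ) _), Complex.mul_conj,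
          Complex.normSq_eq_norm_sq, hw]
        simp
      · intro x; simp [h2, z, h0]
      · intro x hx t; simp [h3 x hx, z, hx]
  obtain ⟨θ, h1, h2, h3⟩ := key n
  refine ⟨θ, ?_, h2, h3⟩
  intro p; rw [h1, tau_self n hn, mul_one]

/-- the quaternion unit i -/
def qi : ℍ[ℝ] := ⟨0, 1, 0, 0⟩
/-- the quaternion unit j -/
def qj : ℍ[ℝ] := ⟨0, 0, 1, 0⟩
/-- the quaternion unit k -/
def qk : ℍ[ℝ] := ⟨0, 0, 0, 1⟩

@[simp] theorem qi_re : qi.re = 0 := rfl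
@[simp] theorem qi_imI : qi.imI = 1 := rfl
@[simp] theorem qi_imJ : qi.imJ = 0 := rfl
@[simp] theorem qi_imK : qi.imK = 0 := rfl
@[simp] theorem qj_re : qj.re = 0 := rfl
@[simp] theorem qj_imI : qj.imI = 0 := rfl
@[simp] theorem qj_imJ : qj.imJ = 1 := rfl
@[simp] theorem qj_imK : qj.imK = 0 := rfl
@[simp] theorem qk_re : qk.re = 0 := rfl
@[simp] theorem qk_imI : qk.imI = 0 := rfl
@[simp] theorem qk_imJ : qk.imJ = 0 := rfl
@[simp] theorem qk_imK : qk.imK = 1 := rfl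

theorem norm_one_iff (q : ℍ[ℝ]) : ‖q‖ = 1 ↔ q.re ^ 2 + q.imI ^ 2 + q.imJ ^ 2 + q.imK ^ 2 = 1 := by
  rw [← Quaternion.normSq_def', Quaternion.normSq_eq_norm_mul_self]
  constructor
  · intro h; rw [h]; norm_num
  · intro h
    nlinarith [norm_nonneg q]

theorem inner_coord (p q : ℍ[ℝ]) : inner ℝ p q =
    p.re * q.re + p.imI * q.imI + p.imJ * q.imJ + p.imK * q.imK := by
  rw [Quaternion.inner_def]; simp

theorem nqi : ‖qi‖ = 1 := by rw [norm_one_iff]; simp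
theorem nqj : ‖qj‖ = 1 := by rw [norm_one_iff]; simp
theorem nqk : ‖qk‖ = 1 := by rw [norm_one_iff]; simp

theorem star_mul_of_norm {q : ℍ[ℝ]} (h : ‖q‖ = 1) : star q * q = 1 := by
  rw [Quaternion.star_mul_self, Quaternion.normSq_eq_norm_mul_self, h]; simp
theorem mul_star_of_norm {q : ℍ[ℝ]} (h : ‖q‖ = 1) : q * star q = 1 := by
  rw [Quaternion.self_mul_star, Quaternion.normSq_eq_norm_mul_self, h]; simp

theorem rot_step {T : Type*} [TopologicalSpace T] (v v' : C(T, ℍ[ℝ])) (hv : ∀ p, v p * v p = -1)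
    (hv' : ∀ p, v' p * v' p = -1) (hne : ∀ p, v' p ≠ - v p) :
    ∃ r : C(T, Sph ℍ[ℝ]), (∀ p, v p * (r p : ℍ[ℝ]) = r p * v' p) ∧
      ∀ p, v p = v' p → (r p : ℍ[ℝ]) = 1 := by
  have h0 : ∀ p, 1 - v p * v' p ≠ 0 := by
    intro p h
    apply hne p
    have h1 : v p * v' p = 1 := (sub_eq_zero.mp h).symm
    have h2 : v p * (v p * v' p) = v p := by rw [h1, mul_one]
    rw [← mul_assoc, hv, neg_one_mul] at h2
    rw [← h2, neg_neg]
  refine ⟨nrm (fun p => 1 - v p * v' p) (by fun_prop) h0, ?_, ?_⟩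
  · intro p
    rw [nrm_coe, mul_smul_comm, smul_mul_assoc]
    congr 1
    rw [mul_sub, sub_mul, ← mul_assoc, hv, mul_assoc (v p), hv']
    simp [add_comm]
  · intro p h
    rw [nrm_coe]
    have : 1 - v p * v' p = ((2 : ℝ) : ℍ[ℝ]) := by
      rw [← h, hv]; ext <;> simp <;> norm_num
    rw [this, Quaternion.norm_coe]
    ext <;> simp

theorem qi_sq : qi * qi = -1 := by ext <;> simp

theorem rot_lift {X : Type*} [PseudoMetricSpace X] [CompactSpace X] (v : C(X × I, ℍ[ℝ]))
    (hv : ∀ p, v p * v p = -1) (h0 : ∀ x, v (x, 0) = qi) :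
    ∃ g : C(X × I, Sph ℍ[ℝ]), (∀ p, qi * (g p : ℍ[ℝ]) = g p * v p) ∧ (∀ x, g (x, 0) = 1) ∧
      ∀ x, (∀ t, v (x, t) = qi) → ∀ t, g (x, t) = 1 := by
  have nv : ∀ p, ‖v p‖ = 1 := by
    intro p
    have := congrArg norm (hv p)
    rw [norm_mul, norm_neg, norm_one] at this
    nlinarith [norm_nonneg (v p)]
  obtain ⟨n, hn, hs⟩ := exists_subdiv v 1 one_pos
  have key : ∀ k : ℕ, ∃ g : C(X × I, Sph ℍ[ℝ]),
      (∀ p, qi * (g p : ℍ[ℝ]) = g p * v (p.1, p.2 * tau n k)) ∧ (∀ x, g (x, 0) = 1) ∧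
      ∀ x, (∀ t, v (x, t) = qi) → ∀ t, g (x, t) = 1 := by
    intro k
    induction k with
    | zero =>
      refine ⟨⟨fun _ => 1, continuous_const⟩, ?_, ?_, ?_⟩
      · intro p; simp [tau_zero, h0]
      · simp
      · simp
    | succ k ih =>
      obtain ⟨g, h1, h2, h3⟩ := ih
      obtain ⟨r, r1, r2⟩ := rot_step (T := X × I) ⟨fun p => v (p.1, p.2 * tau n k), by fun_prop⟩
        ⟨fun p => v (p.1, p.2 * tau n (k + 1)), by fun_prop⟩ (fun p => hv _) (fun p => hv _) (by
          intro p h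
          simp only [ContinuousMap.coe_mk] at h
          have h5 := hs p.1 p.2 k
          rw [h, dist_eq_norm] at h5
          have h6 : -v (p.1, p.2 * tau n k) - v (p.1, p.2 * tau n k)
            = (-2 : ℝ) • v (p.1, p.2 * tau n k) := by
            rw [neg_smul, two_smul]; abel
          rw [h6, norm_smul, nv] at h5
          norm_num at h5)
      simp only [ContinuousMap.coe_mk] at r1 r2
      refine ⟨g * r, ?_, ?_, ?_⟩
      · intro p
        rw [ContinuousMap.mul_apply, Metric.unitSphere.coe_mul, ← mul_assoc, h1, mul_assoc, r1,
          ← mul_assoc]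
      · intro x
        rw [ContinuousMap.mul_apply, h2, one_mul]
        exact Subtype.ext (r2 _ (by simp))
      · intro x hx t
        rw [ContinuousMap.mul_apply, h3 x hx, one_mul]
        exact Subtype.ext (r2 _ (by simp [hx]))
  obtain ⟨g, h1, h2, h3⟩ := key n
  refine ⟨g, ?_, h2, h3⟩
  intro p; rw [h1, tau_self n hn, mul_one]
end Sk
end

section
set_option autoImplicit false
set_option linter.unusedSectionVars false
open Metric Set unitInterval Module Quaternion

namespace Sk
/-- base point of the equator -/
noncomputable def b1 : Equ qi := ⟨1, by simp, by rw [inner_coord]; simp⟩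

theorem b1_toSph : b1.toSph = (1 : Sph ℍ[ℝ]) := rfl

theorem coord_of_sph (g : Sph ℍ[ℝ]) :
    (g : ℍ[ℝ]).re ^ 2 + (g : ℍ[ℝ]).imI ^ 2 + (g : ℍ[ℝ]).imJ ^ 2 + (g : ℍ[ℝ]).imK ^ 2 = 1 :=
  (norm_one_iff _).mp (norm_eq_of_mem_sphere g)

/-- The Hopf map -/
noncomputable def hop : C(Sph ℍ[ℝ], Equ qi) :=
  ⟨fun g => ⟨star (g : ℍ[ℝ]) * qi * g * (-qi), by
      rw [norm_mul, norm_mul, norm_mul, norm_neg, norm_star, nqi, norm_eq_of_mem_sphere]; simp, by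
      rw [inner_coord]; simp; ring⟩, by fun_prop⟩

theorem hop_coe (g : Sph ℍ[ℝ]) : (hop g).1 = star (g : ℍ[ℝ]) * qi * g * (-qi) := rfl

theorem hop_one : hop 1 = b1 := by
  apply Subtype.ext
  rw [hop_coe]; simp [qi_sq, b1]

/-- ends -/
def Z1 : Set I := {0, 1}
/-- boundary of square -/
def Z2 : Set (I × I) := Zc Z1
/-- boundary of cube -/
def Z3 : Set ((I × I) × I) := Zc Z2
/-- boundary of 4-cube -/
def Z4 : Set (((I × I) × I) × I) := Zc Z3

/-- quaternion from coordinates -/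
def mkQ (a b c d : ℝ) : ℍ[ℝ] := ⟨a, b, c, d⟩
@[simp] theorem mkQ_re (a b c d : ℝ) : (mkQ a b c d).re = a := rfl
@[simp] theorem mkQ_imI (a b c d : ℝ) : (mkQ a b c d).imI = b := rfl
@[simp] theorem mkQ_imJ (a b c d : ℝ) : (mkQ a b c d).imJ = c := rfl
@[simp] theorem mkQ_imK (a b c d : ℝ) : (mkQ a b c d).imK = d := rfl

/-- exponential -/
noncomputable def ee (θ : ℝ) : Sph ℍ[ℝ] := ⟨mkQ (Real.cos θ) (Real.sin θ) 0 0, by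
  rw [mem_sphere_zero_iff_norm, norm_one_iff]; simp⟩
theorem ee_coe (θ : ℝ) : (ee θ : ℍ[ℝ]) = mkQ (Real.cos θ) (Real.sin θ) 0 0 := rfl

theorem cont_quat {T : Type*} [TopologicalSpace T] {a b c d : T → ℝ} (ha : Continuous a)
    (hb : Continuous b) (hc : Continuous c) (hd : Continuous d) :
    Continuous fun t => mkQ (a t) (b t) (c t) (d t) := by
  have : (fun t => mkQ (a t) (b t) (c t) (d t)) = fun t =>
      a t • (1 : ℍ[ℝ]) + b t • qi + c t • qj + d t • qk := by
    funext t; ext <;> simp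
  rw [this]; fun_prop

theorem ee_cont : Continuous ee := by
  apply Continuous.subtype_mk
  exact cont_quat (by fun_prop) (by fun_prop) (by fun_prop) (by fun_prop)

theorem ee_zero : ee 0 = 1 := by
  apply Subtype.ext; rw [ee_coe]; ext <;> simp

theorem qi_ee (θ : ℝ) : qi * (ee θ : ℍ[ℝ]) = ee θ * qi := by
  rw [ee_coe]; ext <;> simp

theorem int_lift_const (f : C(I, ℝ)) (h : ∀ t, ∃ n : ℤ, f t = n * (2 * Real.pi)) (t : I) :
    f t = f 0 := by
  have hpi := Real.pi_pos
  have : IsPreconnected (range fun t : I => f t / (2 * Real.pi)) :=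
    isPreconnected_range (by fun_prop)
  have hsub : (range fun t : I => f t / (2 * Real.pi)) ⊆ range ((↑) : ℤ → ℝ) := by
    rintro _ ⟨t, rfl⟩
    obtain ⟨n, hn⟩ := h t
    exact ⟨n, by simp only; rw [hn]; field_simp⟩
  have hc : (range ((↑) : ℤ → ℝ)).Countable := countable_range _
  have hs : (range fun t : I => f t / (2 * Real.pi)).Subsingleton := by
    exact (hc.mono hsub).isTotallyDisconnected _ le_rfl this
  have := hs (mem_range_self t) (mem_range_self 0)
  field_simp at this
  exact this

theorem hopf_lift (h : C((I × I) × I, Equ qi)) (hZ : ∀ z ∈ Z3, h z = b1) :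
    ∃ g : C((I × I) × I, Sph ℍ[ℝ]), (∀ z ∈ Z3, g z = 1) ∧ ∀ p, hop (g p) = h p := by
  let v : C((I × I) × I, ℍ[ℝ]) := ⟨fun p => (h p).1 * qi, by fun_prop⟩
  have hv : ∀ p, v p * v p = -1 := by
    intro p
    have h1 := (norm_one_iff _).mp (h p).2.1
    have h2 := (h p).2.2
    rw [inner_coord] at h2
    simp at h2
    rw [h2] at h1
    ext <;> simp [v, h2] <;> nlinarith
  have hvZ : ∀ z ∈ Z3, v z = qi := by
    intro z hz; simp [v, hZ z hz, b1]
  obtain ⟨g, g1, g2, g3⟩ := rot_lift v hv (fun x => hvZ _ (Or.inr (Or.inl rfl)))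
  have gA : ∀ x ∈ Z2, ∀ t, g (x, t) = 1 := fun x hx => g3 x (fun t => hvZ _ (Or.inl hx))
  -- the end face
  have hend : ∀ x, (g (x, 1) : ℍ[ℝ]).imJ = 0 ∧ (g (x, 1) : ℍ[ℝ]).imK = 0 := by
    intro x
    have h1 := g1 (x, 1)
    rw [hvZ _ (Or.inr (Or.inr rfl))] at h1
    have h2 := congrArg QuaternionAlgebra.imJ h1
    have h3 := congrArg QuaternionAlgebra.imK h1
    simp at h2 h3
    constructor <;> linarith
  let w : C(I × I, ℂ) := ⟨fun x => ((g (x, 1) : ℍ[ℝ]).re : ℂ) + ((g (x, 1) : ℍ[ℝ]).imI : ℂ)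
    * Complex.I, by
      have := Quaternion.continuous_re
      have := Quaternion.continuous_imI
      fun_prop⟩
  have wre : ∀ x, (w x).re = (g (x, 1) : ℍ[ℝ]).re := fun x => by simp [w]
  have wim : ∀ x, (w x).im = (g (x, 1) : ℍ[ℝ]).imI := fun x => by simp [w]
  have hw : ∀ x, ‖w x‖ = 1 := by
    intro x
    have h1 := coord_of_sph (g (x, 1))
    rw [(hend x).1, (hend x).2] at h1
    rw [Complex.norm_eq_sqrt_sq_add_sq, Real.sqrt_eq_one, wre, wim]; linarith
  have w1 : ∀ x ∈ Z2, w x = 1 := by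
    intro x hx; simp [w, gA x hx]
  obtain ⟨θ, t1, t2, t3⟩ := circle_lift w hw (fun x => w1 _ (Or.inr (Or.inl rfl)))
  have tA : ∀ x ∈ Z1, ∀ t, θ (x, t) = 0 := fun x hx => t3 x (fun t => w1 _ (Or.inl hx))
  have tZ : ∀ x ∈ Z2, θ x = 0 := by
    rintro ⟨x, t⟩ (hx | hx | hx)
    · exact tA _ hx _
    · simp only at hx; rw [hx]; exact t2 x
    · simp only at hx; rw [hx]
      have := int_lift_const ⟨fun x => θ (x, 1), by fun_prop⟩ (by
        intro x
        have h1 := t1 (x, 1)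
        rw [w1 _ (Or.inr (Or.inr rfl)), Complex.exp_eq_one_iff] at h1
        obtain ⟨n, hn⟩ := h1
        refine ⟨n, ?_⟩
        have := congrArg Complex.im hn
        simpa using this) x
      simp only [ContinuousMap.coe_mk] at this
      rw [this]; exact tA 0 (by simp [Z1]) 1
  let g' : C((I × I) × I, Sph ℍ[ℝ]) := ⟨fun p => ee (-((p.2 : ℝ) * θ p.1)) * g p, by
    have := ee_cont; fun_prop⟩
  refine ⟨g', ?_, ?_⟩
  · rintro ⟨x, t⟩ (hx | hx | hx)
    · simp only at hx
      simp [g', tZ x hx, gA x hx, ee_zero]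
    · simp only at hx
      simp [g', hx, ee_zero, g2]
    · simp only at hx
      simp only [g', hx, ContinuousMap.coe_mk]
      have hx1 := t1 x
      have e1 : Real.cos (θ x) = (g (x, 1) : ℍ[ℝ]).re := by
        rw [← wre, ← t1, Complex.exp_ofReal_mul_I_re]
      have e2 : Real.sin (θ x) = (g (x, 1) : ℍ[ℝ]).imI := by
        rw [← wim, ← t1, Complex.exp_ofReal_mul_I_im]
      have : g (x, 1) = ee (θ x) := by
        apply Subtype.ext
        ext
        · rw [← e1]; rfl
        · rw [← e2]; rfl
        · exact (hend x).1
        · exact (hend x).2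
      rw [this]
      apply Subtype.ext
      have hc := Real.cos_sq_add_sin_sq (θ x)
      rw [Metric.unitSphere.coe_mul]
      rw [ee_coe, ee_coe]
      ext <;> simp <;> nlinarith
  · intro p
    apply Subtype.ext
    have h1 : qi * (g' p : ℍ[ℝ]) = g' p * v p := by
      simp only [g', ContinuousMap.coe_mk, Metric.unitSphere.coe_mul]
      rw [← mul_assoc, qi_ee, mul_assoc, g1, ← mul_assoc]
    rw [hop_coe, mul_assoc (star _), h1, ← mul_assoc,
      star_mul_of_norm (norm_eq_of_mem_sphere _), one_mul]
    simp only [v, ContinuousMap.coe_mk]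
    rw [mul_assoc, mul_neg, qi_sq]; simp
end Sk
end

section
set_option autoImplicit false
set_option linter.unusedSectionVars false
open Metric Set unitInterval Module Quaternion

namespace Sk
theorem qi_ne : qi ≠ 0 := by intro h; have := nqi; rw [h] at this; simp at this

theorem finrank_qi : finrank ℝ (ℝ ∙ qi)ᗮ = 3 := by
  haveI : Fact (finrank ℝ ℍ[ℝ] = 3 + 1) := ⟨Quaternion.finrank_eq_four⟩
  exact Submodule.finrank_orthogonal_span_singleton qi_ne

/-- coordinates of the cube -/
def cube3 : C((I × I) × I, (ℝ × ℝ) × ℝ) :=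
  ⟨fun p => ((p.1.1, p.1.2), p.2), by fun_prop⟩
theorem cube3_inj : Function.Injective cube3 := by
  rintro ⟨⟨a, b⟩, c⟩ ⟨⟨a', b'⟩, c'⟩ h
  simp only [cube3, ContinuousMap.coe_mk, Prod.mk.injEq, Subtype.coe_inj] at h
  simp [h]
/-- coordinates of the square -/
def cube2 : C(I × I, ℝ × ℝ) := ⟨fun p => (p.1, p.2), by fun_prop⟩
theorem cube2_inj : Function.Injective cube2 := by
  rintro ⟨a, b⟩ ⟨a', b'⟩ h
  simp only [cube2, ContinuousMap.coe_mk, Prod.mk.injEq, Subtype.coe_inj] at h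
  simp [h]

/-- suspension for the quaternions -/
noncomputable abbrev sus {X : Type*} [TopologicalSpace X] (h : C(X, Equ qi)) : C(X × I, Sph ℍ[ℝ]) :=
  susMap qi nqi b1 h

theorem fl4 (F : C(((I × I) × I) × I, Sph ℍ[ℝ])) (hF : ∀ z ∈ Z4, F z = 1) :
    ∃ h : C((I × I) × I, Equ qi), (∀ x ∈ Z3, h x = b1) ∧
      ContinuousMap.HomotopicRel F (sus h) Z4 :=
  FL qi nqi b1 Z3 cube3 cube3_inj (by rw [finrank_qi]; simp) F hF

theorem fl3 (F : C((I × I) × I, Sph ℍ[ℝ])) (hF : ∀ z ∈ Z3, F z = 1) :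
    ∃ h : C(I × I, Equ qi), (∀ x ∈ Z2, h x = b1) ∧
      ContinuousMap.HomotopicRel F (sus h) Z3 :=
  FL qi nqi b1 Z2 cube2 cube2_inj (by rw [finrank_qi]; simp) F hF

/-- the hyperplane -/
noncomputable abbrev V := (ℝ ∙ qi)ᗮ

theorem mem_V {q : ℍ[ℝ]} : q ∈ V ↔ q.imI = 0 := by
  rw [Submodule.mem_orthogonal_singleton_iff_inner_right, inner_coord]; simp

/-- k as a vector of V -/
noncomputable def e2 : V := ⟨qk, mem_V.mpr (by simp)⟩
theorem ne2 : ‖e2‖ = 1 := nqk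
theorem e2_ne : e2 ≠ 0 := by intro h; have := ne2; rw [h] at this; simp at this
theorem finrank_e2 : finrank ℝ (ℝ ∙ e2)ᗮ = 2 := by
  haveI : Fact (finrank ℝ V = 2 + 1) := ⟨finrank_qi⟩
  exact Submodule.finrank_orthogonal_span_singleton e2_ne

theorem inner_e2 (y : V) : inner ℝ e2 y = (y : ℍ[ℝ]).imK := by
  rw [Submodule.coe_inner, inner_coord]; simp [e2]

/-- points of the circle -/
noncomputable def cir (θ : ℝ) : Equ e2 :=
  ⟨⟨mkQ (Real.cos θ) 0 (Real.sin θ) 0, mem_V.mpr (by simp)⟩, by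
    change ‖mkQ (Real.cos θ) 0 (Real.sin θ) 0‖ = 1
    rw [norm_one_iff]; simp, by rw [inner_e2]; simp⟩

theorem cir_cont : Continuous cir := by
  refine Continuous.subtype_mk (Continuous.subtype_mk ?_ _) _
  exact cont_quat (by fun_prop) (by fun_prop) (by fun_prop) (by fun_prop)

theorem cir_coe (θ : ℝ) : ((cir θ).1 : ℍ[ℝ]) = mkQ (Real.cos θ) 0 (Real.sin θ) 0 := rfl

/-- base point -/
noncomputable def b2 : Equ e2 := cir 0

theorem cir_int (n : ℤ) : cir (n * (2 * Real.pi)) = b2 := by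
  apply Subtype.ext; apply Subtype.ext
  rw [b2, cir_coe, cir_coe, Real.cos_int_mul_two_pi]
  have : Real.sin (n * (2 * Real.pi)) = 0 := by
    have := Real.sin_int_mul_pi (n * 2)
    rw [← this]; push_cast; ring_nf
  rw [this]; simp

/-- to V -/
noncomputable def toV : C(Equ qi, Sph V) :=
  ⟨fun y => ⟨⟨y.1, Submodule.mem_orthogonal_singleton_iff_inner_right.mpr y.2.2⟩, by
    rw [mem_sphere_zero_iff_norm]; exact y.2.1⟩, by fun_prop⟩
/-- from V -/
noncomputable def fromV : C(Sph V, Equ qi) :=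
  ⟨fun y => ⟨y.1.1, norm_eq_of_mem_sphere y,
    Submodule.mem_orthogonal_singleton_iff_inner_right.mp y.1.2⟩, by fun_prop⟩
theorem from_to (y : Equ qi) : fromV (toV y) = y := rfl
theorem fromV_b2 : fromV b2.toSph = b1 := by
  apply Subtype.ext
  change mkQ (Real.cos 0) 0 (Real.sin 0) 0 = (1 : ℍ[ℝ])
  ext <;> simp
theorem toV_b1 : toV b1 = b2.toSph := by
  rw [← fromV_b2]; rfl

theorem fl2 (F : C(I × I, Equ qi)) (hF : ∀ z ∈ Z2, F z = b1) :
    ∃ h : C(I, Equ e2), (∀ x ∈ Z1, h x = b2) ∧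
      ContinuousMap.HomotopicRel F (fromV.comp (susMap e2 ne2 b2 h)) Z2 := by
  obtain ⟨h, h1, h2⟩ := FL e2 ne2 b2 Z1 (⟨fun p => (p : ℝ), by fun_prop⟩ : C(I, ℝ))
    Subtype.val_injective (by rw [finrank_e2]; simp) (toV.comp F)
    (by intro z hz; rw [ContinuousMap.comp_apply, hF z hz, toV_b1])
  exact ⟨h, h1, h2.comp_continuousMap fromV⟩

theorem fl1 (h : C(I, Equ e2)) (hZ : ∀ x ∈ Z1, h x = b2) : ∃ n : ℤ,
    ContinuousMap.HomotopicRel h ⟨fun t => cir (n * (2 * Real.pi) * t), by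
      have := cir_cont; fun_prop⟩ Z1 := by
  let q : I → ℍ[ℝ] := fun t => ((h t).1 : ℍ[ℝ])
  have hq : Continuous q := by fun_prop
  have q1 : ∀ t, (q t).imI = 0 := fun t => mem_V.mp (h t).1.2
  have q2 : ∀ t, (q t).imK = 0 := fun t => by
    have := (h t).2.2; rwa [inner_e2] at this
  have q3 : ∀ t, (q t).re ^ 2 + (q t).imJ ^ 2 = 1 := fun t => by
    have : ‖q t‖ = 1 := (h t).2.1
    rw [norm_one_iff, q1, q2] at this; linarith
  have qZ : ∀ t ∈ Z1, q t = 1 := fun t ht => by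
    change (((h t).1 : V) : ℍ[ℝ]) = 1
    rw [hZ t ht, b2, cir_coe]; ext <;> simp
  let w : C(Unit × I, ℂ) := ⟨fun x => ((q x.2).re : ℂ) + ((q x.2).imJ : ℂ) * Complex.I, by
      have := Quaternion.continuous_re
      have := Quaternion.continuous_imJ
      fun_prop⟩
  have wre : ∀ x, (w x).re = (q x.2).re := fun x => by simp [w]
  have wim : ∀ x, (w x).im = (q x.2).imJ := fun x => by simp [w]
  obtain ⟨θ, t1, t2, -⟩ := circle_lift w (by
    intro x
    rw [Complex.norm_eq_sqrt_sq_add_sq, Real.sqrt_eq_one, wre, wim]; exact q3 _) (by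
    intro x; simp [w, qZ 0 (by simp [Z1])])
  have hθ : ∀ t, h t = cir (θ ((), t)) := by
    intro t
    apply Subtype.ext; apply Subtype.ext
    change q t = _
    rw [cir_coe]
    have e1 : Real.cos (θ ((), t)) = (q t).re := by
      rw [← wre ((), t), ← t1, Complex.exp_ofReal_mul_I_re]
    have e2 : Real.sin (θ ((), t)) = (q t).imJ := by
      rw [← wim ((), t), ← t1, Complex.exp_ofReal_mul_I_im]
    rw [e1, e2]
    ext <;> simp [q1, q2]
  have h1 : ∃ n : ℤ, θ ((), 1) = n * (2 * Real.pi) := by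
    have h1 := t1 ((), 1)
    have : w ((), 1) = 1 := by simp [w, qZ 1 (by simp [Z1])]
    rw [this, Complex.exp_eq_one_iff] at h1
    obtain ⟨n, hn⟩ := h1
    refine ⟨n, ?_⟩
    have := congrArg Complex.im hn
    simpa using this
  obtain ⟨n, hn⟩ := h1
  refine ⟨n, homRel_mk (fun p => cir ((1 - p.1) * θ ((), p.2) + p.1 * (n * (2 * Real.pi) * p.2)))
    ?_ ?_ ?_ ?_⟩
  · have := cir_cont; fun_prop
  · intro t; simp [hθ]
  · intro t; simp; rfl
  · rintro s t ht
    rw [hθ]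
    rcases ht with ht | ht
    · rw [ht]; simp [t2]
    · rw [ht]; simp only [hn]; simp; congr 1; ring

/-- the universal map -/
noncomputable def Tm : C(Equ e2 × ((I × I) × I), Sph ℍ[ℝ]) :=
  ⟨fun p => Sus qi nqi b1 (hop (Sus qi nqi b1 (fromV (Sus e2 ne2 b2 (p.1, p.2.1.1)), p.2.1.2)),
    p.2.2), by fun_prop⟩

theorem main_red (F : C(((I × I) × I) × I, Sph ℍ[ℝ])) (hF : ∀ z ∈ Z4, F z = 1) :
    ∃ n : ℤ, ContinuousMap.HomotopicRel F ⟨fun p => Tm (cir (n * (2 * Real.pi) * p.1.1.1),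
      ((p.1.1.2, p.1.2), p.2)), by have := cir_cont; fun_prop⟩ Z4 := by
  obtain ⟨h, hZ, H⟩ := fl4 F hF
  obtain ⟨g, gZ, hg⟩ := hopf_lift h hZ
  obtain ⟨h2, h2Z, H2⟩ := fl3 g gZ
  obtain ⟨h1, h1Z, H1⟩ := fl2 h2 h2Z
  obtain ⟨n, H0⟩ := fl1 h1 h1Z
  refine ⟨n, H.trans ?_⟩
  have hh : h = hop.comp g := by ext1 p; exact (hg p).symm
  rw [hh]
  have K1 := (susMap_homRel e2 ne2 b2 h1Z H0).comp_continuousMap fromV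
  have K2 := H2.trans (susMap_homRel qi nqi b1 h2Z (H1.trans K1))
  have K3 := susMap_homRel qi nqi b1 (A := Z3) (h := hop.comp g) (by
    intro x hx; rw [ContinuousMap.comp_apply, gZ x hx, hop_one]) (K2.comp_continuousMap hop)
  exact K3

theorem lift_form (F : C(((I × I) × I) × I, Sph ℍ[ℝ])) (hF : ∀ z ∈ Z4, F z = 1) :
    ∃ g : C((I × I) × I, Sph ℍ[ℝ]), (∀ z ∈ Z3, g z = 1) ∧
    ContinuousMap.HomotopicRel F (sus (hop.comp g)) Z4 := by
  obtain ⟨h, hZ, H⟩ := fl4 F hF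
  obtain ⟨g, gZ, hg⟩ := hopf_lift h hZ
  have hh : h = hop.comp g := by ext1 p; exact (hg p).symm
  exact ⟨g, gZ, hh ▸ H⟩
end Sk
end

section
set_option autoImplicit false
set_option linter.unusedSectionVars false
open Metric Set unitInterval Module Quaternion

namespace Sk
/-- reflection -/
noncomputable def Rf (n : ℍ[ℝ]) (hn : ‖n‖ = 1) : ℍ[ℝ] →ₗᵢ[ℝ] ℍ[ℝ] where
  toFun y := y - (2 * inner ℝ n y) • n
  map_add' x y := by simp only [inner_add_right, mul_add, add_smul]; abel
  map_smul' c x := by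
    simp only [inner_smul_right, smul_sub, smul_smul, RingHom.id_apply]; congr 2; ring
  norm_map' y := by
    change ‖y - (2 * inner ℝ n y) • n‖ = ‖y‖
    have : ‖y - (2 * inner ℝ n y) • n‖ ^ 2 = ‖y‖ ^ 2 := by
      rw [norm_sub_sq_real, norm_smul, hn, inner_smul_right, real_inner_comm n y]
      simp; ring_nf
      rw [sq_abs]; ring
    rwa [sq_eq_sq₀ (norm_nonneg _) (norm_nonneg _)] at this

theorem Rf_apply (n : ℍ[ℝ]) (hn : ‖n‖ = 1) (y : ℍ[ℝ]) : Rf n hn y = y - (2 * inner ℝ n y) • n := rfl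

/-- rotating normal -/
noncomputable def ns (s : ℝ) : ℍ[ℝ] := mkQ 0 (Real.cos (Real.pi / 2 * s)) 0 (Real.sin (Real.pi / 2 * s))
theorem nns (s : ℝ) : ‖ns s‖ = 1 := by rw [norm_one_iff]; simp [ns]
theorem ns_cont : Continuous ns :=
  cont_quat (by fun_prop) (by fun_prop) (by fun_prop) (by fun_prop)
theorem ns_zero : ns 0 = qi := by ext <;> simp [ns]
theorem ns_one : ns 1 = qk := by ext <;> simp [ns]

/-- conjugator -/
noncomputable def us (s : ℝ) : Sph ℍ[ℝ] :=
  ⟨mkQ (Real.cos (Real.pi / 2 * s)) 0 (Real.sin (Real.pi / 2 * s)) 0, by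
    rw [mem_sphere_zero_iff_norm, norm_one_iff]; simp⟩
theorem us_cont : Continuous us :=
  Continuous.subtype_mk (cont_quat (by fun_prop) (by fun_prop) (by fun_prop) (by fun_prop)) _
theorem us_zero : us 0 = 1 := by
  apply Subtype.ext
  change mkQ _ _ _ _ = 1
  ext <;> simp
theorem us_one : (us 1 : ℍ[ℝ]) = qj := by
  change mkQ _ _ _ _ = _
  ext <;> simp

theorem Rf_hop (g : Sph ℍ[ℝ]) : Rf qk nqk (hop g).1 = (hop (us 1 * g * (us 1)⁻¹)).1 := by
  rw [Rf_apply, hop_coe, hop_coe, Metric.unitSphere.coe_mul, Metric.unitSphere.coe_mul,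
    Metric.unitSphere.coe_inv, us_one, inner_coord]
  have : qj⁻¹ = - qj := by
    rw [inv_eq_of_mul_eq_one_right]; ext <;> simp
  rw [this]
  ext <;> simp <;> ring

/-- flip of last coordinate -/
def flip4 {X : Type*} [TopologicalSpace X] : C(X × I, X × I) := ⟨fun p => (p.1, σ p.2), by fun_prop⟩

theorem claimA (g : C((I × I) × I, Sph ℍ[ℝ])) (hg : ∀ z ∈ Z3, g z = 1) :
    ContinuousMap.HomotopicRel ((sus (hop.comp g)).comp flip4) (sus (hop.comp g)) Z4 := by
  have hgZ : ∀ z ∈ Z3, hop.comp g z = b1 := fun z hz => by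
    rw [ContinuousMap.comp_apply, hg z hz, hop_one]
  have FZ := susMap_Zc qi nqi b1 (hop.comp g) Z3 hgZ
  let g1 : I → C((I × I) × I, Sph ℍ[ℝ]) := fun s => ⟨fun x => us s * g x * (us s)⁻¹, by fun_prop⟩
  have hg1 : ∀ s, ∀ z ∈ Z3, g1 s z = 1 := fun s z hz => by simp [g1, hg z hz]
  have hg1Z : ∀ s, ∀ z ∈ Z3, hop.comp (g1 s) z = b1 := fun s z hz => by
    rw [ContinuousMap.comp_apply, hg1 s z hz, hop_one]
  have step1 : ContinuousMap.HomotopicRel ((sus (hop.comp g)).comp flip4)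
      (sus (hop.comp (g1 1))) Z4 := by
    have hK : ∀ z ∈ Z4, ∀ s : ℝ, Rf (ns s) (nns s) (sus (hop.comp g) z : ℍ[ℝ]) = 1 := by
      intro z hz s
      rw [FZ z hz, b1_toSph, Rf_apply]
      have : inner ℝ (ns s) ((1 : Sph ℍ[ℝ]) : ℍ[ℝ]) = 0 := by
        rw [inner_coord]; simp [ns]
      rw [this]; simp
    have e0 : ∀ z, Rf (ns 0) (nns 0) (sus (hop.comp g) z : ℍ[ℝ]) =
        ((sus (hop.comp g)).comp flip4 z : ℍ[ℝ]) := by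
      rintro ⟨x, t⟩
      rw [ContinuousMap.comp_apply]
      change Rf (ns 0) (nns 0) (Sus qi nqi b1 (hop (g x), t) : ℍ[ℝ]) =
        (Sus qi nqi b1 (hop (g x), σ t) : ℍ[ℝ])
      rw [Sus_coe, Sus_coe, coe_symm_eq, susVec_symm]
      have h1 : Rf (ns 0) (nns 0) (susVec qi b1.1 (hop (g x)).1 t) =
          susVec (-qi) b1.1 (hop (g x)).1 t := by
        rw [susVec_map, Rf_apply, Rf_apply, Rf_apply, ns_zero, b1.2.2, (hop (g x)).2.2,
          real_inner_self_eq_norm_sq, nqi]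
        simp; congr 1; rw [two_smul]; abel
      rw [map_smul, h1, ← h1, LinearIsometry.norm_map]
    have e1 : ∀ z, Rf (ns 1) (nns 1) (sus (hop.comp g) z : ℍ[ℝ]) =
        (sus (hop.comp (g1 1)) z : ℍ[ℝ]) := by
      rintro ⟨x, t⟩
      change Rf (ns 1) (nns 1) (Sus qi nqi b1 (hop (g x), t) : ℍ[ℝ]) =
        (Sus qi nqi b1 (hop (us 1 * g x * (us 1)⁻¹), t) : ℍ[ℝ])
      rw [Sus_coe, Sus_coe]
      have h1 : Rf (ns 1) (nns 1) (susVec qi b1.1 (hop (g x)).1 t) =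
          susVec qi b1.1 (hop (us 1 * g x * (us 1)⁻¹)).1 t := by
        rw [susVec_map, ← Rf_hop]
        have h2 : Rf (ns 1) (nns 1) qi = qi := by
          rw [Rf_apply, ns_one, inner_coord]; simp
        have h3 : Rf (ns 1) (nns 1) b1.1 = b1.1 := by
          rw [Rf_apply, ns_one, inner_coord]; simp [b1]
        rw [h2, h3]; simp only [Rf_apply, ns_one]
      rw [map_smul, h1, ← h1, LinearIsometry.norm_map]
    refine homRel_mk (fun p => ⟨Rf (ns p.1) (nns p.1) (sus (hop.comp g) p.2 : ℍ[ℝ]), by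
      rw [mem_sphere_zero_iff_norm, LinearIsometry.norm_map, norm_eq_of_mem_sphere]⟩) ?_ ?_ ?_ ?_
    · apply Continuous.subtype_mk
      simp only [Rf_apply]
      have := ns_cont
      generalize sus (hop.comp g) = F
      fun_prop
    · intro z; exact Subtype.ext (e0 z)
    · intro z; exact Subtype.ext (e1 z)
    · intro s z hz
      apply Subtype.ext
      change Rf (ns s) (nns s) (sus (hop.comp g) z : ℍ[ℝ]) = _
      rw [← e0, hK z hz, hK z hz]
  refine step1.trans ?_
  apply ContinuousMap.HomotopicRel.symm
  apply susMap_homRel qi nqi b1 hgZ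
  apply ContinuousMap.HomotopicRel.comp_continuousMap
  refine homRel_mk (fun p => us p.1 * g p.2 * (us p.1)⁻¹) ?_ ?_ ?_ ?_
  · have := us_cont; fun_prop
  · intro z; simp [us_zero]
  · intro z; simp [g1]
  · intro s z hz; simp [hg z hz]

theorem claimB {G : Type*} [Group G] [TopologicalSpace G] [IsTopologicalGroup G]
    {X : Type*} [TopologicalSpace X] (A : Set X)
    (F : C(X × I, G)) (hF : ∀ z ∈ Zc A, F z = 1) :
    ContinuousMap.HomotopicRel (F * F.comp flip4) 1 (Zc A) := by
  let Fe : X × ℝ → G := fun p => F (p.1, projIcc 0 1 zero_le_one p.2)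
  have hFe : Continuous Fe := by
    have : Continuous (projIcc (0 : ℝ) 1 zero_le_one) := continuous_projIcc
    fun_prop
  have Fe_I : ∀ x (t : I), Fe (x, t) = F (x, t) := fun x t => by simp [Fe]
  have Fe0 : ∀ x (t : ℝ), t ≤ 0 → Fe (x, t) = 1 := fun x t ht => by
    simp only [Fe]; rw [projIcc_of_le_left _ ht]; exact hF _ (Or.inr (Or.inl rfl))
  have Fe1 : ∀ x (t : ℝ), 1 ≤ t → Fe (x, t) = 1 := fun x t ht => by
    simp only [Fe]; rw [projIcc_of_right_le _ ht]; exact hF _ (Or.inr (Or.inr rfl))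
  have FeA : ∀ x ∈ A, ∀ t, Fe (x, t) = 1 := fun x hx t => hF _ (Or.inl hx)
  let M : C(X × I, G) := ⟨fun p => Fe (p.1, sp p.2), by have := sp_cont; fun_prop⟩
  have MZ : ∀ z ∈ Zc A, M z = 1 := by
    rintro ⟨x, t⟩ (hx | hx | hx)
    · exact FeA x hx _
    · simp only at hx; apply Fe0; rw [hx]; simp [sp]
    · simp only at hx; apply Fe0; rw [hx]; simp [sp]; norm_num
  have PZ : ∀ z ∈ Zc A, (F * F.comp flip4) z = 1 := by
    rintro ⟨x, t⟩ h
    rw [ContinuousMap.mul_apply, hF _ h, ContinuousMap.comp_apply, one_mul]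
    apply hF
    rcases h with h | h | h
    · exact Or.inl h
    · right; right; simp only at h; simp [flip4, h]
    · right; left; simp only at h; simp [flip4, h]
  have s1 : ContinuousMap.HomotopicRel (F * F.comp flip4) M (Zc A) := by
    refine homRel_mk (fun p => Fe (p.2.1, (1 - p.1) * p.2.2 + p.1 * (2 * p.2.2)) *
      Fe (p.2.1, 1 - ((1 - p.1) * p.2.2 + p.1 * (2 * p.2.2 - 1)))) ?_ ?_ ?_ ?_
    · fun_prop
    · rintro ⟨x, t⟩
      simp only [Set.Icc.coe_zero, ContinuousMap.mul_apply, ContinuousMap.comp_apply]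
      simp only [sub_zero, one_mul, zero_mul, add_zero, Fe_I]
      rw [← coe_symm_eq, Fe_I]; rfl
    · rintro ⟨x, t⟩
      simp only [Set.Icc.coe_one, M, ContinuousMap.coe_mk]
      rcases le_total (t : ℝ) (1 / 2) with h | h
      · rw [Fe1 x (1 - _) (by linarith), mul_one, sp, abs_of_nonneg (by linarith)]
        congr 2; ring
      · rw [Fe1 x _ (by linarith), one_mul, sp, abs_of_nonpos (by linarith)]
        congr 2; ring
    · rintro s ⟨x, t⟩ h
      rw [PZ _ h]
      have s0 := s.2.1
      have s1 := s.2.2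
      rcases h with h | h | h
      · simp only [FeA x h, mul_one]
      · simp only at h
        simp only [h, Set.Icc.coe_zero]
        rw [Fe0 _ _ (by simp), Fe1 _ _ (by linarith), mul_one]
      · simp only at h
        simp only [h, Set.Icc.coe_one]
        rw [Fe1 _ _ (by linarith), Fe0 _ _ (by linarith), mul_one]
  refine s1.trans ?_
  refine homRel_mk (fun p => Fe (p.2.1, (1 - p.1) * sp p.2.2)) ?_ ?_ ?_ ?_
  · have := sp_cont; fun_prop
  · rintro ⟨x, t⟩; simp [M]
  · rintro ⟨x, t⟩; simp [Fe0]
  · rintro s ⟨x, t⟩ h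
    rw [MZ _ h]
    rcases h with h | h | h
    · simp only [FeA x h]
    · simp only at h; apply Fe0; rw [h]; simp [sp]
    · simp only at h; apply Fe0; rw [h]; simp [sp]; norm_num

theorem homRel_mul {G : Type*} [Group G] [TopologicalSpace G] [IsTopologicalGroup G]
    {X : Type*} [TopologicalSpace X] {Z : Set X} {f f' g g' : C(X, G)}
    (h : ContinuousMap.HomotopicRel f f' Z) (k : ContinuousMap.HomotopicRel g g' Z) :
    ContinuousMap.HomotopicRel (f * g) (f' * g') Z := by
  obtain ⟨H⟩ := h
  obtain ⟨K⟩ := k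
  refine homRel_mk (fun p => H p * K p) (by fun_prop) ?_ ?_ ?_
  · intro x; simp
  · intro x; simp
  · intro s x hx; rw [H.eq_fst s hx, K.eq_fst s hx]; rfl

theorem sq_null (F : C(((I × I) × I) × I, Sph ℍ[ℝ])) (hF : ∀ z ∈ Z4, F z = 1) :
    ContinuousMap.HomotopicRel (F * F) 1 Z4 := by
  obtain ⟨g, gZ, H⟩ := lift_form F hF
  refine (homRel_mul H (H.trans (claimA g gZ).symm)).trans ?_
  apply claimB
  apply susMap_Zc qi nqi b1
  intro z hz
  rw [ContinuousMap.comp_apply, gZ z hz, hop_one]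
end Sk
end

section
set_option autoImplicit false
set_option linter.unusedSectionVars false
open Metric Set unitInterval Module Quaternion

namespace Sk
section paths
variable {X : Type*} [TopologicalSpace X]

/-- loops from periodic maps -/
def pp (f : C(ℝ, X)) (T : ℝ) (x : X) (hx : ∀ n : ℤ, f (n * T) = x) (n : ℤ) : Path x x where
  toFun t := f (n * T * t)
  source' := by simpa using hx 0
  target' := by simpa using hx n

theorem mk_trans_formula {x : X} (γ γ' δ : Path x x) (K : I × I → X) (hK : Continuous K)
    (h0 : ∀ t : I, (t : ℝ) ≤ 1 / 2 → K (0, t) = γ.extend (2 * t))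
    (h0' : ∀ t : I, 1 / 2 ≤ (t : ℝ) → K (0, t) = γ'.extend (2 * t - 1))
    (h1 : ∀ t, K (1, t) = δ t) (hs : ∀ s, K (s, 0) = x) (hs' : ∀ s, K (s, 1) = x) :
    (γ.trans γ').Homotopic δ := by
  refine homRel_mk K hK ?_ h1 ?_
  · intro t
    change _ = (γ.trans γ') t
    rw [Path.trans_apply]
    split_ifs with h
    · rw [h0 t h, Path.extend_apply]
    · rw [h0' t (by linarith), Path.extend_apply]
  · intro s t ht
    change _ = (γ.trans γ') t
    rcases ht with h | h
    · rw [h, hs]; simp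
    · rw [h, hs']; simp

theorem pp_trans (f : C(ℝ, X)) (T : ℝ) (x : X) (hx : ∀ n : ℤ, f (n * T) = x)
    (hp : ∀ (n : ℤ) r, f (n * T + r) = f r) (n : ℤ) :
    ((pp f T x hx n).trans (pp f T x hx 1)).Homotopic (pp f T x hx (n + 1)) := by
  have ext : ∀ (m : ℤ) (t : ℝ) (ht : t ∈ I), (pp f T x hx m).extend t = f (m * T * t) := by
    intro m t ht; rw [Path.extend_apply _ ht]; rfl
  refine mk_trans_formula _ _ _ (fun p => f ((1 - p.1) * (n * T * min (2 * (p.2 : ℝ)) 1 + T *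
    max (2 * (p.2 : ℝ) - 1) 0) + p.1 * ((n + 1) * T * p.2))) (by fun_prop) ?_ ?_ ?_ ?_ ?_
  · intro t ht
    have := t.2.1
    rw [ext _ _ ⟨by linarith, by linarith⟩]
    simp only [Set.Icc.coe_zero]
    rw [min_eq_left (by linarith), max_eq_right (by linarith)]
    congr 1; ring
  · intro t ht
    have := t.2.2
    rw [ext _ _ ⟨by linarith, by linarith⟩]
    simp only [Set.Icc.coe_zero]
    rw [min_eq_right (by linarith), max_eq_left (by linarith), ← hp n (((1 : ℤ) : ℝ) * T * (2 * t - 1))]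
    congr 1; push_cast; ring
  · intro t
    change _ = f _
    simp
  · intro s; simpa using hx 0
  · intro s; rw [← hx (n + 1)]
    congr 1
    simp only [Set.Icc.coe_one]
    rw [min_eq_right (by norm_num), max_eq_left (by norm_num)]
    push_cast; ring

theorem pp_zero (f : C(ℝ, X)) (T : ℝ) (x : X) (hx : ∀ n : ℤ, f (n * T) = x) :
    pp f T x hx 0 = Path.refl x := by
  ext t; change f _ = x; simpa using hx 0

/-- class of a loop -/
def cls {x : X} (γ : Path x x) : FundamentalGroup X x :=
  FundamentalGroup.fromPath (Path.Homotopic.Quotient.mk γ)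

theorem cls_surj {x : X} (a : FundamentalGroup X x) : ∃ γ : Path x x, cls γ = a := by
  obtain ⟨γ, hγ⟩ := Quotient.exists_rep (FundamentalGroup.toPath a)
  exact ⟨γ, hγ⟩

theorem cls_eq {x : X} {γ γ' : Path x x} : cls γ = cls γ' ↔ γ.Homotopic γ' :=
  Path.Homotopic.Quotient.eq

theorem cls_refl {x : X} : cls (Path.refl x) = 1 := rfl

theorem cls_trans {x : X} (γ γ' : Path x x) : cls (γ.trans γ') = cls γ' * cls γ := rfl

theorem pp_zpow (f : C(ℝ, X)) (T : ℝ) (x : X) (hx : ∀ n : ℤ, f (n * T) = x)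
    (hp : ∀ (n : ℤ) r, f (n * T + r) = f r) (n : ℤ) :
    cls (pp f T x hx n) = cls (pp f T x hx 1) ^ n := by
  have key : ∀ n, cls (pp f T x hx (n + 1)) = cls (pp f T x hx 1) * cls (pp f T x hx n) := fun n => by
    rw [← cls_trans, eq_comm, cls_eq]; exact pp_trans f T x hx hp n
  induction n using Int.induction_on with
  | zero => rw [pp_zero, cls_refl, zpow_zero]
  | succ k ih => rw [key, ih, add_comm, zpow_add, zpow_one]
  | pred k ih =>
    have := key (-(k : ℤ) - 1)
    rw [sub_add_cancel, ih] at this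
    rw [← mul_right_inj (cls (pp f T x hx 1)), ← this, ← zpow_one_add]; congr 1; ring
end paths

section tg
variable {G : Type*} [Group G] [TopologicalSpace G] [IsTopologicalGroup G]

/-- pointwise product of loops -/
def pmul (γ γ' : Path (1 : G) 1) : Path (1 : G) 1 where
  toFun t := γ t * γ' t
  source' := by simp
  target' := by simp

theorem trans_homotopic_pmul (γ γ' : Path (1 : G) 1) : (γ.trans γ').Homotopic (pmul γ γ') := by
  refine mk_trans_formula _ _ _ (fun p => γ.extend ((1 - p.1) * (2 * p.2) + p.1 * p.2) *
    γ'.extend ((1 - p.1) * (2 * p.2 - 1) + p.1 * p.2)) ?_ ?_ ?_ ?_ ?_ ?_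
  · have := γ.continuous_extend
    have := γ'.continuous_extend
    fun_prop
  · intro t ht
    simp only [Set.Icc.coe_zero]
    rw [γ'.extend_of_le_zero (by linarith)]
    simp
  · intro t ht
    simp only [Set.Icc.coe_zero]
    rw [γ.extend_of_one_le (by linarith)]
    simp
  · intro t
    change _ = γ t * γ' t
    simp
  · intro s
    have := s.2.2
    rw [γ.extend_of_le_zero (by simp), γ'.extend_of_le_zero (by simp; linarith)]
    simp
  · intro s
    have := s.2.2
    rw [γ.extend_of_one_le (by simp; linarith), γ'.extend_of_one_le (by simp; linarith)]
    simp
end tg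

instance tgC {X G : Type*} [TopologicalSpace X] [LocallyCompactSpace X] [Group G]
    [TopologicalSpace G] [IsTopologicalGroup G] : IsTopologicalGroup C(X, G) where
  continuous_inv := ContinuousMap.continuous_postcomp (⟨fun g => g⁻¹, continuous_inv⟩ : C(G, G))

/-- the three-fold loop group -/
def Om : Subgroup C((I × I) × I, Sph ℍ[ℝ]) where
  carrier := {f | ∀ z ∈ Z3, f z = 1}
  mul_mem' := by intro a b ha hb z hz; simp [ha z hz, hb z hz]
  one_mem' := by intro z hz; rfl
  inv_mem' := by intro a ha z hz; simp [ha z hz]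

theorem mem_Z3 (a b c : I) : ((a, b), c) ∈ Z3 ↔ (a = 0 ∨ a = 1) ∨ (b = 0 ∨ b = 1) ∨ c = 0 ∨ c = 1 := by
  simp [Z3, Z2, Z1, Zc]; tauto
theorem mem_Z4 (a b c d : I) : (((a, b), c), d) ∈ Z4 ↔ (a = 0 ∨ a = 1) ∨ ((b, c), d) ∈ Z3 := by
  rw [mem_Z3]; simp [Z4, Z3, Z2, Z1, Zc]; tauto

/-- map of a loop -/
noncomputable def FF (γ : Path (1 : Om) 1) : C(((I × I) × I) × I, Sph ℍ[ℝ]) :=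
  ⟨fun p => (γ p.1.1.1).1 ((p.1.1.2, p.1.2), p.2), by fun_prop⟩

theorem FF_apply (γ : Path (1 : Om) 1) (a b c d : I) : FF γ (((a, b), c), d) = (γ a).1 ((b, c), d) := rfl

theorem FF_Z4 (γ : Path (1 : Om) 1) : ∀ z ∈ Z4, FF γ z = 1 := by
  rintro ⟨⟨⟨a, b⟩, c⟩, d⟩ h
  rw [mem_Z4] at h
  rw [FF_apply]
  rcases h with (h | h) | h
  · rw [h]; simp
  · rw [h]; simp
  · exact (γ a).2 _ h

theorem hom_of_FF {γ γ' : Path (1 : Om) 1} (H : ContinuousMap.HomotopicRel (FF γ) (FF γ') Z4) :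
    γ.Homotopic γ' := by
  obtain ⟨K⟩ := H
  let k : C((I × I) × ((I × I) × I), Sph ℍ[ℝ]) :=
    ⟨fun q => K (q.1.1, (((q.1.2, q.2.1.1), q.2.1.2), q.2.2)), by fun_prop⟩
  have hk : ∀ s t, k.curry (s, t) ∈ Om := by
    rintro s t ⟨⟨b, c⟩, d⟩ h
    have hz : (((t, b), c), d) ∈ Z4 := by rw [mem_Z4]; exact Or.inr h
    change K (s, (((t, b), c), d)) = 1
    rw [K.eq_fst s hz, FF_Z4 _ _ hz]
  refine homRel_mk (fun p => (⟨k.curry p, hk p.1 p.2⟩ : Om)) ?_ ?_ ?_ ?_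
  · apply Continuous.subtype_mk; fun_prop
  · intro t; apply Subtype.ext; ext1 ⟨⟨b, c⟩, d⟩
    change K (0, (((t, b), c), d)) = _
    rw [ContinuousMap.HomotopyWith.apply_zero]; rfl
  · intro t; apply Subtype.ext; ext1 ⟨⟨b, c⟩, d⟩
    change K (1, (((t, b), c), d)) = _
    rw [ContinuousMap.HomotopyWith.apply_one]; rfl
  · intro s t ht; apply Subtype.ext; ext1 ⟨⟨b, c⟩, d⟩
    have hz : (((t, b), c), d) ∈ Z4 := by rw [mem_Z4]; exact Or.inl ht
    change K (s, (((t, b), c), d)) = _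
    rw [K.eq_fst s hz]; rfl

theorem Om_sq (a : FundamentalGroup Om 1) : a * a = 1 := by
  obtain ⟨γ, rfl⟩ := cls_surj a
  rw [← cls_trans, ← cls_refl, cls_eq]
  refine (trans_homotopic_pmul γ γ).trans (hom_of_FF ?_)
  have h1 : FF (pmul γ γ) = FF γ * FF γ := rfl
  have h2 : FF (Path.refl 1) = 1 := rfl
  rw [h1, h2]
  exact sq_null _ (FF_Z4 γ)

theorem Tm_Z3 (y : Equ e2) : ∀ z ∈ Z3, Tm (y, z) = 1 := by
  rintro ⟨⟨b, c⟩, d⟩ h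
  rw [mem_Z3] at h
  change Sus qi nqi b1 (hop (Sus qi nqi b1 (fromV (Sus e2 ne2 b2 (y, b)), c)), d) = 1
  rw [← b1_toSph]
  have hb : ∀ b', Sus e2 ne2 b2 (y, b') = b2.toSph →
    Sus qi nqi b1 (hop (Sus qi nqi b1 (fromV (Sus e2 ne2 b2 (y, b')), c)), d) = b1.toSph := by
    intro b' hb'
    rw [hb', fromV_b2, Sus_base, b1_toSph, hop_one, Sus_base, b1_toSph]
  rcases h with (h | h) | (h | h) | h | h
  · rw [h]; exact hb 0 (Sus_zero ..)
  · rw [h]; exact hb 1 (Sus_one ..)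
  · rw [h, Sus_zero, b1_toSph, hop_one, Sus_base, b1_toSph]
  · rw [h, Sus_one, b1_toSph, hop_one, Sus_base, b1_toSph]
  · rw [h, Sus_zero]
  · rw [h, Sus_one]

theorem Tm_b2 (z) : Tm (b2, z) = 1 := by
  obtain ⟨⟨b, c⟩, d⟩ := z
  change Sus qi nqi b1 (hop (Sus qi nqi b1 (fromV (Sus e2 ne2 b2 (b2, b)), c)), d) = 1
  rw [Sus_base, fromV_b2, Sus_base, b1_toSph, hop_one, Sus_base, b1_toSph]

theorem Tm_cir_cont : Continuous fun p : ℝ × ((I × I) × I) => Tm (cir p.1, p.2) := by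
  have := cir_cont; fun_prop

/-- periodic map -/
noncomputable def fper : C(ℝ, Om) :=
  ⟨fun r => ⟨(⟨_, Tm_cir_cont⟩ : C(ℝ × ((I × I) × I), Sph ℍ[ℝ])).curry r, fun z hz => Tm_Z3 _ z hz⟩,
    by apply Continuous.subtype_mk; fun_prop⟩

theorem fper_apply (r : ℝ) (z) : (fper r).1 z = Tm (cir r, z) := rfl

theorem cir_add (n : ℤ) (r : ℝ) : cir (n * (2 * Real.pi) + r) = cir r := by
  apply Subtype.ext; apply Subtype.ext
  rw [cir_coe, cir_coe, add_comm, Real.cos_add_int_mul_two_pi, Real.sin_add_int_mul_two_pi]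

theorem Om_cyclic : ∃ c : FundamentalGroup Om 1, ∀ a, ∃ n : ℤ, a = c ^ n := by
  have hx : ∀ n : ℤ, fper (n * (2 * Real.pi)) = 1 := by
    intro n; apply Subtype.ext; ext1 z
    rw [fper_apply, cir_int, Tm_b2]; rfl
  have hp : ∀ (n : ℤ) r, fper (n * (2 * Real.pi) + r) = fper r := by
    intro n r; apply Subtype.ext; ext1 z
    rw [fper_apply, fper_apply, cir_add]
  refine ⟨cls (pp fper _ _ hx 1), fun a => ?_⟩
  obtain ⟨γ, rfl⟩ := cls_surj a
  obtain ⟨n, hn⟩ := main_red (FF γ) (FF_Z4 γ)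
  refine ⟨n, ?_⟩
  rw [← pp_zpow fper _ _ hx hp, cls_eq]
  exact hom_of_FF hn

theorem Om_two : ∃ c : FundamentalGroup Om 1, ∀ a, a = 1 ∨ a = c := by
  obtain ⟨c, hc⟩ := Om_cyclic
  refine ⟨c, fun a => ?_⟩
  obtain ⟨n, rfl⟩ := hc a
  obtain ⟨k, hk | hk⟩ := Int.even_or_odd' n
  · left; rw [hk, zpow_mul, zpow_two, Om_sq, one_zpow]
  · right; rw [hk, zpow_add, zpow_mul, zpow_two, Om_sq, one_zpow, zpow_one, one_mul]
end Sk
end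

section
set_option autoImplicit false
set_option linter.unusedSectionVars false
open Metric Set unitInterval Module Quaternion

namespace Sk

theorem homeo_pi1 {X Y : Type*} [TopologicalSpace X] [TopologicalSpace Y] (h : X ≃ₜ Y) (x : X) (y : Y)
    (hy : h x = y) : Nonempty (FundamentalGroup X x ≃* FundamentalGroup Y y) := by
  subst hy
  refine ⟨MulEquiv.ofBijective (FundamentalGroup.map (h : C(X, Y)) x) ⟨?_, ?_⟩⟩
  · intro a b hab
    obtain ⟨γ, rfl⟩ := cls_surj a
    obtain ⟨γ', rfl⟩ := cls_surj b
    change cls (γ.map (h : C(X, Y)).continuous) = cls (γ'.map (h : C(X, Y)).continuous) at hab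
    rw [cls_eq] at hab ⊢
    have := ContinuousMap.HomotopicRel.comp_continuousMap hab (h.symm : C(Y, X))
    have e : ∀ γ : Path x x, (h.symm : C(Y, X)).comp (γ.map (h : C(X, Y)).continuous).toContinuousMap =
        γ.toContinuousMap := fun γ => by ext t; simp
    rw [e, e] at this
    exact this
  · intro b
    obtain ⟨γ, rfl⟩ := cls_surj b
    refine ⟨cls ((γ.map h.symm.continuous).cast (by simp) (by simp)), ?_⟩
    change cls (((γ.map h.symm.continuous).cast _ _).map (h : C(X, Y)).continuous) = _
    congr 1; ext t; simp

/-- cube coordinates in [-1,1] -/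
def cv (z : (I × I) × I) : (ℝ × ℝ) × ℝ := ((2 * z.1.1 - 1, 2 * z.1.2 - 1), 2 * z.2 - 1)

theorem cv_cont : Continuous cv := by unfold cv; fun_prop

theorem cv_inj : Function.Injective cv := by
  rintro ⟨⟨a, b⟩, c⟩ ⟨⟨a', b'⟩, c'⟩ h
  simp only [cv, Prod.mk.injEq] at h
  obtain ⟨⟨h1, h2⟩, h3⟩ := h
  rw [Prod.mk.injEq, Prod.mk.injEq]
  exact ⟨⟨Subtype.ext (by linarith), Subtype.ext (by linarith)⟩, Subtype.ext (by linarith)⟩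

theorem cv_norm (z) : ‖cv z‖ = max (max |2 * (z.1.1 : ℝ) - 1| |2 * (z.1.2 : ℝ) - 1|) |2 * (z.2 : ℝ) - 1| := rfl

theorem abs_le_I (a : I) : |2 * (a : ℝ) - 1| ≤ 1 := by
  have := a.2.1; have := a.2.2
  rw [abs_le]; constructor <;> linarith

theorem abs_eq_I (a : I) : |2 * (a : ℝ) - 1| = 1 ↔ a = 0 ∨ a = 1 := by
  rw [abs_eq (by norm_num)]
  constructor
  · rintro (h | h)
    · right; exact Subtype.ext (by rw [Set.Icc.coe_one]; linarith)
    · left; exact Subtype.ext (by rw [Set.Icc.coe_zero]; linarith)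
  · rintro (h | h) <;> rw [h] <;> norm_num

theorem cv_le (z) : ‖cv z‖ ≤ 1 := by
  rw [cv_norm]; simp only [max_le_iff, abs_le_I, and_self]

theorem cv_one (z) : ‖cv z‖ = 1 ↔ z ∈ Z3 := by
  obtain ⟨⟨a, b⟩, c⟩ := z
  rw [mem_Z3, ← abs_eq_I, ← abs_eq_I, ← abs_eq_I]
  rw [← (cv_le ((a, b), c)).ge_iff_eq, cv_norm, ← (abs_le_I a).ge_iff_eq, ← (abs_le_I b).ge_iff_eq,
    ← (abs_le_I c).ge_iff_eq]
  simp only [ge_iff_le, le_max_iff, or_assoc]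

theorem cv_surj (v : (ℝ × ℝ) × ℝ) (hv : ‖v‖ ≤ 1) : ∃ z, cv z = v := by
  obtain ⟨⟨a, b⟩, c⟩ := v
  have : max (max |a| |b|) |c| ≤ 1 := hv
  simp only [max_le_iff, abs_le] at this
  refine ⟨((⟨(a + 1) / 2, ?_, ?_⟩, ⟨(b + 1) / 2, ?_, ?_⟩), ⟨(c + 1) / 2, ?_, ?_⟩), ?_⟩
  any_goals linarith
  simp only [cv, Prod.mk.injEq]
  refine ⟨⟨?_, ?_⟩, ?_⟩ <;> ring

/-- unnormalised collapse map -/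
def cw (v : (ℝ × ℝ) × ℝ) : ℍ[ℝ] :=
  mkQ (2 * ‖v‖ - 1) ((1 - ‖v‖) * v.1.1) ((1 - ‖v‖) * v.1.2) ((1 - ‖v‖) * v.2)

/-- imaginary part -/
def imv (q : ℍ[ℝ]) : (ℝ × ℝ) × ℝ := ((q.imI, q.imJ), q.imK)

theorem imv_smul (c : ℝ) (q : ℍ[ℝ]) : imv (c • q) = c • imv q := by simp [imv]

theorem imv_cw (v) : imv (cw v) = (1 - ‖v‖) • v := rfl

theorem q_ext {p q : ℍ[ℝ]} (h : p.re = q.re) (h2 : imv p = imv q) : p = q := by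
  simp only [imv, Prod.mk.injEq] at h2
  ext
  exacts [h, h2.1.1, h2.1.2, h2.2]

theorem cw_cont : Continuous cw :=
  cont_quat (by fun_prop) (by fun_prop) (by fun_prop) (by fun_prop)

theorem cw_ne (v : (ℝ × ℝ) × ℝ) : cw v ≠ 0 := by
  intro h
  have h1 := congrArg (fun q => q.re) h
  have h2 := congrArg imv h
  rw [imv_cw] at h2
  have h3 : imv 0 = 0 := rfl
  rw [h3] at h2
  simp [cw] at h1
  rcases smul_eq_zero.mp h2 with h4 | h4
  · linarith
  · rw [h4] at h1; simp at h1

/-- collapse map -/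
noncomputable def col : C((I × I) × I, Sph ℍ[ℝ]) :=
  nrm (fun z => cw (cv z)) (by have := cv_cont; have := cw_cont; fun_prop) (fun z => cw_ne _)

theorem col_coe (z) : (col z : ℍ[ℝ]) = ‖cw (cv z)‖⁻¹ • cw (cv z) := nrm_coe ..

theorem col_one (z) (h : z ∈ Z3) : col z = 1 := by
  rw [← cv_one] at h
  apply Subtype.ext
  rw [col_coe]
  have : cw (cv z) = 1 := by
    unfold cw; rw [h]; ext <;> simp; norm_num
  rw [this]; simp

theorem col_inj (z z') (h : col z = col z') : z = z' ∨ (z ∈ Z3 ∧ z' ∈ Z3) := by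
  have h1 := congrArg (fun q : Sph ℍ[ℝ] => (q : ℍ[ℝ])) h
  simp only [col_coe] at h1
  rw [← cv_one, ← cv_one]
  set v := cv z with hv
  set v' := cv z' with hv'
  have hm1 : ‖v‖ ≤ 1 := cv_le z
  have hm2 : ‖v'‖ ≤ 1 := cv_le z'
  have p1 : 0 < ‖cw v‖⁻¹ := inv_pos.mpr (norm_pos_iff.mpr (cw_ne v))
  have p2 : 0 < ‖cw v'‖⁻¹ := inv_pos.mpr (norm_pos_iff.mpr (cw_ne v'))
  set α := ‖cw v‖⁻¹
  set β := ‖cw v'‖⁻¹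
  have hre := congrArg (fun q => q.re) h1
  have him := congrArg imv h1
  rw [imv_smul, imv_smul, imv_cw, imv_cw] at him
  have him' := congrArg norm him
  rw [norm_smul, norm_smul, norm_smul, norm_smul, Real.norm_of_nonneg p1.le,
    Real.norm_of_nonneg p2.le, Real.norm_of_nonneg (by linarith),
    Real.norm_of_nonneg (by linarith)] at him'
  simp [cw] at hre
  have n1 := norm_nonneg v
  have n2 := norm_nonneg v'
  have hmm : ‖v‖ = ‖v'‖ := by
    set m := ‖v‖
    set m' := ‖v'‖
    -- cross product vanishes
    have key : α * β * ((m' - m) * ((1 - m) * (1 - m') + m * m')) = 0 := by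
      linear_combination (β * (2 * m' - 1)) * him' - (β * ((1 - m') * m')) * hre
    have hab : α * β ≠ 0 := (mul_pos p1 p2).ne'
    rcases mul_eq_zero.mp ((mul_eq_zero.mp key).resolve_left hab) with h5 | h5
    · linarith
    · exfalso
      have q1 : 0 ≤ (1 - m) * (1 - m') := mul_nonneg (by linarith) (by linarith)
      have q2 : 0 ≤ m * m' := mul_nonneg n1 n2
      have q3 : m * m' = 0 := by linarith
      have q4 : (1 - m) * (1 - m') = 0 := by linarith
      rcases mul_eq_zero.mp q3 with q | q
      · rw [q] at q4 hre
        have : m' = 1 := by linarith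
        rw [this] at hre; linarith
      · rw [q] at q4 hre
        have : m = 1 := by linarith
        rw [this] at hre; linarith
  by_cases hone : ‖v‖ = 1
  · right; exact ⟨hone, hmm ▸ hone⟩
  · left
    apply cv_inj
    have : α = β := by
      rw [← hmm] at hre him'
      by_cases h0 : 2 * ‖v‖ - 1 = 0
      · have : (1 - ‖v‖) * ‖v‖ ≠ 0 := by
          have : ‖v‖ = 1 / 2 := by linarith
          rw [this]; norm_num
        exact mul_right_cancel₀ this him'
      · exact mul_right_cancel₀ h0 hre
    rw [this, ← hmm] at him
    have hne : 1 - ‖v‖ ≠ 0 := fun h => hone (by linarith)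
    exact smul_right_injective _ hne (smul_right_injective _ p2.ne' him)

theorem col_surj : Function.Surjective col := by
  intro q
  have key : ∃ v : (ℝ × ℝ) × ℝ, ‖v‖ ≤ 1 ∧ ∃ μ : ℝ, 0 < μ ∧ cw v = μ • (q : ℍ[ℝ]) := by
    have hq := coord_of_sph q
    by_cases h0 : imv (q : ℍ[ℝ]) = 0
    · have h1 := h0
      simp only [imv, Prod.mk_eq_zero] at h1
      rw [h1.1.1, h1.1.2, h1.2] at hq
      have : (q : ℍ[ℝ]).re ^ 2 = 1 := by linarith
      rcases sq_eq_one_iff.mp this with h | h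
      · have hn : ‖(((1 : ℝ), (0 : ℝ)), (0 : ℝ))‖ = 1 := by simp [Prod.norm_def]
        refine ⟨((1, 0), 0), hn.le, 1, one_pos, ?_⟩
        apply q_ext
        · simp only [cw, mkQ_re, hn]; simp [h]; norm_num
        · rw [imv_cw, hn, imv_smul, h0]; simp
      · refine ⟨0, by simp, 1, one_pos, ?_⟩
        apply q_ext
        · simp [cw, h]
        · rw [imv_cw, imv_smul, h0]; simp
    · set δ := ‖imv (q : ℍ[ℝ])‖ with hδ
      have dp : 0 < δ := norm_pos_iff.mpr h0
      obtain ⟨m, ⟨m0, m1⟩, hm⟩ : ∃ m ∈ Icc (0 : ℝ) 1, (2 * m - 1) * δ - (q : ℍ[ℝ]).re * (m * (1 - m)) = 0 := by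
        apply intermediate_value_Icc (zero_le_one : (0 : ℝ) ≤ 1)
          (f := fun m => (2 * m - 1) * δ - (q : ℍ[ℝ]).re * (m * (1 - m))) (by fun_prop)
        constructor <;> norm_num <;> linarith
      have hm0 : m ≠ 0 := by rintro rfl; simp at hm; linarith
      have hm1 : m ≠ 1 := by rintro rfl; norm_num at hm; linarith
      have m0' : 0 < m := lt_of_le_of_ne m0 (Ne.symm hm0)
      have m1' : m < 1 := lt_of_le_of_ne m1 hm1
      have nv : ‖(m / δ) • imv (q : ℍ[ℝ])‖ = m := by
        rw [norm_smul, ← hδ, Real.norm_of_nonneg (by positivity)]; field_simp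
      refine ⟨(m / δ) • imv (q : ℍ[ℝ]), by rw [nv]; exact m1, (1 - m) * m / δ,
        div_pos (mul_pos (by linarith) m0') dp, ?_⟩
      apply q_ext
      · simp only [cw, mkQ_re, nv]
        simp
        field_simp
        linarith
      · rw [imv_cw, nv, imv_smul, smul_smul]; congr 1; ring
  obtain ⟨v, hv, μ, hμ, h⟩ := key
  obtain ⟨z, rfl⟩ := cv_surj v hv
  refine ⟨z, Subtype.ext ?_⟩
  rw [col_coe, h, norm_smul, norm_eq_of_mem_sphere, Real.norm_of_nonneg hμ.le, smul_smul]
  rw [mul_one, inv_mul_cancel₀ hμ.ne', one_smul]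

theorem col_quot : Topology.IsQuotientMap col :=
  (col.continuous.isClosedMap).isQuotientMap col.continuous col_surj

theorem zero_mem_Z3 : ((0, 0), 0) ∈ Z3 := by rw [mem_Z3]; simp

/-- based self-maps of the sphere -/
def Bg : Subgroup C(Sph ℍ[ℝ], Sph ℍ[ℝ]) where
  carrier := {f | f 1 = 1}
  mul_mem' := by intro a b ha hb; simp_all
  one_mem' := rfl
  inv_mem' := by intro a ha; simp_all

theorem mem_Bg (f : C(Sph ℍ[ℝ], Sph ℍ[ℝ])) : f ∈ Bg ↔ f 1 = 1 := Iff.rfl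

/-- pull back along collapse -/
noncomputable def pull (f : Bg) : Om := ⟨f.1.comp col, fun z hz => by
  rw [ContinuousMap.comp_apply, col_one z hz]; exact f.2⟩

theorem pull_isom : Isometry pull := by
  apply Isometry.of_dist_eq
  intro f g
  apply le_antisymm
  · refine (ContinuousMap.dist_le dist_nonneg).mpr fun z => ?_
    exact ContinuousMap.dist_apply_le_dist (f := f.1) (g := g.1) (col z)
  · refine (ContinuousMap.dist_le dist_nonneg).mpr fun y => ?_
    obtain ⟨z, rfl⟩ := col_surj y
    exact ContinuousMap.dist_apply_le_dist (f := (pull f).1) (g := (pull g).1) z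

theorem pull_surj : Function.Surjective pull := by
  intro f
  have hf : Function.FactorsThrough f.1 col := by
    intro z z' h
    rcases col_inj z z' h with h | ⟨h1, h2⟩
    · rw [h]
    · rw [f.2 z h1, f.2 z' h2]
  refine ⟨⟨col_quot.lift f.1 hf, ?_⟩, ?_⟩
  · rw [mem_Bg, ← col_one _ zero_mem_Z3]
    have := DFunLike.congr_fun (col_quot.lift_comp f.1 hf) ((0, 0), 0)
    rw [ContinuousMap.comp_apply] at this
    rw [this, col_one _ zero_mem_Z3]
    exact f.2 _ zero_mem_Z3
  · apply Subtype.ext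
    exact col_quot.lift_comp f.1 hf

/-- homeo -/
noncomputable def pullH : Bg ≃ₜ Om :=
  (IsometryEquiv.mk (Equiv.ofBijective pull ⟨pull_isom.injective, pull_surj⟩) pull_isom).toHomeomorph

theorem Bg_two : ∃ c : FundamentalGroup Bg 1, ∀ a, a = 1 ∨ a = c := by
  obtain ⟨e⟩ := homeo_pi1 pullH 1 1 rfl
  obtain ⟨c, hc⟩ := Om_two
  refine ⟨e.symm c, fun a => ?_⟩
  rcases hc (e a) with h | h
  · left; rwa [MulEquiv.map_eq_one_iff] at h
  · right; rw [← h]; simp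

theorem lmulH {G : Type*} [Group G] [TopologicalSpace G] [IsTopologicalGroup G] (f g : G) :
    Nonempty (FundamentalGroup G f ≃* FundamentalGroup G g) :=
  homeo_pi1 (Homeomorph.mulLeft (g * f⁻¹)) f g (by simp)

end Sk
end

section
set_option autoImplicit false
set_option linter.unusedSectionVars false
open Metric Set unitInterval Module Quaternion MvPolynomial

namespace Sk
/-- polynomial ring -/
abbrev PA := MvPolynomial (Fin 4) ℝ
/-- quaternionic polynomials -/
abbrev PQ := ℍ[PA]

/-- quaternion from coordinates -/
def mkA (a b c d : PA) : PQ := ⟨a, b, c, d⟩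
@[simp] theorem mkA_re (a b c d : PA) : (mkA a b c d).re = a := rfl
@[simp] theorem mkA_imI (a b c d : PA) : (mkA a b c d).imI = b := rfl
@[simp] theorem mkA_imJ (a b c d : PA) : (mkA a b c d).imJ = c := rfl
@[simp] theorem mkA_imK (a b c d : PA) : (mkA a b c d).imK = d := rfl

/-- componentwise derivative -/
noncomputable def dQ (i : Fin 4) : PQ →ₗ[ℝ] PQ where
  toFun φ := mkA (pderiv i φ.re) (pderiv i φ.imI) (pderiv i φ.imJ) (pderiv i φ.imK)
  map_add' x y := by ext1 <;> simp
  map_smul' c x := by ext1 <;> simp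

@[simp] theorem dQ_re (i) (φ : PQ) : (dQ i φ).re = pderiv i φ.re := rfl
@[simp] theorem dQ_imI (i) (φ : PQ) : (dQ i φ).imI = pderiv i φ.imI := rfl
@[simp] theorem dQ_imJ (i) (φ : PQ) : (dQ i φ).imJ = pderiv i φ.imJ := rfl
@[simp] theorem dQ_imK (i) (φ : PQ) : (dQ i φ).imK = pderiv i φ.imK := rfl

theorem dQ_mul (i) (φ ψ : PQ) : dQ i (φ * ψ) = dQ i φ * ψ + φ * dQ i ψ := by
  ext1 <;> simp [Derivation.leibniz] <;> ring

theorem dQ_smul (i) (a : PA) (ψ : PQ) : dQ i (a • ψ) = pderiv i a • ψ + a • dQ i ψ := by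
  ext1 <;> simp [Derivation.leibniz] <;> ring

theorem dQ_comm (i j) (φ : PQ) : dQ i (dQ j φ) = dQ j (dQ i φ) := by
  have h : ∀ p : PA, pderiv i (pderiv j p) = pderiv j (pderiv i p) := fun p => by
    have := congrArg (fun d : Derivation ℝ PA PA => d p)
      (show ⁅(pderiv i : Derivation ℝ PA PA), pderiv j⁆ = 0 by
        apply MvPolynomial.derivation_ext; intro k
        rw [Derivation.commutator_apply]; simp [pderiv_X, Pi.single_apply]
        split_ifs <;> simp)
    rw [Derivation.commutator_apply] at this
    simpa [sub_eq_zero] using this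
  ext1 <;> simp [h]

theorem smA (a : PA) (p q : PQ) : (a • p) * q = a • (p * q) := by
  ext1 <;> simp <;> ring
theorem mulsA (a : PA) (p q : PQ) : p * (a • q) = a • (p * q) := by
  ext1 <;> simp <;> ring
theorem smR (a : ℝ) (p q : PQ) : (a • p) * q = a • (p * q) := by
  ext1 <;> simp [MvPolynomial.smul_eq_C_mul] <;> ring
theorem mulsR (a : ℝ) (p q : PQ) : p * (a • q) = a • (p * q) := by
  ext1 <;> simp [MvPolynomial.smul_eq_C_mul] <;> ring
theorem zsA (p : PQ) : (0 : PA) • p = 0 := by ext1 <;> simp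
theorem sA_one (a : PA) (p : PQ) : p * (a • (1 : PQ)) = a • p := by
  rw [mulsA, mul_one]
theorem C_smul (a : ℝ) (p : PQ) : (C a : PA) • p = a • p := by
  ext1 <;> simp [MvPolynomial.smul_eq_C_mul]

/-- units -/
noncomputable def EQ : Fin 4 → PQ := ![mkA 1 0 0 0, mkA 0 1 0 0, mkA 0 0 1 0, mkA 0 0 0 1]
/-- the variable -/
noncomputable def xQ : PQ := mkA (X 0) (X 1) (X 2) (X 3)
/-- square radius -/
noncomputable def rr : PA := X 0 ^ 2 + X 1 ^ 2 + X 2 ^ 2 + X 3 ^ 2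

theorem dQ_EQ (i j) : dQ i (EQ j) = 0 := by
  fin_cases j <;> ext1 <;> simp [EQ]

/-- right Fueter operator -/
noncomputable def DQ : PQ →ₗ[ℝ] PQ where
  toFun φ := ∑ i, dQ i φ * EQ i
  map_add' x y := by simp only [map_add, add_mul, Finset.sum_add_distrib]
  map_smul' c x := by
    simp only [map_smul, smR, RingHom.id_apply, Finset.smul_sum]
theorem DQ_apply (φ : PQ) : DQ φ = ∑ i, dQ i φ * EQ i := rfl

theorem pderiv_rr (i) : pderiv i rr = 2 * X i := by
  fin_cases i <;> simp [rr, Derivation.leibniz_pow, pderiv_X] 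

theorem dQ_xb (j) : dQ j (star xQ) = star (EQ j) := by
  fin_cases j <;> ext1 <;> simp [EQ, xQ, pderiv_X]

theorem alg1 (i j) : EQ i * star xQ * EQ j =
    (2 * X j : PA) • EQ i - (if i = j then (2 : PA) else 0) • xQ + EQ j * star (EQ i) * xQ := by
  fin_cases i <;> fin_cases j <;> ext1 <;> simp [EQ, xQ] <;> ring

theorem sum_star : ∑ j, star (EQ j) * EQ j = (4 : PA) • (1 : PQ) := by
  simp only [Fin.sum_univ_four]
  ext1 <;> simp [EQ]; norm_num

theorem DQ_dQ (i) (φ : PQ) (h : DQ φ = 0) : DQ (dQ i φ) = 0 := by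
  have := congrArg (dQ i) h
  rw [map_zero, DQ_apply, map_sum] at this
  rw [DQ_apply, ← this]
  refine Finset.sum_congr rfl fun j _ => ?_
  rw [dQ_mul, dQ_EQ, dQ_comm]; simp

theorem DQ_x (i) (φ : PQ) (h : DQ φ = 0) : DQ ((X i : PA) • φ) = φ * EQ i := by
  rw [DQ_apply]
  simp only [dQ_smul, add_mul, Finset.sum_add_distrib, smA, ← Finset.smul_sum]
  rw [← DQ_apply, h, smul_zero, add_zero]
  rw [Finset.sum_eq_single i]
  · simp
  · intro j _ hj; rw [pderiv_X_of_ne hj.symm, zsA]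
  · simp

theorem DQ_rr (ψ : PQ) (h : DQ ψ = 0) : DQ (rr • ψ) = (2 : PA) • (ψ * xQ) := by
  rw [DQ_apply]
  simp only [dQ_smul, add_mul, Finset.sum_add_distrib, smA, ← Finset.smul_sum]
  rw [← DQ_apply, h, smul_zero, add_zero]
  simp only [pderiv_rr, Fin.sum_univ_four]
  ext1 <;> simp [EQ, xQ] <;> ring

theorem DQ_ex (i) (φ : PQ) (h : DQ φ = 0) : DQ (φ * EQ i * star xQ) =
    (2 : PA) • ((∑ j, (X j : PA) • dQ j φ) * EQ i) - (2 : PA) • (dQ i φ * xQ) + (4 : PA) • (φ * EQ i) := by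
  have h1 : DQ (φ * EQ i * star xQ) = ∑ j, dQ j φ * (EQ i * star xQ * EQ j) +
      φ * EQ i * ∑ j, star (EQ j) * EQ j := by
    rw [DQ_apply, Finset.mul_sum, ← Finset.sum_add_distrib]
    refine Finset.sum_congr rfl fun j _ => ?_
    rw [dQ_mul, dQ_mul, dQ_EQ, dQ_xb]
    simp only [mul_zero, add_zero, add_mul, mul_assoc]
  have h2 : ∑ j, dQ j φ * (EQ i * star xQ * EQ j) =
      (2 : PA) • ((∑ j, (X j : PA) • dQ j φ) * EQ i) - (2 : PA) • (dQ i φ * xQ)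
        + DQ φ * (star (EQ i) * xQ) := by
    have e : ∀ j, dQ j φ * (EQ i * star xQ * EQ j) = (2 : PA) • (((X j : PA) • dQ j φ) * EQ i)
        - (if i = j then (2 : PA) else 0) • (dQ j φ * xQ) + dQ j φ * EQ j * (star (EQ i) * xQ) := by
      intro j
      rw [alg1, mul_add, mul_sub, mulsA, mulsA, smA, mul_smul]
      simp only [mul_assoc]
    rw [Finset.sum_congr rfl fun j _ => e j, Finset.sum_add_distrib, Finset.sum_sub_distrib,
      ← Finset.smul_sum, ← Finset.sum_mul, ← Finset.sum_mul, ← DQ_apply]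
    congr 2
    rw [Finset.sum_eq_single i]
    · rw [if_pos rfl]
    · intro j _ hj; rw [if_neg hj.symm, zsA]
    · simp
  rw [h1, h2, h, sum_star, sA_one, zero_mul, add_zero]
end Sk
end

section
set_option autoImplicit false
set_option linter.unusedSectionVars false
open Metric Set unitInterval Module Quaternion MvPolynomial

namespace Sk
/-- homogeneous quaternionic polynomials of degree k -/
def HomQ (k : ℕ) : Submodule ℝ PQ where
  carrier := {φ | φ.re.IsHomogeneous k ∧ φ.imI.IsHomogeneous k ∧ φ.imJ.IsHomogeneous k ∧ φ.imK.IsHomogeneous k}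
  zero_mem' := by simp [isHomogeneous_zero]
  add_mem' := by
    rintro a b ⟨h1, h2, h3, h4⟩ ⟨g1, g2, g3, g4⟩
    exact ⟨h1.add g1, h2.add g2, h3.add g3, h4.add g4⟩
  smul_mem' := by
    rintro c a ⟨h1, h2, h3, h4⟩
    have key : ∀ p : PA, p.IsHomogeneous k → (c • p).IsHomogeneous k := fun p hp =>
      (homogeneousSubmodule (Fin 4) ℝ k).smul_mem c hp
    exact ⟨key _ h1, key _ h2, key _ h3, key _ h4⟩

theorem mem_HomQ {k : ℕ} {φ : PQ} : φ ∈ HomQ k ↔ φ.re.IsHomogeneous k ∧ φ.imI.IsHomogeneous k ∧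
    φ.imJ.IsHomogeneous k ∧ φ.imK.IsHomogeneous k := Iff.rfl

theorem HomQ_mul {j k : ℕ} {φ ψ : PQ} (h : φ ∈ HomQ j) (g : ψ ∈ HomQ k) : φ * ψ ∈ HomQ (j + k) := by
  obtain ⟨h1, h2, h3, h4⟩ := h
  obtain ⟨g1, g2, g3, g4⟩ := g
  refine ⟨?_, ?_, ?_, ?_⟩
  · rw [Quaternion.re_mul]
    exact (((h1.mul g1).sub (h2.mul g2)).sub (h3.mul g3)).sub (h4.mul g4)
  · rw [Quaternion.imI_mul]
    exact (((h1.mul g2).add (h2.mul g1)).add (h3.mul g4)).sub (h4.mul g3)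
  · rw [Quaternion.imJ_mul]
    exact (((h1.mul g3).sub (h2.mul g4)).add (h3.mul g1)).add (h4.mul g2)
  · rw [Quaternion.imK_mul]
    exact (((h1.mul g4).add (h2.mul g3)).sub (h3.mul g2)).add (h4.mul g1)

theorem HomQ_smul {j k : ℕ} {a : PA} {ψ : PQ} (h : a.IsHomogeneous j) (g : ψ ∈ HomQ k) : a • ψ ∈ HomQ (j + k) := by
  obtain ⟨g1, g2, g3, g4⟩ := g
  exact ⟨h.mul g1, h.mul g2, h.mul g3, h.mul g4⟩

theorem HomQ_d {k : ℕ} (i) {φ : PQ} (h : φ ∈ HomQ k) : dQ i φ ∈ HomQ (k - 1) := by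
  obtain ⟨g1, g2, g3, g4⟩ := h
  exact ⟨g1.pderiv, g2.pderiv, g3.pderiv, g4.pderiv⟩

theorem EQ_hom (i) : EQ i ∈ HomQ 0 := by
  fin_cases i <;> simp [EQ, mem_HomQ, isHomogeneous_zero, isHomogeneous_one]

theorem xb_hom : star xQ ∈ HomQ 1 := by
  have := fun i => isHomogeneous_X ℝ (i : Fin 4)
  refine ⟨?_, ?_, ?_, ?_⟩ <;> simp [xQ]
  · exact this 0
  · exact (this 1).neg
  · exact (this 2).neg
  · exact (this 3).neg

theorem rr_hom : rr.IsHomogeneous 2 := by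
  have := fun i => (isHomogeneous_X ℝ (i : Fin 4)).pow 2
  exact (((this 0).add (this 1)).add (this 2)).add (this 3)

/-- monogenic homogeneous polynomials -/
noncomputable def MM (k : ℕ) : Submodule ℝ PQ := HomQ k ⊓ LinearMap.ker DQ

theorem euler {k : ℕ} {φ : PQ} (h : φ ∈ HomQ k) : ∑ j, (X j : PA) • dQ j φ = (k : ℝ) • φ := by
  obtain ⟨g1, g2, g3, g4⟩ := h
  have := g1.sum_X_mul_pderiv
  have := g2.sum_X_mul_pderiv
  have := g3.sum_X_mul_pderiv
  have := g4.sum_X_mul_pderiv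
  simp only [Fin.sum_univ_four] at *
  ext1 <;> simp [*, MvPolynomial.smul_eq_C_mul]

theorem MM_d {k : ℕ} (i) {φ : PQ} (h : φ ∈ MM k) : dQ i φ ∈ MM (k - 1) :=
  ⟨HomQ_d i h.1, DQ_dQ i φ h.2⟩

theorem HomQ_zero {φ : PQ} (h : φ ∈ HomQ 0) (i) : dQ i φ = 0 := by
  have key : ∀ p : PA, p.IsHomogeneous 0 → pderiv i p = 0 := by
    intro p hp
    rw [← totalDegree_zero_iff_isHomogeneous, totalDegree_eq_zero_iff_eq_C] at hp
    rw [hp]; simp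
  obtain ⟨g1, g2, g3, g4⟩ := h
  ext1 <;> simp [key, *]

/-- the corrected product -/
noncomputable def mI (k : ℕ) (i : Fin 4) (φ : PQ) : PQ :=
  (X i : PA) • φ - (1 / (2 * (k : ℝ) + 4)) • (φ * EQ i * star xQ + rr • dQ i φ)

theorem MM_mI {k : ℕ} (i) {φ : PQ} (h : φ ∈ MM k) : mI k i φ ∈ MM (k + 1) := by
  have hD : DQ φ = 0 := h.2
  constructor
  · refine Submodule.sub_mem _ ?_ (Submodule.smul_mem _ _ (Submodule.add_mem _ ?_ ?_))
    · rw [add_comm]; exact HomQ_smul (isHomogeneous_X ℝ i) h.1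
    · exact HomQ_mul (HomQ_mul h.1 (EQ_hom i)) xb_hom
    · rcases Nat.eq_zero_or_pos k with rfl | hk
      · rw [HomQ_zero h.1]; simp only [smul_zero]; exact Submodule.zero_mem _
      · have := HomQ_smul rr_hom (HomQ_d i h.1)
        convert this using 2; omega
  · rw [SetLike.mem_coe, LinearMap.mem_ker]
    unfold mI
    rw [map_sub, DQ_x i φ hD, map_smul, map_add, DQ_ex i φ hD, DQ_rr _ (DQ_dQ i φ hD), euler h.1]
    have : (2 * (k : ℝ) + 4) ≠ 0 := by positivity
    rw [smR]
    have e : ∀ a b : PQ, (2 : PA) • (k : ℝ) • a - (2 : PA) • b + (4 : PA) • a + (2 : PA) • b =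
        (2 * (k : ℝ) + 4) • a := by
      intro a b
      rw [← C_smul, ← C_smul]
      have c2 : (C 2 : PA) = 2 := map_ofNat C 2
      have c4 : (C 4 : PA) = 4 := map_ofNat C 4
      ext1 <;> simp [c2, c4] <;> ring
    rw [e, smul_smul, one_div, inv_mul_cancel₀ this, one_smul, sub_self]

/-- constant polynomial -/
noncomputable def cQ (u : ℍ[ℝ]) : PQ := mkA (C u.re) (C u.imI) (C u.imJ) (C u.imK)
@[simp] theorem cQ_re (u : ℍ[ℝ]) : (cQ u).re = C u.re := rfl
@[simp] theorem cQ_imI (u : ℍ[ℝ]) : (cQ u).imI = C u.imI := rfl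
@[simp] theorem cQ_imJ (u : ℍ[ℝ]) : (cQ u).imJ = C u.imJ := rfl
@[simp] theorem cQ_imK (u : ℍ[ℝ]) : (cQ u).imK = C u.imK := rfl
theorem cQ_hom (u : ℍ[ℝ]) : cQ u ∈ HomQ 0 :=
  ⟨isHomogeneous_C _ _, isHomogeneous_C _ _, isHomogeneous_C _ _, isHomogeneous_C _ _⟩
theorem dQ_cQ (i) (u : ℍ[ℝ]) : dQ i (cQ u) = 0 := HomQ_zero (cQ_hom u) i
theorem MM_c {k : ℕ} (u : ℍ[ℝ]) {φ : PQ} (h : φ ∈ MM k) : cQ u * φ ∈ MM k := by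
  constructor
  · have := HomQ_mul (cQ_hom u) h.1
    rwa [zero_add] at this
  · rw [SetLike.mem_coe, LinearMap.mem_ker, DQ_apply]
    have : DQ φ = 0 := h.2
    rw [DQ_apply] at this
    rw [← mul_zero (cQ u), ← this, Finset.mul_sum]
    refine Finset.sum_congr rfl fun j _ => ?_
    rw [dQ_mul, dQ_cQ, zero_mul, zero_add, mul_assoc]
theorem cQ_MM (u : ℍ[ℝ]) : cQ u ∈ MM 0 := by
  refine ⟨cQ_hom u, ?_⟩
  rw [SetLike.mem_coe, LinearMap.mem_ker, DQ_apply]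
  simp [dQ_cQ]
theorem MM_zero {φ : PQ} (h : φ ∈ MM 0) : ∃ u, φ = cQ u := by
  have key : ∀ p : PA, p.IsHomogeneous 0 → p = C (coeff 0 p) := by
    intro p hp
    rwa [← totalDegree_zero_iff_isHomogeneous, totalDegree_eq_zero_iff_eq_C] at hp
  obtain ⟨⟨g1, g2, g3, g4⟩, -⟩ := h
  refine ⟨mkQ (coeff 0 φ.re) (coeff 0 φ.imI) (coeff 0 φ.imJ) (coeff 0 φ.imK), ?_⟩
  ext1 <;> simp
  · exact key _ g1
  · exact key _ g2
  · exact key _ g3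
  · exact key _ g4

theorem hs_fin (k : ℕ) : Module.Finite ℝ (homogeneousSubmodule (Fin 4) ℝ k) := by
  exact Module.Finite.iff_fg.2 (homogeneousSubmodule_fg _ _ _)

theorem MM_fin (k : ℕ) : Module.Finite ℝ (MM k) := by
  haveI := hs_fin k
  let H := homogeneousSubmodule (Fin 4) ℝ k
  let L : MM k →ₗ[ℝ] (H × H) × (H × H) :=
    { toFun := fun φ => ((⟨φ.1.re, φ.2.1.1⟩, ⟨φ.1.imI, φ.2.1.2.1⟩), (⟨φ.1.imJ, φ.2.1.2.2.1⟩, ⟨φ.1.imK, φ.2.1.2.2.2⟩))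
      map_add' := fun a b => rfl
      map_smul' := fun a b => rfl }
  refine Module.Finite.of_injective L ?_
  intro a b hab
  have h1 : a.1.re = b.1.re := congrArg (fun z => (z.1.1 : PA)) hab
  have h2 : a.1.imI = b.1.imI := congrArg (fun z => (z.1.2 : PA)) hab
  have h3 : a.1.imJ = b.1.imJ := congrArg (fun z => (z.2.1 : PA)) hab
  have h4 : a.1.imK = b.1.imK := congrArg (fun z => (z.2.2 : PA)) hab
  apply Subtype.ext
  ext1 <;> assumption
end Sk
end

section
set_option autoImplicit false
set_option linter.unusedSectionVars false
open Metric Set unitInterval Module Quaternion MvPolynomial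

namespace Sk
/-- vector fields -/
noncomputable def vf : Fin 3 → Fin 4 → PA :=
  ![![-X 1, X 0, -X 3, X 2], ![-X 2, X 3, X 0, -X 1], ![-X 3, -X 2, X 1, X 0]]

/-- derivation -/
noncomputable def XA (a : Fin 3) : Derivation ℝ PA PA := ∑ i, vf a i • (pderiv i : Derivation ℝ PA PA)
theorem XA_apply (a) (p : PA) : XA a p = ∑ i, vf a i * pderiv i p := by
  simp only [XA, Fin.sum_univ_four, Derivation.add_apply, Derivation.smul_apply, smul_eq_mul]
theorem XA_X (a i) : XA a (X i) = vf a i := by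
  rw [XA_apply, Finset.sum_eq_single i]
  · simp
  · intro j _ hj; rw [pderiv_X_of_ne hj.symm, mul_zero]
  · simp

/-- componentwise -/
noncomputable def XQ (a : Fin 3) (φ : PQ) : PQ :=
  mkA (XA a φ.re) (XA a φ.imI) (XA a φ.imJ) (XA a φ.imK)
@[simp] theorem XQ_re (a) (φ : PQ) : (XQ a φ).re = XA a φ.re := rfl
@[simp] theorem XQ_imI (a) (φ : PQ) : (XQ a φ).imI = XA a φ.imI := rfl
@[simp] theorem XQ_imJ (a) (φ : PQ) : (XQ a φ).imJ = XA a φ.imJ := rfl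
@[simp] theorem XQ_imK (a) (φ : PQ) : (XQ a φ).imK = XA a φ.imK := rfl

/-- Dirac type operator -/
noncomputable def GQ (φ : PQ) : PQ := - ∑ a : Fin 3, XQ a φ * EQ a.succ

theorem XQ_eq (a) (φ : PQ) : XQ a φ = ∑ i, vf a i • dQ i φ := by
  simp only [Fin.sum_univ_four]
  ext1 <;> simp [XA_apply, Fin.sum_univ_four]

theorem DQ_XQ (φ : PQ) : rr • DQ φ = (∑ j, (X j : PA) • dQ j φ) * xQ - GQ φ * xQ := by
  rw [DQ_apply, GQ]
  simp only [XQ_eq, Fin.sum_univ_four, Fin.sum_univ_three]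
  generalize dQ 0 φ = a
  generalize dQ 1 φ = b
  generalize dQ 2 φ = c
  generalize dQ 3 φ = d
  ext1 <;> simp [EQ, xQ, vf, rr] <;> ring

theorem GQ_MM {k : ℕ} {φ : PQ} (h : φ ∈ MM k) : rr • GQ φ = rr • (k : ℝ) • φ := by
  have h1 := DQ_XQ φ
  have h2 : DQ φ = 0 := h.2
  rw [h2, euler h.1, smul_zero] at h1
  have h3 : GQ φ * xQ = ((k : ℝ) • φ) * xQ := (sub_eq_zero.1 h1.symm).symm
  have h4 : ∀ p : PQ, p * xQ * star xQ = rr • p := by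
    intro p
    ext1 <;> simp [xQ, rr] <;> ring
  rw [← h4, ← h4, h3]

theorem GQ_xb : GQ (star xQ) = (-3 : ℝ) • star xQ := by
  rw [GQ]
  simp only [Fin.sum_univ_three]
  have c3 : (C 3 : PA) = 3 := map_ofNat C 3
  ext1 <;> simp [xQ, EQ, XA_X, vf, MvPolynomial.smul_eq_C_mul, c3] <;> ring

/-- inner product -/
noncomputable def dotA (φ ψ : PQ) : PA := φ.re * ψ.re + φ.imI * ψ.imI + φ.imJ * ψ.imJ + φ.imK * ψ.imK

theorem dot_GQ (φ ψ : PQ) : dotA (GQ φ) ψ - dotA φ (GQ ψ) = ∑ a : Fin 3, XA a (dotA φ (ψ * EQ a.succ)) := by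
  simp only [GQ, Fin.sum_univ_three, dotA]
  simp [EQ, Derivation.leibniz]
  ring

/-- coordinate functions -/
noncomputable def cS : Fin 4 → C(Sph ℍ[ℝ], ℝ) :=
  ![⟨fun x => (x : ℍ[ℝ]).re, Quaternion.continuous_re.comp continuous_subtype_val⟩, ⟨fun x => (x : ℍ[ℝ]).imI, Quaternion.continuous_imI.comp continuous_subtype_val⟩,
    ⟨fun x => (x : ℍ[ℝ]).imJ, Quaternion.continuous_imJ.comp continuous_subtype_val⟩, ⟨fun x => (x : ℍ[ℝ]).imK, Quaternion.continuous_imK.comp continuous_subtype_val⟩]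
theorem cS0 (x) : cS 0 x = (x : ℍ[ℝ]).re := rfl
theorem cS1 (x) : cS 1 x = (x : ℍ[ℝ]).imI := rfl
theorem cS2 (x) : cS 2 x = (x : ℍ[ℝ]).imJ := rfl
theorem cS3 (x) : cS 3 x = (x : ℍ[ℝ]).imK := rfl

/-- evaluation on the sphere -/
noncomputable def ev : PA →ₐ[ℝ] C(Sph ℍ[ℝ], ℝ) := aeval cS
@[simp] theorem ev_X (i) : ev (X i) = cS i := by simp [ev]

/-- one parameter groups -/
noncomputable def gS (a : Fin 3) (s : ℝ) : Sph ℍ[ℝ] :=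
  ⟨mkQ (Real.cos s) (Real.sin s * ![1, 0, 0] a) (Real.sin s * ![0, 1, 0] a) (Real.sin s * ![0, 0, 1] a), by
    rw [mem_sphere_zero_iff_norm, norm_one_iff]
    fin_cases a <;> simp⟩

theorem cS_gS (a i s) : (cS i).comp (ContinuousMap.mulLeft (gS a s)) =
    Real.cos s • cS i + Real.sin s • ev (vf a i) := by
  ext x
  fin_cases a <;> fin_cases i <;>
    simp [gS, vf, cS0, cS1, cS2, cS3] <;> ring

theorem ev_deriv (a) (p : PA) :
    HasDerivAt (fun s : ℝ => (ev p).comp (ContinuousMap.mulLeft (gS a s))) (ev (XA a p)) 0 := by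
  have h0 : ∀ i, Real.cos 0 • cS i + Real.sin 0 • ev (vf a i) = cS i := by intro i; simp
  have e : ∀ s (p : PA), (ev p).comp (ContinuousMap.mulLeft (gS a s)) =
      aeval (fun i => Real.cos s • cS i + Real.sin s • ev (vf a i)) p := by
    intro s p
    have : (ContinuousMap.compRightAlgHom ℝ ℝ (ContinuousMap.mulLeft (gS a s))).comp ev =
        aeval (fun i => Real.cos s • cS i + Real.sin s • ev (vf a i)) := by
      apply MvPolynomial.algHom_ext
      intro i
      simp only [AlgHom.comp_apply, ev_X, aeval_X, ← cS_gS]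
      rfl
    rw [← this]; rfl
  simp only [e]
  induction p using MvPolynomial.induction_on with
  | C r => simpa using hasDerivAt_const (0 : ℝ) (algebraMap ℝ C(Sph ℍ[ℝ], ℝ) r)
  | add p q hp hq =>
    simp only [map_add]
    exact hp.fun_add hq
  | mul_X p i hp =>
    have h1 : HasDerivAt (fun s : ℝ => Real.cos s • cS i + Real.sin s • ev (vf a i)) (ev (vf a i)) 0 := by
      have := ((Real.hasDerivAt_cos 0).smul_const (cS i)).fun_add
        ((Real.hasDerivAt_sin 0).smul_const (ev (vf a i)))
      refine this.congr_deriv ?_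
      simp
    have h2 := hp.mul h1
    simp only [h0] at h2
    simp only [map_mul, aeval_X]
    refine h2.congr_deriv ?_
    rw [Derivation.leibniz, XA_X]
    simp [ev]
    ring
end Sk
end

section
set_option autoImplicit false
set_option linter.unusedSectionVars false
open Metric Set unitInterval Module Quaternion MvPolynomial MeasureTheory

namespace Sk
noncomputable instance msS : MeasurableSpace (Sph ℍ[ℝ]) := borel _
instance bsS : BorelSpace (Sph ℍ[ℝ]) := ⟨rfl⟩

/-- Haar measure -/
noncomputable def sg : Measure (Sph ℍ[ℝ]) := Measure.haarMeasure ⊤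
instance : sg.IsHaarMeasure := by unfold sg; infer_instance
instance : IsProbabilityMeasure sg := ⟨by
  have := Measure.haarMeasure_self (K₀ := (⊤ : TopologicalSpace.PositiveCompacts (Sph ℍ[ℝ])))
  simpa [sg] using this⟩

/-- the Hilbert space -/
noncomputable abbrev HH := Lp ℍ[ℝ] 2 sg

/-- embedding -/
noncomputable def tl : C(Sph ℍ[ℝ], ℍ[ℝ]) →L[ℝ] HH := ContinuousMap.toLp 2 sg ℝ
theorem tl_ae (f : C(Sph ℍ[ℝ], ℍ[ℝ])) : tl f =ᵐ[sg] f := ContinuousMap.coeFn_toLp sg f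

/-- multiplication operator -/
noncomputable def el : C(Sph ℍ[ℝ], ℍ[ℝ]) →L[ℝ] (HH →L[ℝ] HH) :=
  (ContinuousLinearMap.holderL sg ⊤ 2 2 (ContinuousLinearMap.mul ℝ ℍ[ℝ])).comp (ContinuousMap.toLp ⊤ sg ℝ)

theorem el_ae (f : C(Sph ℍ[ℝ], ℍ[ℝ])) (v : HH) : el f v =ᵐ[sg] fun x => f x * v x := by
  have h1 : el f v = ContinuousLinearMap.holder 2 (ContinuousLinearMap.mul ℝ ℍ[ℝ]) (ContinuousMap.toLp ⊤ sg ℝ f) v := rfl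
  have h2 := ContinuousLinearMap.coeFn_holder (r := 2) (ContinuousLinearMap.mul ℝ ℍ[ℝ]) (ContinuousMap.toLp ⊤ sg ℝ f) v
  rw [h1]
  filter_upwards [h2, ContinuousMap.coeFn_toLp (p := ⊤) (𝕜 := ℝ) sg f] with x hx hy
  rw [hx, hy]; rfl

theorem el_tl (f g : C(Sph ℍ[ℝ], ℍ[ℝ])) : el f (tl g) = tl (f * g) := by
  apply Lp.ext
  filter_upwards [el_ae f (tl g), tl_ae g, tl_ae (f * g)] with x h1 h2 h3
  rw [h1, h2, h3]; rfl

theorem el_mul (f g : C(Sph ℍ[ℝ], ℍ[ℝ])) : el (f * g) = el f * el g := by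
  ext1 v
  apply Lp.ext
  rw [mul_apply_eq_comp]
  filter_upwards [el_ae f (el g v), el_ae (f * g) v, el_ae g v] with x h1 h2 h3
  rw [h1, h2, h3, ContinuousMap.mul_apply, mul_assoc]

theorem el_one : el 1 = 1 := by
  ext1 v
  apply Lp.ext
  filter_upwards [el_ae 1 v] with x h1
  rw [h1, ContinuousMap.one_apply, one_mul]; rfl

theorem el_norm_le (f : C(Sph ℍ[ℝ], ℍ[ℝ])) (hf : ∀ x, ‖f x‖ ≤ 1) (v : HH) : ‖el f v‖ ≤ ‖v‖ := by
  apply Lp.norm_le_norm_of_ae_le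
  filter_upwards [el_ae f v] with x h1
  rw [h1, norm_mul]
  exact mul_le_of_le_one_left (norm_nonneg _) (hf x)

theorem el_norm (f : C(Sph ℍ[ℝ], ℍ[ℝ])) (hf : ∀ x, ‖f x‖ = 1) (v : HH) : ‖el f v‖ = ‖v‖ := by
  apply le_antisymm <;> apply Lp.norm_le_norm_of_ae_le <;>
  filter_upwards [el_ae f v] with x h1 <;> rw [h1, norm_mul, hf, one_mul]

theorem tl_norm_le (f g : C(Sph ℍ[ℝ], ℍ[ℝ])) (h : ∀ x, ‖f x‖ ≤ ‖g x‖) : ‖tl f‖ ≤ ‖tl g‖ := by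
  apply Lp.norm_le_norm_of_ae_le
  filter_upwards [tl_ae f, tl_ae g] with x h1 h2
  rw [h1, h2]; exact h x

theorem tl_inner (f g : C(Sph ℍ[ℝ], ℍ[ℝ])) : inner ℝ (tl f) (tl g) = ∫ x, inner ℝ (f x) (g x) ∂sg := by
  rw [L2.inner_def]
  apply integral_congr_ae
  filter_upwards [tl_ae f, tl_ae g] with x h1 h2
  rw [h1, h2]

theorem tl_const (u : ℍ[ℝ]) : ‖tl (ContinuousMap.const _ u)‖ = ‖u‖ := by
  have h := tl_inner (ContinuousMap.const _ u) (ContinuousMap.const _ u)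
  simp only [ContinuousMap.const_apply, integral_const, real_inner_self_eq_norm_sq] at h
  simp at h
  exact h

/-- evaluation of quaternionic polynomials -/
noncomputable def evQ : PQ →ₗ[ℝ] C(Sph ℍ[ℝ], ℍ[ℝ]) where
  toFun φ := ⟨fun x => mkQ (ev φ.re x) (ev φ.imI x) (ev φ.imJ x) (ev φ.imK x), by
    apply cont_quat <;> fun_prop⟩
  map_add' φ ψ := by ext x <;> simp
  map_smul' c φ := by ext x <;> simp

theorem evQ_apply (φ : PQ) (x) : evQ φ x = mkQ (ev φ.re x) (ev φ.imI x) (ev φ.imJ x) (ev φ.imK x) := rfl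
@[simp] theorem evQ_re (φ : PQ) (x) : (evQ φ x).re = ev φ.re x := rfl
@[simp] theorem evQ_imI (φ : PQ) (x) : (evQ φ x).imI = ev φ.imI x := rfl
@[simp] theorem evQ_imJ (φ : PQ) (x) : (evQ φ x).imJ = ev φ.imJ x := rfl
@[simp] theorem evQ_imK (φ : PQ) (x) : (evQ φ x).imK = ev φ.imK x := rfl

theorem evQ_mul (φ ψ : PQ) : evQ (φ * ψ) = evQ φ * evQ ψ := by
  ext x <;> simp
theorem evQ_star (φ : PQ) : evQ (star φ) = star (evQ φ) := by
  ext x <;> simp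
theorem evQ_x (x : Sph ℍ[ℝ]) : evQ xQ x = x := by
  ext <;> simp [xQ, cS0, cS1, cS2, cS3]
theorem evQ_c (u : ℍ[ℝ]) : evQ (cQ u) = ContinuousMap.const _ u := by
  have : ∀ r (x : Sph ℍ[ℝ]), ev (C r) x = r := fun r x => by simp [ev, _root_.algebraMap_apply]
  ext x <;> simp [this]
theorem ev_rr : ev rr = 1 := by
  ext x
  simp [rr, cS0, cS1, cS2, cS3]
  have := (norm_one_iff (x : ℍ[ℝ])).1 (by simp)
  linarith
theorem evQ_smul (a : PA) (φ : PQ) (x) : evQ (a • φ) x = ev a x • evQ φ x := by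
  have e : ∀ p q : PA, ev (p * q) x = ev p x * ev q x := fun p q => by
    rw [map_mul, ContinuousMap.mul_apply]
  ext
  · rw [evQ_re, Quaternion.re_smul, Quaternion.re_smul, smul_eq_mul, smul_eq_mul, evQ_re, e]
  · rw [evQ_imI, Quaternion.imI_smul, Quaternion.imI_smul, smul_eq_mul, smul_eq_mul, evQ_imI, e]
  · rw [evQ_imJ, Quaternion.imJ_smul, Quaternion.imJ_smul, smul_eq_mul, smul_eq_mul, evQ_imJ, e]
  · rw [evQ_imK, Quaternion.imK_smul, Quaternion.imK_smul, smul_eq_mul, smul_eq_mul, evQ_imK, e]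
theorem evQ_rr (φ : PQ) : evQ (rr • φ) = evQ φ := by
  apply ContinuousMap.ext; intro x
  rw [evQ_smul, ev_rr, ContinuousMap.one_apply, one_smul]

/-- integral functional -/
noncomputable def IS : C(Sph ℍ[ℝ], ℝ) →L[ℝ] ℝ := (L1.integralCLM' ℝ).comp (ContinuousMap.toLp 1 sg ℝ)
theorem IS_apply (f : C(Sph ℍ[ℝ], ℝ)) : IS f = ∫ x, f x ∂sg := by
  have : IS f = L1.integral (ContinuousMap.toLp 1 sg ℝ f) := by
    rw [L1.integral_eq' (𝕜 := ℝ)]; rfl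
  rw [this, L1.integral_eq_integral]
  exact integral_congr_ae (ContinuousMap.coeFn_toLp sg f)

theorem int_XA (a) (p : PA) : IS (ev (XA a p)) = 0 := by
  have h1 := IS.hasFDerivAt.comp_hasDerivAt 0 (ev_deriv a p)
  have h2 : (IS ∘ fun s : ℝ => (ev p).comp (ContinuousMap.mulLeft (gS a s))) = fun _ => ∫ x, ev p x ∂sg := by
    funext s
    simp only [Function.comp_apply, IS_apply]
    exact integral_mul_left_eq_self (fun x => ev p x) (gS a s)
  rw [h2] at h1
  exact h1.unique (hasDerivAt_const _ _)

/-- polynomials in the Hilbert space -/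
noncomputable def tq : PQ →ₗ[ℝ] HH := tl.toLinearMap ∘ₗ evQ
theorem tq_apply (φ : PQ) : tq φ = tl (evQ φ) := rfl

theorem tq_inner (φ ψ : PQ) : inner ℝ (tq φ) (tq ψ) = IS (ev (dotA φ ψ)) := by
  rw [tq_apply, tq_apply, tl_inner, IS_apply]
  congr 1; funext x
  rw [inner_coord]; simp [dotA]

theorem tq_GQ (φ ψ : PQ) : inner ℝ (tq (GQ φ)) (tq ψ) = inner ℝ (tq φ) (tq (GQ ψ)) := by
  rw [← sub_eq_zero, tq_inner, tq_inner, ← map_sub, ← map_sub, dot_GQ, map_sum, map_sum]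
  exact Finset.sum_eq_zero fun a _ => int_XA a _

theorem tq_rr (φ : PQ) : tq (rr • φ) = tq φ := by rw [tq_apply, evQ_rr]; rfl

theorem tq_G {k : ℕ} {φ : PQ} (h : φ ∈ MM k) : tq (GQ φ) = (k : ℝ) • tq φ := by
  rw [← tq_rr, GQ_MM h, tq_rr, map_smul]

theorem orth_MM {j k : ℕ} (hjk : j ≠ k) {φ ψ : PQ} (h : φ ∈ MM j) (g : ψ ∈ MM k) :
    inner ℝ (tq φ) (tq ψ) = 0 := by
  have := tq_GQ φ ψ
  rw [tq_G h, tq_G g, real_inner_smul_left, real_inner_smul_right, ← sub_eq_zero, ← sub_mul] at this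
  refine (mul_eq_zero.1 this).resolve_left ?_
  rw [sub_eq_zero]; exact_mod_cast hjk

theorem orth_xb {k : ℕ} {ψ : PQ} (g : ψ ∈ MM k) :
    inner ℝ (tq ψ) (tq (star xQ)) = 0 := by
  have := tq_GQ ψ (star xQ)
  rw [tq_G g, GQ_xb, map_smul, real_inner_smul_left, real_inner_smul_right, ← sub_eq_zero, ← sub_mul] at this
  refine (mul_eq_zero.1 this).resolve_left ?_
  have : (0 : ℝ) ≤ k := by positivity
  linarith
end Sk
end

section
set_option autoImplicit false
set_option linter.unusedSectionVars false
open Metric Set unitInterval Module Quaternion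

namespace Sk
section gr
/-- orthogonal finite dimensional grading -/
structure Gr (E : Type*) [NormedAddCommGroup E] [InnerProductSpace ℝ E] where
  /-- pieces -/
  N : ℕ → Submodule ℝ E
  fin : ∀ k, FiniteDimensional ℝ (N k)
  orth : ∀ j k, j ≠ k → N j ⟂ N k

variable {E : Type*} [NormedAddCommGroup E] [InnerProductSpace ℝ E] [CompleteSpace E] (g : Gr E)
instance (k) : FiniteDimensional ℝ (g.N k) := g.fin k

/-- closure of the sum -/
def Gr.W : Submodule ℝ E := (⨆ k, g.N k).topologicalClosure
instance : CompleteSpace g.W := by unfold Gr.W; infer_instance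

/-- projection to the closure -/
noncomputable def Gr.P : E →L[ℝ] E := g.W.starProjection
/-- projection to a piece -/
noncomputable def Gr.p (k : ℕ) : E →L[ℝ] E := (g.N k).starProjection
/-- partial sums -/
noncomputable def Gr.A (n : ℕ) : E →L[ℝ] E := ∑ k ∈ Finset.range n, g.p k
/-- tails -/
noncomputable def Gr.Q (n : ℕ) : E →L[ℝ] E := g.P - g.A n

theorem Gr.le (k) : g.N k ≤ g.W := (le_iSup g.N k).trans (Submodule.le_topologicalClosure _)
theorem Gr.p_mem (k v) : g.p k v ∈ g.N k := Submodule.starProjection_apply_mem _ _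
theorem Gr.P_mem (v) : g.P v ∈ g.W := Submodule.starProjection_apply_mem _ _
theorem Gr.P_self {v} (h : v ∈ g.W) : g.P v = v := Submodule.starProjection_eq_self_iff.2 h
theorem Gr.p_self {k v} (h : v ∈ g.N k) : g.p k v = v := Submodule.starProjection_eq_self_iff.2 h
theorem Gr.p_ne {j k v} (hjk : j ≠ k) (h : v ∈ g.N j) : g.p k v = 0 := by
  rw [Gr.p, Submodule.starProjection_apply_eq_zero_iff]
  exact (g.orth j k hjk) h
theorem Gr.P_zero {v} (h : ∀ k, ∀ w ∈ g.N k, inner ℝ w v = 0) : g.P v = 0 := by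
  rw [Gr.P, Submodule.starProjection_apply_eq_zero_iff, Gr.W, Submodule.orthogonal_closure]
  rw [Submodule.mem_orthogonal]
  intro u hu
  refine Submodule.iSup_induction g.N (motive := fun u => inner ℝ u v = 0) hu h (by simp) ?_
  intro x y hx hy
  rw [inner_add_left, hx, hy, add_zero]
theorem Gr.A_apply (n v) : g.A n v = ∑ k ∈ Finset.range n, g.p k v := by
  simp [Gr.A]
theorem Gr.A_mem (n v) : g.A n v ∈ g.W := by
  rw [Gr.A_apply]; exact Submodule.sum_mem _ fun k _ => g.le k (g.p_mem k v)
theorem Gr.A_N {k v} (n) (h : v ∈ g.N k) : g.A n v = if k < n then v else 0 := by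
  rw [Gr.A_apply]
  split_ifs with hk
  · rw [Finset.sum_eq_single k]
    · exact g.p_self h
    · intro j _ hj; exact g.p_ne hj.symm h
    · intro h; simp at h; omega
  · apply Finset.sum_eq_zero
    intro j hj; refine g.p_ne ?_ h
    rintro rfl; simp at hj; omega
theorem Gr.Q_N {k v} (n) (h : v ∈ g.N k) : g.Q n v = if k < n then 0 else v := by
  rw [Gr.Q, sub_apply, g.P_self (g.le k h), g.A_N n h]
  split_ifs <;> simp
theorem Gr.pP (k v) : g.p k (g.P v) = g.p k v := by
  have := Submodule.starProjection_comp_starProjection_of_le (g.le k)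
  exact congrArg (fun T => T v) this
theorem Gr.AP (n v) : g.A n (g.P v) = g.A n v := by
  simp only [Gr.A_apply, Gr.pP]
theorem Gr.PA (n v) : g.P (g.A n v) = g.A n v := g.P_self (g.A_mem n v)
theorem Gr.pA {k n} (hk : k < n) (v) : g.p k (g.A n v) = g.p k v := by
  rw [Gr.A_apply, map_sum, Finset.sum_eq_single k]
  · exact g.p_self (g.p_mem _ _)
  · intro j _ hj; exact g.p_ne hj (g.p_mem _ _)
  · intro h; simp at h; omega
theorem Gr.AA {m n} (h : m ≤ n) (v) : g.A m (g.A n v) = g.A m v := by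
  rw [Gr.A_apply, Gr.A_apply g m v]
  exact Finset.sum_congr rfl fun k hk => g.pA (by simp at hk; omega) v
theorem Gr.AA' {m n} (h : m ≤ n) (v) : g.A n (g.A m v) = g.A m v := by
  rw [Gr.A_apply g m v, map_sum]
  refine Finset.sum_congr rfl fun k hk => ?_
  rw [g.A_N n (g.p_mem k v), if_pos]
  simp at hk; omega
theorem Gr.PP (v) : g.P (g.P v) = g.P v := g.P_self (g.P_mem v)
theorem Gr.Q_apply (n v) : g.Q n v = g.P v - g.A n v := rfl
theorem Gr.QQ {m n} (h : m ≤ n) (v) : g.Q m (g.Q n v) = g.Q n v := by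
  simp only [Gr.Q_apply, map_sub, Gr.PP, Gr.PA, Gr.AP, g.AA h]
  abel
theorem Gr.Q_zero : g.Q 0 = g.P := by ext v; simp [Gr.Q_apply, Gr.A_apply]
theorem Gr.QP (n v) : g.Q n (g.P v) = g.Q n v := by
  simp only [Gr.Q_apply, map_sub, Gr.PP, Gr.PA, Gr.AP]
theorem Gr.PQ (n v) : g.P (g.Q n v) = g.Q n v := by
  simp only [Gr.Q_apply, map_sub, Gr.PP, Gr.PA, Gr.AP]
theorem Gr.Q_sym (n v w) : inner ℝ (g.Q n v) w = inner ℝ v (g.Q n w) := by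
  simp only [Gr.Q_apply, Gr.A_apply, inner_sub_left, inner_sub_right, sum_inner, inner_sum]
  congr 1
  · exact Submodule.inner_starProjection_left_eq_right _ _ _
  · exact Finset.sum_congr rfl fun k _ => Submodule.inner_starProjection_left_eq_right _ _ _
theorem Gr.Q_pyth (n v) : ‖v‖ ^ 2 = ‖g.Q n v‖ ^ 2 + ‖v - g.Q n v‖ ^ 2 := by
  have h : inner ℝ (g.Q n v) (v - g.Q n v) = 0 := by
    rw [Gr.Q_sym, map_sub, g.QQ le_rfl, sub_self, inner_zero_right]
  have := norm_add_sq_eq_norm_sq_add_norm_sq_of_inner_eq_zero _ _ h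
  simp only [add_sub_cancel] at this
  nlinarith
theorem Gr.Q_le (n v) : ‖g.Q n v‖ ≤ ‖v‖ := by
  have := g.Q_pyth n v
  exact abs_le_of_sq_le_sq' (by nlinarith [sq_nonneg ‖v - g.Q n v‖]) (norm_nonneg v) |>.2
theorem Gr.Q_le' (n v) : ‖v - g.Q n v‖ ≤ ‖v‖ := by
  have := g.Q_pyth n v
  exact abs_le_of_sq_le_sq' (by nlinarith [sq_nonneg ‖g.Q n v‖]) (norm_nonneg v) |>.2

theorem Gr.exA {v} (h : v ∈ ⨆ k, g.N k) : ∃ n, g.A n v = v := by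
  refine Submodule.iSup_induction g.N (motive := fun v => ∃ n, g.A n v = v) h ?_ ?_ ?_
  · intro k x hx
    exact ⟨k + 1, by rw [g.A_N _ hx, if_pos (by omega)]⟩
  · exact ⟨0, by simp⟩
  · intro x y hx hy
    obtain ⟨a, ha⟩ := hx
    obtain ⟨b, hb⟩ := hy
    refine ⟨max a b, ?_⟩
    rw [map_add]
    have h1 := g.AA' (le_max_left a b) x
    have h2 := g.AA' (le_max_right a b) y
    rw [ha] at h1
    rw [hb] at h2
    rw [h1, h2]

theorem Gr.dense {S : Set E} (hS : IsClosed S) (h : ∀ n v, g.A n v ∈ S) {v} (hv : v ∈ g.W) : v ∈ S := by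
  have : (g.W : Set E) ⊆ S := by
    rw [Gr.W, Submodule.topologicalClosure_coe]
    refine closure_minimal ?_ hS
    intro w hw
    obtain ⟨n, hn⟩ := g.exA hw
    rw [← hn]; exact h n w
  exact this hv

theorem Gr.sum_sq {φ : ℕ → E} (h : ∀ k, φ k ∈ g.N k) (n) :
    ‖∑ k ∈ Finset.range n, φ k‖ ^ 2 = ∑ k ∈ Finset.range n, ‖φ k‖ ^ 2 := by
  induction n with
  | zero => simp
  | succ n ih =>
    rw [Finset.sum_range_succ, Finset.sum_range_succ, ← ih]
    have : inner ℝ (∑ k ∈ Finset.range n, φ k) (φ n) = 0 := by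
      rw [sum_inner]
      refine Finset.sum_eq_zero fun k hk => ?_
      refine Submodule.inner_left_of_mem_orthogonal (K := g.N n) (h n) ?_
      exact g.orth k n (by simp at hk; omega) (h k)
    have := norm_add_sq_eq_norm_sq_add_norm_sq_of_inner_eq_zero _ _ this
    nlinarith

theorem Gr.A_sq (n v) : ‖g.A n v‖ ^ 2 = ∑ k ∈ Finset.range n, ‖g.p k v‖ ^ 2 := by
  rw [Gr.A_apply]; exact g.sum_sq (fun k => g.p_mem k v) n

theorem Gr.c_sq (c : ℕ → ℝ) (n v) : ‖∑ k ∈ Finset.range n, c k • g.p k v‖ ^ 2 =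
    ∑ k ∈ Finset.range n, c k ^ 2 * ‖g.p k v‖ ^ 2 := by
  rw [g.sum_sq (fun k => (g.N k).smul_mem _ (g.p_mem k v)) n]
  refine Finset.sum_congr rfl fun k _ => ?_
  rw [norm_smul, mul_pow, Real.norm_eq_abs, sq_abs]

theorem Gr.c_le (c : ℕ → ℝ) {B : ℝ} (hB : 0 ≤ B) (hc : ∀ k, |c k| ≤ B) (n v) :
    ‖∑ k ∈ Finset.range n, c k • g.p k v‖ ≤ B * ‖g.A n v‖ := by
  refine (abs_le_of_sq_le_sq' ?_ (by positivity)).2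
  rw [Gr.c_sq, mul_pow, Gr.A_sq, Finset.mul_sum]
  refine Finset.sum_le_sum fun k _ => mul_le_mul_of_nonneg_right ?_ (by positivity)
  rw [← sq_abs (c k)]
  exact pow_le_pow_left₀ (abs_nonneg _) (hc k) 2

/-- range of the partial sums -/
theorem Gr.ker_fin (n) : ∃ F : Submodule ℝ E, FiniteDimensional ℝ F ∧ ∀ v, v ∈ F ↔ (v ∈ g.W ∧ g.Q n v = 0) := by
  refine ⟨⨆ k : Fin n, g.N k, inferInstance, fun v => ⟨fun h => ?_, fun h => ?_⟩⟩
  · refine Submodule.iSup_induction (fun k : Fin n => g.N k)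
      (motive := fun v => v ∈ g.W ∧ g.Q n v = 0) h ?_ ?_ ?_
    · intro k x hx
      refine ⟨g.le k hx, ?_⟩
      rw [g.Q_N n hx, if_pos k.2]
    · exact ⟨g.W.zero_mem, by simp⟩
    · intro x y hx hy
      exact ⟨g.W.add_mem hx.1 hy.1, by rw [map_add, hx.2, hy.2, add_zero]⟩
  · have : v = g.A n v := by
      have := h.2
      rw [Gr.Q_apply, g.P_self h.1, sub_eq_zero] at this
      exact this
    rw [this, Gr.A_apply]
    refine Submodule.sum_mem _ fun k hk => ?_
    exact Submodule.mem_iSup_of_mem (⟨k, by simpa using hk⟩ : Fin n) (g.p_mem k v)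

/-- commutation with symmetries -/
theorem proj_comm (K : Submodule ℝ E) [K.HasOrthogonalProjection] (U U' : E →L[ℝ] E)
    (hU : ∀ v ∈ K, U v ∈ K) (hU' : ∀ v ∈ K, U' v ∈ K) (h : ∀ v w, inner ℝ (U v) w = inner ℝ v (U' w)) (v : E) :
    K.starProjection (U v) = U (K.starProjection v) := by
  apply Submodule.eq_starProjection_of_mem_of_inner_eq_zero
  · exact hU _ (Submodule.starProjection_apply_mem _ _)
  · intro w hw
    rw [← map_sub, h]
    exact Submodule.starProjection_inner_eq_zero _ _ (hU' w hw)

theorem Gr.Q_comm (U U' : E →L[ℝ] E) (hU : ∀ k, ∀ v ∈ g.N k, U v ∈ g.N k)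
    (hU' : ∀ k, ∀ v ∈ g.N k, U' v ∈ g.N k) (h : ∀ v w, inner ℝ (U v) w = inner ℝ v (U' w)) (n) (v : E) :
    g.Q n (U v) = U (g.Q n v) := by
  have hW : ∀ T : E →L[ℝ] E, (∀ k, ∀ v ∈ g.N k, T v ∈ g.N k) → ∀ v ∈ g.W, T v ∈ g.W := by
    intro T hT v hv
    have hc : IsClosed (g.W : Set E) := Submodule.isClosed_topologicalClosure _
    refine g.dense (S := T ⁻¹' (g.W : Set E)) (hc.preimage T.continuous) ?_ hv
    intro n v
    rw [mem_preimage, SetLike.mem_coe, Gr.A_apply, map_sum]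
    exact Submodule.sum_mem _ fun k _ => g.le k (hT k _ (g.p_mem k v))
  rw [Gr.Q_apply, Gr.Q_apply, map_sub, Gr.A_apply, Gr.A_apply, map_sum]
  congr 1
  · exact proj_comm _ U U' (hW U hU) (hW U' hU') h v
  · exact Finset.sum_congr rfl fun k _ => proj_comm _ U U' (hU k) (hU' k) h v
end gr
end Sk
end

section
set_option autoImplicit false
set_option linter.unusedSectionVars false
open Metric Set unitInterval Module Quaternion MvPolynomial MeasureTheory

namespace Sk
/-- the grading by monogenic polynomials -/
noncomputable def gM : Gr HH where
  N k := (MM k).map tq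
  fin k := by haveI := MM_fin k; infer_instance
  orth j k hjk := by
    rw [Submodule.isOrtho_iff_inner_eq]
    rintro _ ⟨φ, h, rfl⟩ _ ⟨ψ, h', rfl⟩
    exact orth_MM hjk h h'

theorem gM_mem {k : ℕ} {φ : PQ} (h : φ ∈ MM k) : tq φ ∈ gM.N k := ⟨φ, h, rfl⟩
theorem gM_ex {k : ℕ} {v : HH} (h : v ∈ gM.N k) : ∃ φ ∈ MM k, tq φ = v := h

/-- constant maps -/
noncomputable abbrev kc (u : ℍ[ℝ]) : C(Sph ℍ[ℝ], ℍ[ℝ]) := ContinuousMap.const _ u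

theorem el_tq (p φ : PQ) : el (evQ p) (tq φ) = tq (p * φ) := by
  rw [tq_apply, el_tl, tq_apply, evQ_mul]
theorem kc_tq (u : ℍ[ℝ]) (φ : PQ) : el (kc u) (tq φ) = tq (cQ u * φ) := by
  rw [← el_tq, evQ_c]
theorem kc_N (u : ℍ[ℝ]) (k : ℕ) (v : HH) (hv : v ∈ gM.N k) : el (kc u) v ∈ gM.N k := by
  obtain ⟨φ, h, rfl⟩ := gM_ex hv
  rw [kc_tq]; exact gM_mem (MM_c u h)
theorem kc_inner (u : ℍ[ℝ]) (v w : HH) : inner ℝ (el (kc u) v) w = inner ℝ v (el (kc (star u)) w) := by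
  rw [L2.inner_def, L2.inner_def]
  apply integral_congr_ae
  filter_upwards [el_ae (kc u) v, el_ae (kc (star u)) w] with x h1 h2
  rw [h1, h2, inner_coord, inner_coord]
  simp
  ring
theorem kc_Q (u : ℍ[ℝ]) (n : ℕ) (v : HH) : gM.Q n (el (kc u) v) = el (kc u) (gM.Q n v) :=
  gM.Q_comm _ _ (kc_N u) (kc_N (star u)) (kc_inner u) n v

theorem key_est (G L : HH →L[ℝ] HH) (hG : ∀ v, ‖G v‖ ≤ ‖v‖)
    (B : C(Sph ℍ[ℝ], ℍ[ℝ]) →ₗ[ℝ] C(Sph ℍ[ℝ], ℍ[ℝ])) (hB : ∀ f x, ‖B f x‖ ≤ ‖f x‖) (c : ℕ → ℝ)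
    (h : ∀ k, ∀ φ ∈ MM k, L (tq φ) = G (c k • tl (B (evQ φ)))) (n : ℕ) (v : HH) :
    ‖L (gM.A n v)‖ ≤ ‖∑ k ∈ Finset.range n, c k • gM.p k v‖ := by
  choose φ h1 h2 using fun k => gM_ex (gM.p_mem k v)
  have e1 : L (gM.A n v) = G (tl (B (evQ (∑ k ∈ Finset.range n, c k • φ k)))) := by
    rw [Gr.A_apply, map_sum, map_sum, map_sum, map_sum, map_sum]
    refine Finset.sum_congr rfl fun k _ => ?_
    rw [← h2, h k _ (h1 k), map_smul evQ, map_smul B, map_smul tl]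
  have e2 : ∑ k ∈ Finset.range n, c k • gM.p k v = tl (evQ (∑ k ∈ Finset.range n, c k • φ k)) := by
    rw [← tq_apply, map_sum]
    refine Finset.sum_congr rfl fun k _ => ?_
    rw [← h2, map_smul tq]
  rw [e1, e2]
  exact (hG _).trans (tl_norm_le _ _ (hB _))

theorem tx {k m : ℕ} (hm : m ≤ k - 1) (i : Fin 4) {φ : PQ} (h : φ ∈ MM k) :
    tq ((X i : PA) • φ) - gM.Q m (tq ((X i : PA) • φ)) = (1 / (2 * (k : ℝ) + 4)) •
      (tq (φ * EQ i * star xQ) - gM.Q m (tq (φ * EQ i * star xQ))) := by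
  have e : tq ((X i : PA) • φ) = tq (mI k i φ) + (1 / (2 * (k : ℝ) + 4)) • (tq (φ * EQ i * star xQ) + tq (dQ i φ)) := by
    rw [← tq_rr (dQ i φ), ← map_add, ← map_smul, ← map_add, mI, sub_add_cancel]
  have q1 : gM.Q m (tq (mI k i φ)) = tq (mI k i φ) := by
    rw [gM.Q_N m (gM_mem (MM_mI i h)), if_neg (by omega)]
  have q2 : gM.Q m (tq (dQ i φ)) = tq (dQ i φ) := by
    rw [gM.Q_N m (gM_mem (MM_d i h)), if_neg (by omega)]
  rw [e, map_add, map_smul, map_add, q1, q2, smul_sub, smul_add, smul_add]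
  abel

/-- real units -/
noncomputable def eR : Fin 4 → ℍ[ℝ] := ![1, qi, qj, qk]
theorem EQ_eR (i) : EQ i = cQ (eR i) := by
  fin_cases i <;> ext1 <;> simp [EQ, eR]
theorem eR_norm (i) : ‖eR i‖ = 1 := by
  rw [norm_one_iff]; fin_cases i <;> simp [eR]

/-- right multiplication -/
noncomputable def rmul (q : C(Sph ℍ[ℝ], ℍ[ℝ])) : C(Sph ℍ[ℝ], ℍ[ℝ]) →ₗ[ℝ] C(Sph ℍ[ℝ], ℍ[ℝ]) where
  toFun f := f * q
  map_add' f g := add_mul f g q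
  map_smul' c f := smul_mul_assoc c f q

/-- approximate invariance -/
def Good (f : C(Sph ℍ[ℝ], ℍ[ℝ])) : Prop := ∀ m, ∀ ε > 0, ∃ n, ∀ v,
  ‖el f (gM.Q n v) - gM.Q m (el f (gM.Q n v))‖ ≤ ε * ‖v‖

theorem good_mono {f : C(Sph ℍ[ℝ], ℍ[ℝ])} {m n n' : ℕ} {ε : ℝ} (hε : 0 ≤ ε) (hn : n ≤ n')
    (h : ∀ v, ‖el f (gM.Q n v) - gM.Q m (el f (gM.Q n v))‖ ≤ ε * ‖v‖) (v : HH) :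
    ‖el f (gM.Q n' v) - gM.Q m (el f (gM.Q n' v))‖ ≤ ε * ‖v‖ := by
  have := h (gM.Q n' v)
  rw [gM.QQ hn] at this
  exact this.trans (mul_le_mul_of_nonneg_left (gM.Q_le _ _) hε)

theorem good_add {f g : C(Sph ℍ[ℝ], ℍ[ℝ])} (hf : Good f) (hg : Good g) : Good (f + g) := by
  intro m ε hε
  obtain ⟨a, ha⟩ := hf m (ε / 2) (by positivity)
  obtain ⟨b, hb⟩ := hg m (ε / 2) (by positivity)
  refine ⟨max a b, fun v => ?_⟩
  have h1 := good_mono (by positivity) (le_max_left a b) ha v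
  have h2 := good_mono (by positivity) (le_max_right a b) hb v
  rw [map_add, add_apply, map_add, add_sub_add_comm]
  refine (norm_add_le _ _).trans ?_
  linarith

theorem good_mul {f g : C(Sph ℍ[ℝ], ℍ[ℝ])} (hf : Good f) (hg : Good g) : Good (f * g) := by
  intro m ε hε
  obtain ⟨a, ha⟩ := hf m (ε / (2 * (‖el g‖ + 1))) (by positivity)
  obtain ⟨b, hb⟩ := hg a (ε / (2 * (‖el f‖ + 1))) (by positivity)
  refine ⟨b, fun v => ?_⟩
  rw [el_mul, mul_apply_eq_comp]
  set w := el g (gM.Q b v) with hw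
  have e : el f w - gM.Q m (el f w) = (el f (gM.Q a w) - gM.Q m (el f (gM.Q a w))) +
      (el f (w - gM.Q a w) - gM.Q m (el f (w - gM.Q a w))) := by
    simp only [map_sub]; abel
  have n1 : ‖w‖ ≤ (‖el g‖ + 1) * ‖v‖ := by
    refine ((el g).le_opNorm _).trans ?_
    exact mul_le_mul (by linarith) (gM.Q_le _ _) (norm_nonneg _) (by positivity)
  have n2 : ‖el f (w - gM.Q a w)‖ ≤ (‖el f‖ + 1) * (ε / (2 * (‖el f‖ + 1)) * ‖v‖) := by
    refine ((el f).le_opNorm _).trans ?_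
    exact mul_le_mul (by linarith) (hb v) (norm_nonneg _) (by positivity)
  rw [e]
  refine (norm_add_le _ _).trans ?_
  refine (add_le_add (ha w) (gM.Q_le' _ _)).trans ?_
  have n3 : ε / (2 * (‖el g‖ + 1)) * ‖w‖ ≤ ε / (2 * (‖el g‖ + 1)) * ((‖el g‖ + 1) * ‖v‖) :=
    mul_le_mul_of_nonneg_left n1 (by positivity)
  have e1 : ε / (2 * (‖el g‖ + 1)) * ((‖el g‖ + 1) * ‖v‖) = ε / 2 * ‖v‖ := by
    have : ‖el g‖ + 1 ≠ 0 := by positivity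
    field_simp
  have e2 : (‖el f‖ + 1) * (ε / (2 * (‖el f‖ + 1)) * ‖v‖) = ε / 2 * ‖v‖ := by
    have : ‖el f‖ + 1 ≠ 0 := by positivity
    field_simp
  linarith

theorem good_kc (u : ℍ[ℝ]) : Good (kc u) := by
  intro m ε hε
  refine ⟨m, fun v => ?_⟩
  rw [kc_Q, gM.QQ le_rfl, sub_self, norm_zero]
  positivity

theorem good_closed : IsClosed {f | Good f} := by
  rw [← closure_subset_iff_isClosed]
  intro f hf m ε hε
  have hc : Filter.Tendsto (fun g => ‖el f - el g‖) (nhds f) (nhds 0) := by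
    have h0 : Continuous fun g => ‖el f - el g‖ := by
      have h3 : Continuous fun g => el f - el g := (continuous_sub_left (el f)).comp el.continuous
      exact (continuous_norm (E := HH →L[ℝ] HH)).comp h3
    have h1 := h0.tendsto f
    have h2 : ‖el f - el f‖ = 0 := by rw [sub_self (el f)]; exact norm_zero (E := HH →L[ℝ] HH)
    rwa [h2] at h1
  obtain ⟨g, hg, hgG⟩ := (mem_closure_iff_nhds.1 hf) _ (hc (Iio_mem_nhds (by positivity : 0 < ε / 2)))
  obtain ⟨n, hn⟩ := hgG m (ε / 2) (by positivity)
  refine ⟨n, fun v => ?_⟩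
  have hg' : ‖el f - el g‖ ≤ ε / 2 := le_of_lt hg
  have e : el f (gM.Q n v) - gM.Q m (el f (gM.Q n v)) =
      (el g (gM.Q n v) - gM.Q m (el g (gM.Q n v))) +
      ((el f - el g) (gM.Q n v) - gM.Q m ((el f - el g) (gM.Q n v))) := by
    simp only [sub_apply, map_sub]; abel
  rw [e]
  refine (norm_add_le _ _).trans ((add_le_add (hn v) ((gM.Q_le' _ _).trans
    (((el f - el g).le_opNorm _).trans (mul_le_mul hg' (gM.Q_le _ _) (norm_nonneg _) (by positivity))))).trans ?_)
  linarith

/-- scalar coordinate -/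
noncomputable def Xi (i : Fin 4) : PQ := (X i : PA) • (1 : PQ)
theorem Xi_mul (i : Fin 4) (φ : PQ) : Xi i * φ = (X i : PA) • φ := by rw [Xi, smA, one_mul]

theorem good_x (i : Fin 4) : Good (evQ (Xi i)) := by
  intro m ε hε
  obtain ⟨n0, hn0⟩ := exists_nat_gt (1 / ε)
  let n := max n0 (m + 1)
  refine ⟨n, fun v => ?_⟩
  let G : HH →L[ℝ] HH := 1 - gM.Q m
  let L : HH →L[ℝ] HH := G * el (evQ (Xi i)) * gM.Q n
  have hG : ∀ v, ‖G v‖ ≤ ‖v‖ := fun v => gM.Q_le' m v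
  let q := evQ (EQ i) * evQ (star xQ)
  have hq : ∀ x, ‖q x‖ = 1 := by
    intro x
    simp only [q, ContinuousMap.mul_apply, norm_mul, EQ_eR, evQ_c, ContinuousMap.const_apply, eR_norm,
      evQ_star, ContinuousMap.star_apply, norm_star, evQ_x, one_mul]
    simp
  have hc : ∀ k, |(fun k : ℕ => if k < n then 0 else 1 / (2 * (k : ℝ) + 4)) k| ≤ ε := by
    intro k
    dsimp only
    split_ifs with hk
    · simpa using hε.le
    · rw [abs_of_pos (by positivity), one_div_le (by positivity) hε]
      have h1 : n0 ≤ k := (le_max_left n0 (m+1)).trans (not_lt.1 hk)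
      have h1 : (n0 : ℝ) ≤ k := by exact_mod_cast h1
      linarith [(Nat.cast_nonneg k : (0:ℝ) ≤ k)]
  have hk : ∀ n' v, ‖L (gM.A n' v)‖ ≤ ε * ‖gM.A n' v‖ := by
    intro n' v
    refine (key_est G L hG (rmul q) ?_ _ ?_ n' v).trans (gM.c_le _ hε.le hc n' v)
    · intro f x
      show ‖f x * q x‖ ≤ _
      rw [norm_mul, hq, mul_one]
    · intro k φ hφ
      show G (el (evQ (Xi i)) (gM.Q n (tq φ))) = _
      rw [gM.Q_N n (gM_mem hφ)]
      split_ifs with hk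
      · rw [map_zero, map_zero, zero_smul, map_zero]
      · have h1 : m + 1 ≤ k := (le_max_right n0 (m+1)).trans (not_lt.1 hk)
        have h4 := tx (show m ≤ k - 1 by omega) i hφ
        rw [el_tq, Xi_mul, G.map_smul]
        generalize tq ((X i : PA) • φ) = w at *
        have e : tq (φ * EQ i * star xQ) = tl (rmul q (evQ φ)) := by
          rw [tq_apply, evQ_mul, evQ_mul, mul_assoc]; rfl
        rw [e] at h4; exact h4
  have hW : ∀ v ∈ gM.W, ‖L v‖ ≤ ε * ‖v‖ := by
    intro v hv
    refine gM.dense (S := {v | ‖L v‖ ≤ ε * ‖v‖}) ?_ hk hv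
    exact isClosed_le (by fun_prop) (by fun_prop)
  have h2 := hW _ (gM.P_mem v)
  have h3 : L (gM.P v) = L v := by
    show G (el (evQ (Xi i)) (gM.Q n (gM.P v))) = _
    rw [gM.QP]; rfl
  rw [h3] at h2
  refine h2.trans (mul_le_mul_of_nonneg_left ?_ hε.le)
  rw [← gM.Q_zero]; exact gM.Q_le 0 v
end Sk
end

section
set_option autoImplicit false
set_option linter.unusedSectionVars false
open Metric Set unitInterval Module Quaternion MvPolynomial MeasureTheory

namespace Sk
theorem ofR_cont : Continuous (Algebra.ofId ℝ ℍ[ℝ]) := by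
  have : (Algebra.ofId ℝ ℍ[ℝ] : ℝ → ℍ[ℝ]) = fun r : ℝ => (r : ℍ[ℝ]) := rfl
  rw [this]; exact Quaternion.continuous_coe

/-- real functions as quaternionic functions -/
noncomputable def iotR : C(Sph ℍ[ℝ], ℝ) →ₐ[ℝ] C(Sph ℍ[ℝ], ℍ[ℝ]) :=
  (Algebra.ofId ℝ ℍ[ℝ]).compLeftContinuous ℝ ofR_cont
theorem iotR_apply (h : C(Sph ℍ[ℝ], ℝ)) (x) : iotR h x = (h x : ℍ[ℝ]) := rfl
theorem iotR_cont : Continuous iotR := ContinuousMap.continuous_postcomp ⟨_, ofR_cont⟩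

theorem iotR_cS (i : Fin 4) : iotR (cS i) = evQ (Xi i) := by
  ext1 x
  rw [iotR_apply, Xi, evQ_smul]
  ext <;> simp

/-- good scalar functions -/
noncomputable def goodA : Subalgebra ℝ C(Sph ℍ[ℝ], ℝ) where
  carrier := {h | Good (iotR h)}
  add_mem' {a b} ha hb := by
    show Good (iotR (a + b)); rw [map_add]; exact good_add ha hb
  mul_mem' {a b} ha hb := by
    show Good (iotR (a * b)); rw [map_mul]; exact good_mul ha hb
  algebraMap_mem' r := by
    show Good _
    have : iotR (algebraMap ℝ _ r) = kc (r : ℍ[ℝ]) := by ext1 x; rw [iotR_apply]; rfl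
    rw [this]; exact good_kc _

theorem good_iotR (h : C(Sph ℍ[ℝ], ℝ)) : Good (iotR h) := by
  have h1 : goodA.SeparatesPoints := by
    intro x y hxy
    by_contra hc
    push Not at hc
    have h2 : ∀ i, cS i x = cS i y := fun i => hc _ ⟨cS i, by
      show Good _
      rw [iotR_cS]; exact good_x i, rfl⟩
    apply hxy
    ext
    · exact h2 0
    · exact h2 1
    · exact h2 2
    · exact h2 3
  have h2 := ContinuousMap.subalgebra_topologicalClosure_eq_top_of_separatesPoints _ h1
  have h3 : h ∈ goodA.topologicalClosure := by rw [h2]; trivial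
  have h4 : IsClosed {h | Good (iotR h)} := good_closed.preimage iotR_cont
  exact h4.closure_subset h3

/-- coordinate of a function -/
noncomputable def coo (f : C(Sph ℍ[ℝ], ℍ[ℝ])) (i : Fin 4) : C(Sph ℍ[ℝ], ℝ) :=
  ⟨fun x => ![(f x).re, (f x).imI, (f x).imJ, (f x).imK] i, by
    have := f.continuous
    fin_cases i
    · exact Quaternion.continuous_re.comp this
    · exact Quaternion.continuous_imI.comp this
    · exact Quaternion.continuous_imJ.comp this
    · exact Quaternion.continuous_imK.comp this⟩

theorem good_all (f : C(Sph ℍ[ℝ], ℍ[ℝ])) : Good f := by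
  have : f = iotR (coo f 0) * kc (eR 0) + iotR (coo f 1) * kc (eR 1) + iotR (coo f 2) * kc (eR 2)
      + iotR (coo f 3) * kc (eR 3) := by
    ext1 x
    simp only [ContinuousMap.add_apply, ContinuousMap.mul_apply, iotR_apply]
    ext <;> simp [coo, eR]
  rw [this]
  exact good_add (good_add (good_add (good_mul (good_iotR _) (good_kc _)) (good_mul (good_iotR _) (good_kc _)))
    (good_mul (good_iotR _) (good_kc _))) (good_mul (good_iotR _) (good_kc _))
end Sk
end

section
set_option autoImplicit false
set_option linter.unusedSectionVars false
open Metric Set unitInterval Module Quaternion MvPolynomial MeasureTheory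

namespace Sk
/-- 1 - P -/
noncomputable def GP : HH →L[ℝ] HH := 1 - gM.P
theorem GP_apply (v : HH) : GP v = v - gM.P v := rfl
theorem GP_le (v : HH) : ‖GP v‖ ≤ ‖v‖ := by
  rw [GP_apply, ← gM.Q_zero]; exact gM.Q_le' 0 v

/-- post-composition followed by right multiplication by the conjugate -/
noncomputable def Bop (β : ℍ[ℝ] →L[ℝ] ℍ[ℝ]) : C(Sph ℍ[ℝ], ℍ[ℝ]) →ₗ[ℝ] C(Sph ℍ[ℝ], ℍ[ℝ]) :=
  (rmul (evQ (star xQ))).comp (β.compLeftContinuous ℝ (Sph ℍ[ℝ])).toLinearMap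
theorem Bop_apply (β : ℍ[ℝ] →L[ℝ] ℍ[ℝ]) (f) (x) : Bop β f x = β (f x) * evQ (star xQ) x := rfl

theorem xb_norm (x : Sph ℍ[ℝ]) : ‖evQ (star xQ) x‖ = 1 := by
  rw [evQ_star, ContinuousMap.star_apply, norm_star, evQ_x]; simp
theorem xx_norm (x : Sph ℍ[ℝ]) : ‖evQ xQ x‖ = 1 := by
  rw [evQ_x]; simp

theorem Bop_le (β : ℍ[ℝ] →L[ℝ] ℍ[ℝ]) (hβ : ∀ q, ‖β q‖ ≤ ‖q‖) (f) (x) : ‖Bop β f x‖ ≤ ‖f x‖ := by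
  rw [Bop_apply, norm_mul, xb_norm, mul_one]; exact hβ _

/-- linear form with quaternion coefficients -/
noncomputable def pU (us : Fin 4 → ℍ[ℝ]) : PQ := ∑ i, Xi i * cQ (us i)

theorem us_est (us : Fin 4 → ℍ[ℝ]) (β : ℍ[ℝ] →L[ℝ] ℍ[ℝ]) (b : ℝ)
    (h : ∀ q, ∑ i, us i * q * eR i = b • β q) {k : ℕ} {φ : PQ} (hφ : φ ∈ MM k) :
    GP (el (evQ (pU us)) (tq φ)) = GP ((b / (2 * (k : ℝ) + 4)) • tl (Bop β (evQ φ))) := by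
  have e1 : ∀ i, GP (tq (Xi i * cQ (us i) * φ)) =
      GP ((1 / (2 * (k : ℝ) + 4)) • tq (cQ (us i) * φ * EQ i * star xQ)) := by
    intro i
    have := tx (Nat.zero_le _) i (MM_c (us i) hφ)
    rw [mul_assoc, Xi_mul, GP.map_smul, GP_apply, GP_apply, ← gM.Q_zero]
    exact this
  have e2 : ∑ i, tq (cQ (us i) * φ * EQ i * star xQ) = b • tl (Bop β (evQ φ)) := by
    rw [← map_sum, ← tl.map_smul, tq_apply, ← Finset.sum_mul]
    congr 1
    ext1 x
    rw [ContinuousMap.smul_apply, Bop_apply, ← smul_mul_assoc, ← h, evQ_mul, ContinuousMap.mul_apply, map_sum]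
    congr 1
    rw [ContinuousMap.coe_sum, Finset.sum_apply]
    refine Finset.sum_congr rfl fun i _ => ?_
    rw [evQ_mul, evQ_mul, EQ_eR, evQ_c, evQ_c]; rfl
  rw [el_tq, pU, Finset.sum_mul, map_sum, map_sum, Finset.sum_congr rfl fun i _ => e1 i, ← map_sum,
    ← Finset.smul_sum, e2, smul_smul]
  congr 2; ring

/-- real part -/
noncomputable def beR : ℍ[ℝ] →L[ℝ] ℍ[ℝ] := LinearMap.toContinuousLinearMap
  { toFun := fun q => mkQ q.re 0 0 0
    map_add' := fun a b => by ext <;> simp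
    map_smul' := fun a b => by ext <;> simp }
/-- conjugation -/
noncomputable def beS : ℍ[ℝ] →L[ℝ] ℍ[ℝ] := LinearMap.toContinuousLinearMap
  { toFun := fun q => star q
    map_add' := fun a b => by ext <;> simp <;> ring
    map_smul' := fun a b => by ext <;> simp }
theorem beR_apply (q) : beR q = mkQ q.re 0 0 0 := rfl
theorem beS_apply (q) : beS q = star q := rfl
theorem beR_sq (q : ℍ[ℝ]) : ‖beR q‖ ^ 2 = q.re ^ 2 := by
  rw [beR_apply, ← real_inner_self_eq_norm_sq, inner_coord]; simp; ring
theorem q_sq (q : ℍ[ℝ]) : ‖q‖ ^ 2 = q.re ^ 2 + q.imI ^ 2 + q.imJ ^ 2 + q.imK ^ 2 := by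
  rw [← real_inner_self_eq_norm_sq, inner_coord]; ring
theorem beR_le (q) : ‖beR q‖ ≤ ‖q‖ := by
  refine (abs_le_of_sq_le_sq' ?_ (norm_nonneg _)).2
  rw [beR_sq, q_sq]; nlinarith [sq_nonneg q.imI, sq_nonneg q.imJ, sq_nonneg q.imK]
theorem beS_le (q) : ‖beS q‖ ≤ ‖q‖ := by rw [beS_apply, norm_star]

theorem px : xQ = pU eR := by
  rw [pU, Fin.sum_univ_four]
  simp only [Xi_mul]
  ext1 <;> simp [xQ, eR]
theorem pxb : star xQ = pU (fun i => star (eR i)) := by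
  rw [pU, Fin.sum_univ_four]
  simp only [Xi_mul]
  ext1 <;> simp [xQ, eR]
theorem sumx (q : ℍ[ℝ]) : ∑ i, eR i * q * eR i = (-2 : ℝ) • beS q := by
  rw [Fin.sum_univ_four, beS_apply]
  ext <;> simp [eR] <;> ring
theorem sumxb (q : ℍ[ℝ]) : ∑ i, star (eR i) * q * eR i = (4 : ℝ) • beR q := by
  rw [Fin.sum_univ_four, beR_apply]
  ext <;> simp [eR] <;> ring

theorem E1 {v : HH} (hv : v ∈ gM.W) : ‖GP (el (evQ xQ) v)‖ ≤ 1 / 2 * ‖v‖ := by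
  refine gM.dense (S := {v | ‖GP (el (evQ xQ) v)‖ ≤ 1 / 2 * ‖v‖}) ?_ ?_ hv
  · exact isClosed_le (by fun_prop) (by fun_prop)
  · intro n v
    refine (key_est GP (GP * el (evQ xQ)) GP_le (Bop beS) (Bop_le beS beS_le)
      (fun k => -2 / (2 * (k : ℝ) + 4)) ?_ n v).trans (gM.c_le _ (by norm_num) ?_ n v)
    · intro k φ hφ
      rw [mul_apply_eq_comp, px]
      exact us_est eR beS (-2) sumx hφ
    · intro k
      have : (0:ℝ) ≤ k := Nat.cast_nonneg k
      rw [abs_div, abs_of_pos (by positivity : 0 < 2 * (k : ℝ) + 4), div_le_iff₀ (by positivity)]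
      norm_num; linarith

theorem E2 {v : HH} (hv : v ∈ gM.W) : ‖GP (el (evQ (star xQ)) v)‖ ^ 2 ≤ 4 / 9 * ‖v‖ ^ 2 + 5 / 9 * ‖gM.p 0 v‖ ^ 2 := by
  refine gM.dense (S := {v | ‖GP (el (evQ (star xQ)) v)‖ ^ 2 ≤ 4 / 9 * ‖v‖ ^ 2 + 5 / 9 * ‖gM.p 0 v‖ ^ 2}) ?_ ?_ hv
  · exact isClosed_le (by fun_prop) (by fun_prop)
  · intro n v
    have h1 := key_est GP (GP * el (evQ (star xQ))) GP_le (Bop beR) (Bop_le beR beR_le)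
      (fun k => 4 / (2 * (k : ℝ) + 4)) (by
        intro k φ hφ
        rw [mul_apply_eq_comp, pxb]
        exact us_est _ beR 4 sumxb hφ) n v
    have h2 := pow_le_pow_left₀ (norm_nonneg _) h1 2
    rw [gM.c_sq] at h2
    refine h2.trans ?_
    rw [gM.A_sq]
    rcases n with _ | n
    · simp
    · rw [gM.pA (Nat.succ_pos n), Finset.sum_range_succ', Finset.sum_range_succ']
      have h3 : ∑ k ∈ Finset.range n, (4 / (2 * ((k + 1 : ℕ) : ℝ) + 4)) ^ 2 * ‖gM.p (k + 1) v‖ ^ 2 ≤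
          4 / 9 * ∑ k ∈ Finset.range n, ‖gM.p (k + 1) v‖ ^ 2 := by
        rw [Finset.mul_sum]
        refine Finset.sum_le_sum fun k _ => mul_le_mul_of_nonneg_right ?_ (by positivity)
        have h5 : (0:ℝ) ≤ k := Nat.cast_nonneg k
        have h4 : 4 / (2 * ((k + 1 : ℕ) : ℝ) + 4) ≤ 2 / 3 := by
          push_cast
          rw [div_le_iff₀ (by positivity)]; linarith
        refine (pow_le_pow_left₀ (by positivity) h4 2).trans (by norm_num)
      have h4 : (4 / (2 * ((0 : ℕ) : ℝ) + 4)) ^ 2 = 1 := by norm_num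
      rw [h4]
      linarith

theorem xbx : el (evQ (star xQ)) * el (evQ xQ) = 1 := by
  rw [← el_mul, ← evQ_mul, ← el_one]
  congr 1
  ext1 x
  rw [evQ_mul, evQ_star, ContinuousMap.mul_apply, ContinuousMap.star_apply, evQ_x, Quaternion.star_mul_self,
    Quaternion.normSq_eq_norm_mul_self]
  simp

/-- generator of the kernel -/
noncomputable def v1 : HH := tq (cQ 1)
theorem v1_ne : v1 ≠ 0 := by
  intro h
  have := tl_const 1
  rw [← evQ_c, ← tq_apply] at this
  rw [v1] at h
  rw [h] at this
  simp at this
theorem v1_W : v1 ∈ gM.W := gM.le 0 (gM_mem (cQ_MM 1))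
theorem v1_ker : gM.P (el (evQ (star xQ)) v1) = 0 := by
  rw [v1, el_tq]
  have : cQ 1 = 1 := by ext1 <;> simp
  rw [this, mul_one]
  apply gM.P_zero
  intro k w hw
  obtain ⟨φ, h, rfl⟩ := gM_ex hw
  exact orth_xb h

theorem ker_v1 {v : HH} (hv : v ∈ gM.W) (h : gM.P (el (evQ (star xQ)) v) = 0) : ∃ c : ℝ, v = c • v1 := by
  have h1 := E2 hv
  rw [GP_apply, h, sub_zero, el_norm _ xb_norm] at h1
  have h2 := gM.Q_pyth 1 v
  have h3 : v - gM.Q 1 v = gM.p 0 v := by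
    rw [gM.Q_apply, gM.P_self hv, gM.A_apply]; simp
  rw [h3] at h2
  have h4 : ‖gM.Q 1 v‖ ^ 2 = 0 := le_antisymm (by linarith) (by positivity)
  have h5 : gM.Q 1 v = 0 := by simpa using h4
  rw [h5, sub_zero] at h3
  obtain ⟨φ, hφ, e⟩ := gM_ex (gM.p_mem 0 v)
  obtain ⟨u, rfl⟩ := MM_zero hφ
  rw [← h3] at e
  have h6 := us_est (fun i => star (eR i)) beR 4 sumxb hφ
  rw [← pxb, e, GP_apply, h, sub_zero] at h6
  have h7 : ‖v‖ ≤ ‖beR u‖ := by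
    rw [← el_norm _ xb_norm v, h6]
    refine (GP_le _).trans ?_
    have e4 : (4 / (2 * ((0 : ℕ) : ℝ) + 4)) = 1 := by norm_num
    rw [e4, one_smul, ← tl_const (beR u)]
    refine tl_norm_le _ _ fun x => ?_
    rw [Bop_apply, norm_mul, xb_norm, mul_one, evQ_c]; rfl
  have h8 : ‖v‖ = ‖u‖ := by rw [← e, tq_apply, evQ_c, tl_const]
  rw [h8] at h7
  have h9 := pow_le_pow_left₀ (norm_nonneg _) h7 2
  rw [beR_sq, q_sq] at h9
  have i1 : u.imI = 0 := by nlinarith [sq_nonneg u.imI, sq_nonneg u.imJ, sq_nonneg u.imK]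
  have i2 : u.imJ = 0 := by nlinarith [sq_nonneg u.imI, sq_nonneg u.imJ, sq_nonneg u.imK]
  have i3 : u.imK = 0 := by nlinarith [sq_nonneg u.imI, sq_nonneg u.imJ, sq_nonneg u.imK]
  refine ⟨u.re, ?_⟩
  rw [v1, ← map_smul tq, ← e]
  congr 1
  ext1 <;> simp [i1, i2, i3]
  rw [MvPolynomial.smul_eq_C_mul, mul_one]
end Sk
end

section
set_option autoImplicit false
set_option linter.unusedSectionVars false
open Metric Set unitInterval Module Quaternion

namespace Sk
section
variable {E : Type*} [NormedAddCommGroup E] [NormedSpace ℝ E]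
theorem surj_abs [CompleteSpace E] (P S T : E →L[ℝ] E) (hP : ∀ v, P (P v) = P v) (hle : ∀ v, ‖P v‖ ≤ ‖v‖)
    (hT : ∀ v, ‖T v‖ = ‖v‖) (hTS : T * S = 1)
    (h : ∀ v, ‖S (P v) - P (S (P v))‖ ≤ 1 / 2 * ‖P v‖) (w : E) (hw : P w = w) :
    ∃ v, P v = v ∧ P (T v) = w := by
  let R : E →L[ℝ] E := P * T * (1 - P) * S * P
  have hR' : ∀ v, R v = P (T (S (P v) - P (S (P v)))) := fun v => rfl
  have hR : ‖R‖ ≤ 1 / 2 := by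
    refine R.opNorm_le_bound (by norm_num) fun v => ?_
    rw [hR']
    refine (hle _).trans ?_
    rw [hT]
    refine (h v).trans ?_
    have := hle v
    linarith
  let u := Units.oneSub R (hR.trans_lt (by norm_num))
  let y : E := (↑u⁻¹ : E →L[ℝ] E) w
  have hy : y - R y = w := by
    have : ((↑u : E →L[ℝ] E) * (↑u⁻¹ : E →L[ℝ] E)) w = w := by rw [Units.mul_inv]; rfl
    exact this
  have hy' : P y = y := by
    have : y = w + R y := by rw [← hy]; abel
    rw [this, map_add, hw, hR', hP]
  refine ⟨P (S y), hP _, ?_⟩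
  have e : P (T (S y - P (S y))) = R y := by rw [hR', hy']
  have e2 : T (S y) = y := congrArg (fun A => A y) hTS
  rw [map_sub, map_sub, e2, hy'] at e
  rw [← hy, ← e]; abel

theorem even_abs (F : Submodule ℝ E) [FiniteDimensional ℝ F] (J : E →L[ℝ] E) (hJ : ∀ v ∈ F, J v ∈ F)
    (hJJ : ∀ v, J (J v) = - v) : Even (finrank ℝ F) := by
  by_contra hc
  rw [Nat.not_even_iff_odd] at hc
  let j : F →ₗ[ℝ] F := J.toLinearMap.restrict hJ
  have h1 : j * j = (-1 : ℝ) • (1 : F →ₗ[ℝ] F) := by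
    ext v
    show J (J v) = _
    rw [hJJ]; simp
  have h2 := congrArg LinearMap.det h1
  rw [map_mul, LinearMap.det_smul, hc.neg_one_pow, map_one] at h2
  nlinarith [mul_self_nonneg (LinearMap.det j)]

theorem dim_abs (K F : Submodule ℝ E) [FiniteDimensional ℝ F] (T : E →L[ℝ] E) (hT : ∀ v ∈ K, T v ∈ F)
    (hs : ∀ w ∈ F, ∃ v ∈ K, T v = w) (v0 : E) (h0 : v0 ≠ 0) (hK : v0 ∈ K) (hT0 : T v0 = 0)
    (hk : ∀ v ∈ K, T v = 0 → ∃ c : ℝ, v = c • v0) : FiniteDimensional ℝ K ∧ finrank ℝ K = finrank ℝ F + 1 := by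
  let t : K →ₗ[ℝ] F := T.toLinearMap.restrict hT
  have ts : Function.Surjective t := by
    rintro ⟨w, hw⟩
    obtain ⟨v, hv, e⟩ := hs w hw
    exact ⟨⟨v, hv⟩, Subtype.ext e⟩
  have hv0 : (⟨v0, hK⟩ : K) ∈ LinearMap.ker t := by
    rw [LinearMap.mem_ker]; exact Subtype.ext hT0
  have hkk : ∀ w : LinearMap.ker t, ∃ c : ℝ, c • (⟨⟨v0, hK⟩, hv0⟩ : LinearMap.ker t) = w := by
    rintro ⟨⟨w, hw⟩, h⟩
    rw [LinearMap.mem_ker] at h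
    obtain ⟨c, hc⟩ := hk w hw (congrArg Subtype.val h)
    exact ⟨c, Subtype.ext (Subtype.ext hc.symm)⟩
  have f1 : finrank ℝ (LinearMap.ker t) = 1 :=
    finrank_eq_one _ (fun h => h0 (congrArg (fun z : LinearMap.ker t => ((z : K) : E)) h)) hkk
  haveI : FiniteDimensional ℝ (LinearMap.ker t) := Module.finite_of_finrank_pos (by omega)
  haveI : FiniteDimensional ℝ (K ⧸ LinearMap.ker t) := (t.quotKerEquivOfSurjective ts).symm.finiteDimensional
  haveI : FiniteDimensional ℝ K := Module.Finite.of_submodule_quotient (LinearMap.ker t)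
  refine ⟨this, ?_⟩
  rw [← t.finrank_range_add_finrank_ker, f1, LinearMap.range_eq_top.2 ts, finrank_top]
end

theorem mem_W {v : HH} : v ∈ gM.W ↔ gM.P v = v := ⟨gM.P_self, fun h => h ▸ gM.P_mem v⟩

theorem oddK (n : ℕ) : ∃ K : Submodule ℝ HH, FiniteDimensional ℝ K ∧ Odd (finrank ℝ K) ∧
    ∀ v, v ∈ K ↔ v ∈ gM.W ∧ gM.Q n (el (evQ (star xQ)) v) = 0 := by
  obtain ⟨F, hF, hFm⟩ := gM.ker_fin n
  let K : Submodule ℝ HH := gM.W ⊓ LinearMap.ker (gM.Q n * el (evQ (star xQ))).toLinearMap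
  have hK : ∀ v, v ∈ K ↔ v ∈ gM.W ∧ gM.Q n (el (evQ (star xQ)) v) = 0 := fun v => Iff.rfl
  have hd := dim_abs K F (gM.P * el (evQ (star xQ))) (fun v hv => by
      rw [hFm]
      refine ⟨gM.P_mem _, ?_⟩
      rw [mul_apply_eq_comp, gM.QP]; exact ((hK v).1 hv).2)
    (fun w hw => by
      rw [hFm] at hw
      obtain ⟨v, h1, h2⟩ := surj_abs gM.P (el (evQ xQ)) (el (evQ (star xQ))) gM.PP
        (fun v => by rw [← gM.Q_zero]; exact gM.Q_le 0 v) (el_norm _ xb_norm) xbx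
        (fun v => E1 (gM.P_mem v)) w (mem_W.1 hw.1)
      refine ⟨v, (hK v).2 ⟨mem_W.2 h1, ?_⟩, h2⟩
      rw [← gM.QP, h2]; exact hw.2) v1 v1_ne
    ((hK v1).2 ⟨v1_W, by rw [← gM.QP, v1_ker, map_zero]⟩) v1_ker
    (fun v hv h => ker_v1 ((hK v).1 hv).1 h)
  refine ⟨K, hd.1, ?_, hK⟩
  rw [hd.2]
  refine Even.add_one (even_abs F (el (kc qi)) (fun v hv => ?_) (fun v => ?_))
  · rw [hFm, mem_W] at hv ⊢
    refine ⟨?_, ?_⟩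
    · rw [← gM.Q_zero, kc_Q, gM.Q_zero, hv.1]
    · rw [kc_Q, hv.2, map_zero]
  · have e : kc qi * kc qi = - 1 := by
      ext1 x
      show qi * qi = -1
      ext <;> simp
    have e2 : (el (kc qi) * el (kc qi)) v = - v := by
      rw [← el_mul, e, map_neg, el_one]; rfl
    exact e2
end Sk
end

section
set_option autoImplicit false
set_option linter.unusedSectionVars false
open Metric Set unitInterval Module Quaternion

namespace Sk
section
variable {R : Type*} [Ring R]
/-- the operator to be inverted -/
def CR (P Q f f' : R) : R := 1 - Q * f * (1 - P) * f' * Q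
/-- projection built from an invertible element -/
noncomputable def PiR (P Q f f' : R) : R := P - P * f' * Q * Ring.inverse (CR P Q f f') * (Q * f * P)

variable {P Q f f' : R}

theorem CR_Q (hP : P * P = P) (hQ : Q * Q = Q) (hPQ : P * Q = Q) (hQP : Q * P = Q)
  (hf : f * f' = 1) (hC : IsUnit (CR P Q f f')) : Q * f * P * (P * f' * Q) * Ring.inverse (CR P Q f f') = Q := by
  have e : Q * f * P * (P * f' * Q) = Q * CR P Q f f' := by
    have h1 : Q * f * P * (P * f' * Q) = Q * f * P * f' * Q := by
      calc _ = Q * f * (P * P) * f' * Q := by noncomm_ring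
        _ = _ := by rw [hP]
    have h2 : Q * CR P Q f f' = Q - (Q * Q) * (f * f') * Q + (Q * Q) * f * P * f' * Q := by
      rw [CR]; noncomm_ring
    rw [h1, h2, hf, hQ, mul_one, hQ, sub_self, zero_add]
  rw [e, mul_assoc, Ring.mul_inverse_cancel _ hC, mul_one]

theorem PiR_idem (hP : P * P = P) (hQ : Q * Q = Q) (hPQ : P * Q = Q) (hQP : Q * P = Q)
  (hf : f * f' = 1) (hC : IsUnit (CR P Q f f')) : PiR P Q f f' * PiR P Q f f' = PiR P Q f f' := by
  have h := CR_Q hP hQ hPQ hQP hf hC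
  rw [PiR]
  set i := Ring.inverse (CR P Q f f')
  have e1 : P * (P * f' * Q * i * (Q * f * P)) = P * f' * Q * i * (Q * f * P) := by
    simp only [← mul_assoc, hP]
  have e2 : P * f' * Q * i * (Q * f * P) * P = P * f' * Q * i * (Q * f * P) := by
    simp only [mul_assoc, hP]
  have e3 : P * f' * Q * i * (Q * f * P) * (P * f' * Q * i * (Q * f * P)) = P * f' * Q * i * (Q * f * P) := by
    calc _ = P * f' * Q * i * (Q * f * P * (P * f' * Q) * i) * (Q * f * P) := by noncomm_ring
      _ = P * f' * Q * i * (Q * Q * f * P) := by rw [h]; noncomm_ring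
      _ = _ := by rw [hQ]
  rw [mul_sub, sub_mul, sub_mul, hP, e1, e2, e3, sub_self, sub_zero]

theorem PiR_P (hP : P * P = P) (hQ : Q * Q = Q) (hPQ : P * Q = Q) (hQP : Q * P = Q)
  (hf : f * f' = 1) (hC : IsUnit (CR P Q f f')) : P * PiR P Q f f' = PiR P Q f f' := by
  rw [PiR, mul_sub, hP]
  simp only [← mul_assoc, hP]

theorem PiR_Q (hP : P * P = P) (hQ : Q * Q = Q) (hPQ : P * Q = Q) (hQP : Q * P = Q)
  (hf : f * f' = 1) (hC : IsUnit (CR P Q f f')) : Q * f * PiR P Q f f' = 0 := by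
  have h := CR_Q hP hQ hPQ hQP hf hC
  rw [PiR]
  set i := Ring.inverse (CR P Q f f')
  have e : Q * f * (P * f' * Q * i * (Q * f * P)) = Q * f * P := by
    calc _ = Q * f * P * f' * Q * i * (Q * f * P) := by noncomm_ring
      _ = Q * f * (P * P) * f' * Q * i * (Q * f * P) := by rw [hP]
      _ = (Q * f * P * (P * f' * Q) * i) * (Q * f * P) := by noncomm_ring
      _ = Q * Q * f * P := by rw [h]; noncomm_ring
      _ = _ := by rw [hQ]
  rw [mul_sub, e, sub_self]

theorem PiR_equi (hC : IsUnit (CR P Q f f')) {g g' U : R} (hC' : IsUnit (CR P Q g g')) (h1 : U * P = P * U) (h2 : U * Q = Q * U)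
    (h3 : U * g = f * U) (h4 : U * g' = f' * U) : U * PiR P Q g g' = PiR P Q f f' * U := by
  have hc : U * CR P Q g g' = CR P Q f f' * U := by
    have k : U * (1 - P) = (1 - P) * U := by rw [mul_sub, sub_mul, h1, mul_one, one_mul]
    rw [CR, CR, mul_sub, sub_mul, mul_one, one_mul]
    congr 1
    simp only [← mul_assoc]
    rw [h2, mul_assoc Q U g, h3, ← mul_assoc, mul_assoc (Q * f) U, k, ← mul_assoc,
      mul_assoc _ U g', h4, ← mul_assoc, mul_assoc _ U Q, h2, ← mul_assoc]
  have hi : U * Ring.inverse (CR P Q g g') = Ring.inverse (CR P Q f f') * U := by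
    calc _ = Ring.inverse (CR P Q f f') * CR P Q f f' * U * Ring.inverse (CR P Q g g') := by
            rw [Ring.inverse_mul_cancel _ hC, one_mul]
      _ = Ring.inverse (CR P Q f f') * (U * CR P Q g g') * Ring.inverse (CR P Q g g') := by
            rw [hc, ← mul_assoc]
      _ = _ := by rw [mul_assoc, mul_assoc, Ring.mul_inverse_cancel _ hC', mul_one]
  rw [PiR, PiR, mul_sub, sub_mul, h1]
  congr 1
  simp only [← mul_assoc]
  rw [h1, mul_assoc P U g', h4, ← mul_assoc, mul_assoc _ U Q, h2, ← mul_assoc, mul_assoc _ U (Ring.inverse _), hi,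
    ← mul_assoc, mul_assoc _ U Q, h2, ← mul_assoc, mul_assoc _ U g, h3, ← mul_assoc, mul_assoc _ U P, h1, ← mul_assoc]
end

section
variable {E : Type*} [NormedAddCommGroup E] [NormedSpace ℝ E] [CompleteSpace E]
theorem CR_unit {P Q f f' : E →L[ℝ] E} (hQ : ∀ v, ‖Q v‖ ≤ ‖v‖) (hf : ∀ v, ‖f v‖ = ‖v‖)
    (h : ∀ v, ‖f' (Q v) - P (f' (Q v))‖ ≤ 1 / 2 * ‖v‖) : IsUnit (CR P Q f f') := by
  have : ‖Q * f * (1 - P) * f' * Q‖ ≤ 1 / 2 := by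
    refine ContinuousLinearMap.opNorm_le_bound _ (by norm_num) fun v => ?_
    refine (hQ (f ((1 - P) (f' (Q v))))).trans ?_
    rw [hf]; exact h v
  exact (Units.oneSub _ (this.trans_lt (by norm_num))).isUnit

theorem PiR_cont {Y : Type*} [TopologicalSpace Y] {P Q : E →L[ℝ] E} {f f' : Y → (E →L[ℝ] E)} (hf : Continuous f)
    (hf' : Continuous f') (hC : ∀ y, IsUnit (CR P Q (f y) (f' y))) : Continuous fun y => PiR P Q (f y) (f' y) := by
  have h1 : Continuous fun y => CR P Q (f y) (f' y) := by
    unfold CR; fun_prop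
  have h2 : Continuous fun y => Ring.inverse (CR P Q (f y) (f' y)) := by
    rw [continuous_iff_continuousAt]
    intro y
    have := NormedRing.inverse_continuousAt (hC y).unit
    exact this.comp (f := fun y => CR P Q (f y) (f' y)) h1.continuousAt
  unfold PiR
  fun_prop
end

theorem exists_n {Y : Type*} [TopologicalSpace Y] [CompactSpace Y] {F : Y → C(Sph ℍ[ℝ], ℍ[ℝ])} (hF : Continuous F) :
    ∃ n, ∀ y v, ‖el (F y) (gM.Q n v) - gM.P (el (F y) (gM.Q n v))‖ ≤ 1 / 2 * ‖v‖ := by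
  have key : ∃ n, ∀ y ∈ (univ : Set Y), ∀ v, ‖el (F y) (gM.Q n v) - gM.Q 0 (el (F y) (gM.Q n v))‖ ≤ 1 / 2 * ‖v‖ := by
    refine isCompact_univ.induction_on (p := fun s => ∃ n, ∀ y ∈ s, ∀ v,
      ‖el (F y) (gM.Q n v) - gM.Q 0 (el (F y) (gM.Q n v))‖ ≤ 1 / 2 * ‖v‖) ?_ ?_ ?_ ?_
    · exact ⟨0, by simp⟩
    · rintro s t hst ⟨n, hn⟩
      exact ⟨n, fun y hy => hn y (hst hy)⟩
    · rintro s t ⟨n, hn⟩ ⟨n', hn'⟩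
      refine ⟨max n n', fun y hy => ?_⟩
      rcases hy with hy | hy
      · exact good_mono (by norm_num) (le_max_left _ _) (hn y hy)
      · exact good_mono (by norm_num) (le_max_right _ _) (hn' y hy)
    · intro y _
      obtain ⟨n, hn⟩ := good_all (F y) 0 (1 / 4) (by norm_num)
      have h0 : Continuous fun z => ‖el (F z) - el (F y)‖ :=
        (continuous_norm (E := HH →L[ℝ] HH)).comp ((continuous_sub_right (el (F y))).comp (el.continuous.comp hF))
      have h1 : {z | ‖el (F z) - el (F y)‖ < 1 / 4} ∈ nhds y := by
        refine (isOpen_lt h0 continuous_const).mem_nhds ?_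
        show ‖el (F y) - el (F y)‖ < 1 / 4
        rw [sub_self (el (F y)), norm_zero (E := HH →L[ℝ] HH)]; norm_num
      refine ⟨_, mem_nhdsWithin_of_mem_nhds h1, n, fun z hz v => ?_⟩
      have hg' : ‖el (F z) - el (F y)‖ ≤ 1 / 4 := le_of_lt hz
      have e : el (F z) (gM.Q n v) - gM.Q 0 (el (F z) (gM.Q n v)) =
          (el (F y) (gM.Q n v) - gM.Q 0 (el (F y) (gM.Q n v))) +
          ((el (F z) - el (F y)) (gM.Q n v) - gM.Q 0 ((el (F z) - el (F y)) (gM.Q n v))) := by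
        simp only [sub_apply, map_sub]; abel
      rw [e]
      refine (norm_add_le _ _).trans ((add_le_add (hn v) ((gM.Q_le' _ _).trans
        (((el (F z) - el (F y)).le_opNorm _).trans (mul_le_mul hg' (gM.Q_le _ _) (norm_nonneg _) (by norm_num))))).trans ?_)
      linarith [norm_nonneg v]
  obtain ⟨n, hn⟩ := key
  refine ⟨n, fun y v => ?_⟩
  rw [← gM.Q_zero]; exact hn y trivial v

theorem exists_Pi {Y : Type*} [TopologicalSpace Y] [CompactSpace Y] {F : Y → C(Sph ℍ[ℝ], ℍ[ℝ])} (hF : Continuous F)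
    (h1 : ∀ y x, ‖F y x‖ = 1) : ∃ (n : ℕ) (p : Y → (HH →L[ℝ] HH)), Continuous p ∧ (∀ y v, p y (p y v) = p y v) ∧
    (∀ y v, p y v = v ↔ v ∈ gM.W ∧ gM.Q n (el (F y) v) = 0) ∧
    ∀ y y' u, kc u * F y = F y' * kc u → ∀ v, el (kc u) (p y v) = p y' (el (kc u) v) := by
  have hS : Continuous fun y => star (F y) := continuous_star.comp hF
  obtain ⟨n, hn⟩ := exists_n hS
  have hff : ∀ y, F y * star (F y) = 1 := by
    intro y; ext1 x
    show F y x * star (F y x) = 1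
    rw [Quaternion.self_mul_star, Quaternion.normSq_eq_norm_mul_self, h1]; simp
  have hff' : ∀ y, star (F y) * F y = 1 := by
    intro y; ext1 x
    show star (F y x) * F y x = 1
    rw [Quaternion.star_mul_self, Quaternion.normSq_eq_norm_mul_self, h1]; simp
  have hC : ∀ y, IsUnit (CR gM.P (gM.Q n) (el (F y)) (el (star (F y)))) := fun y =>
    CR_unit (gM.Q_le n) (el_norm _ (h1 y)) (hn y)
  have hP : gM.P * gM.P = gM.P := by ext1 v; exact gM.PP v
  have hQ : gM.Q n * gM.Q n = gM.Q n := by ext1 v; exact gM.QQ le_rfl v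
  have hPQ : gM.P * gM.Q n = gM.Q n := by ext1 v; exact gM.PQ n v
  have hQP : gM.Q n * gM.P = gM.Q n := by ext1 v; exact gM.QP n v
  have hf : ∀ y, el (F y) * el (star (F y)) = 1 := fun y => by rw [← el_mul, hff, el_one]
  refine ⟨n, fun y => PiR gM.P (gM.Q n) (el (F y)) (el (star (F y))),
    PiR_cont (el.continuous.comp hF) (el.continuous.comp hS) hC, ?_, ?_, ?_⟩
  · intro y v
    exact congrArg (fun T => T v) (PiR_idem hP hQ hPQ hQP (hf y) (hC y))
  · intro y v
    constructor
    · intro h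
      have e1 := congrArg (fun T => T v) (PiR_P hP hQ hPQ hQP (hf y) (hC y))
      have e2 := congrArg (fun T => T v) (PiR_Q hP hQ hPQ hQP (hf y) (hC y))
      simp only [mul_apply_eq_comp] at e1 e2
      rw [h] at e1 e2
      exact ⟨mem_W.2 e1, e2⟩
    · rintro ⟨ha, hb⟩
      have e : PiR gM.P (gM.Q n) (el (F y)) (el (star (F y))) v = gM.P v -
        (gM.P * (el (star (F y))) * gM.Q n * Ring.inverse (CR gM.P (gM.Q n) (el (F y)) (el (star (F y)))))
          (gM.Q n (el (F y) (gM.P v))) := rfl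
      rw [e, mem_W.1 ha, hb, map_zero, sub_zero]
  · intro y y' u h v
    have h' : kc u * star (F y) = star (F y') * kc u := by
      calc _ = (star (F y') * F y') * kc u * star (F y) := by rw [hff', one_mul]
        _ = star (F y') * (kc u * F y) * star (F y) := by rw [h, ← mul_assoc]
        _ = star (F y') * kc u := by rw [mul_assoc, mul_assoc, hff, mul_one]
    have := PiR_equi (P := gM.P) (Q := gM.Q n) (U := el (kc u)) (hC y') (hC y)
      (by ext1 v; rw [← gM.Q_zero]; exact (kc_Q u 0 v).symm) (by ext1 v; exact (kc_Q u n v).symm)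
      (by rw [← el_mul, h, el_mul]) (by rw [← el_mul, h', el_mul])
    exact congrArg (fun T => T v) this
end Sk
end

section
set_option autoImplicit false
set_option linter.unusedSectionVars false
open Metric Set unitInterval Module

namespace Sk
section
variable {E : Type*} [NormedAddCommGroup E] [NormedSpace ℝ E]

/-- iterated product of projections -/
noncomputable def Gp (q : ℕ → (E →L[ℝ] E)) : ℕ → (E →L[ℝ] E)
  | 0 => 1
  | n + 1 => q (n + 1) * Gp q n

theorem Gp_spec (q : ℕ → (E →L[ℝ] E)) (hq : ∀ n v, q n (q n v) = q n v) (hd : ∀ n, ‖q n - q (n + 1)‖ < 1)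
    {v : E} (hv : q 0 v = v) (h0 : v ≠ 0) (n : ℕ) : q n (Gp q n v) = Gp q n v ∧ Gp q n v ≠ 0 := by
  induction n with
  | zero => exact ⟨hv, h0⟩
  | succ n ih =>
    refine ⟨hq _ _, fun h => ?_⟩
    have h1 : q (n + 1) (Gp q n v) = 0 := h
    have h2 : (q n - q (n + 1)) (Gp q n v) = Gp q n v := by rw [sub_apply, h1, sub_zero, ih.1]
    have h3 := (q n - q (n + 1)).le_opNorm (Gp q n v)
    rw [h2] at h3
    have h4 : 0 < ‖Gp q n v‖ := norm_pos_iff.2 ih.2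
    nlinarith [hd n]

theorem Gp_fix (q : ℕ → (E →L[ℝ] E)) {v : E} (hv : ∀ n, q n v = v) (n : ℕ) : Gp q n v = v := by
  induction n with
  | zero => rfl
  | succ n ih => rw [Gp, mul_apply_eq_comp, ih, hv]

theorem Gp_cont {Y : Type*} [TopologicalSpace Y] (q : Y → ℕ → (E →L[ℝ] E)) (hq : ∀ n, Continuous fun y => q y n) (n : ℕ) :
    Continuous fun y => Gp (q y) n := by
  induction n with
  | zero => exact continuous_const
  | succ n ih => exact (hq (n + 1)).mul ih

variable (K : Submodule ℝ E) [FiniteDimensional ℝ K] (p0 : E →L[ℝ] E) (hp : ∀ v, p0 v ∈ K)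

/-- compression to `K` -/
noncomputable def BK (A : E →L[ℝ] E) : K →L[ℝ] K := ((p0.codRestrict K hp).comp A).comp K.subtypeL

theorem BK_apply (hpK : ∀ v ∈ K, p0 v = v) (A : E →L[ℝ] E) (v : K) (h : A v ∈ K) : (BK K p0 hp A v : E) = A v := by
  show p0 (A v) = A v
  exact hpK _ h

theorem det_path (hpK : ∀ v ∈ K, p0 v = v) (A : I → (E →L[ℝ] E)) (hA : Continuous A) (h : ∀ s, ∀ v ∈ K, v ≠ 0 → A s v ∈ K ∧ A s v ≠ 0)
    (h0 : 0 < (BK K p0 hp (A 0)).det) : 0 < (BK K p0 hp (A 1)).det := by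
  have hc : Continuous fun s => (BK K p0 hp (A s)).det := by
    refine ContinuousLinearMap.continuous_det.comp ?_
    unfold BK
    fun_prop
  have hne : ∀ s, (BK K p0 hp (A s)).det ≠ 0 := by
    intro s
    have hu : IsUnit (BK K p0 hp (A s)).toLinearMap := by
      rw [LinearMap.isUnit_iff_ker_eq_bot, LinearMap.ker_eq_bot']
      intro v hv
      by_contra hv0
      have hv1 : (v : E) ≠ 0 := fun h => hv0 (Subtype.ext h)
      have h1 := h s v v.2 hv1
      have h2 := BK_apply K p0 hp hpK (A s) v h1.1
      apply h1.2
      rw [← h2]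
      exact congrArg Subtype.val hv
    exact (LinearMap.isUnit_iff_isUnit_det _ |>.1 hu).ne_zero
  by_contra hcon
  obtain ⟨s, hs⟩ := mem_range_of_exists_le_of_exists_ge hc ⟨1, not_lt.1 hcon⟩ ⟨0, h0.le⟩
  exact hne s hs

theorem det_id (hpK : ∀ v ∈ K, p0 v = v) (A : E →L[ℝ] E) (h : ∀ v ∈ K, A v = v) : (BK K p0 hp A).det = 1 := by
  have : BK K p0 hp A = ContinuousLinearMap.id ℝ K := by
    ext v
    rw [BK_apply K p0 hp hpK A v (by rw [h v v.2]; exact v.2), h v v.2]; rfl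
  rw [this]; exact LinearMap.det_id

theorem det_neg' (A : E →L[ℝ] E) (hK : Odd (finrank ℝ K)) : (BK K p0 hp (-A)).det = - (BK K p0 hp A).det := by
  have : (BK K p0 hp (-A)).toLinearMap = (-1 : ℝ) • (BK K p0 hp A).toLinearMap := by
    ext v
    show p0 (-(A v)) = (-1 : ℝ) • p0 (A v)
    rw [map_neg]; simp
  unfold ContinuousLinearMap.det
  rw [this, LinearMap.det_smul, hK.neg_one_pow]; ring

/-- points of a subdivision -/
noncomputable def pt (N : ℕ) (s : I) (k : ℕ) : I := Set.projIcc 0 1 zero_le_one ((s : ℝ) * (k / N))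
theorem pt_zero (N : ℕ) (s : I) : pt N s 0 = 0 := by
  simp only [pt, Nat.cast_zero, zero_div, mul_zero]; exact Set.projIcc_left _
theorem pt_zero' (N k : ℕ) : pt N 0 k = 0 := by
  simp only [pt, Set.Icc.coe_zero, zero_mul]; exact Set.projIcc_left _
theorem pt_N {N : ℕ} (hN : 0 < N) (s : I) : pt N s N = s := by
  have : (N : ℝ) ≠ 0 := by positivity
  simp only [pt, div_self this, mul_one]; exact Set.projIcc_val _ _
theorem pt_cont (N k : ℕ) : Continuous fun s => pt N s k := by
  unfold pt; exact continuous_projIcc.comp (by fun_prop)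
theorem pt_dist {N : ℕ} (hN : 0 < N) (s : I) (k : ℕ) : dist (pt N s k) (pt N s (k + 1)) ≤ 1 / N := by
  have h := (LipschitzWith.projIcc (zero_le_one : (0:ℝ) ≤ 1)).dist_le_mul ((s : ℝ) * (k / N)) ((s : ℝ) * ((k + 1 : ℕ) / N))
  refine h.trans ?_
  have e : (s : ℝ) * (k / N) - (s : ℝ) * ((k + 1 : ℕ) / N) = - (s * (1 / N)) := by push_cast; ring
  rw [Real.dist_eq, e, abs_neg, abs_of_nonneg (mul_nonneg s.2.1 (by positivity))]
  simp only [NNReal.coe_one, one_mul]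
  exact mul_le_of_le_one_left (by positivity) s.2.2

theorem top_lemma (p : I × I → (E →L[ℝ] E)) (hc : Continuous p) (hi : ∀ y v, p y (p y v) = p y v)
    (hK : Odd (finrank ℝ K)) (hb0 : ∀ v, p (1, 0) v = v ↔ v ∈ K)
    (h1 : ∀ r v, p (r, 0) v = p (1, 0) v) (h2 : ∀ r v, p (r, 1) v = p (1, 0) v) (h3 : ∀ t v, p (1, t) v = p (1, 0) v)
    (u : I → (E →L[ℝ] E)) (hu : Continuous u) (u0 : u 0 = 1) (u1 : u 1 = -1) (ui : ∀ s v, u s v = 0 → v = 0)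
    (hup : ∀ s v, u s (p (0, s) v) = p (1, 0) (u s v)) : False := by
  have hp : ∀ v, p (1, 0) v ∈ K := fun v => (hb0 _).1 (hi _ v)
  have hpK : ∀ v ∈ K, p (1, 0) v = v := fun v hv => (hb0 v).2 hv
  have huc := CompactSpace.uniformContinuous_of_continuous hc
  rw [Metric.uniformContinuous_iff] at huc
  obtain ⟨δ, hδ, hd⟩ := huc 1 one_pos
  obtain ⟨m, hm⟩ := exists_nat_gt (1 / δ)
  have hm0 : (0:ℝ) < m := lt_trans (by positivity) hm
  have hN : 0 < m := by exact_mod_cast hm0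
  have hm1 : 1 / (m : ℝ) < δ := by rw [one_div_lt hm0 hδ]; exact hm
  have key : ∀ r s, ∀ v ∈ K, v ≠ 0 → p (r, s) (Gp (fun k => p (r, pt m s k)) m v) = Gp (fun k => p (r, pt m s k)) m v ∧
      Gp (fun k => p (r, pt m s k)) m v ≠ 0 := by
    intro r s v hv hv0
    have := Gp_spec (fun k => p (r, pt m s k)) (fun n v => hi _ v) (fun n => by
      rw [← dist_eq_norm]
      apply hd
      rw [Prod.dist_eq]
      simp only [dist_self]
      exact max_lt hδ ((pt_dist hN s n).trans_lt hm1)) (by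
      show p (r, pt m s 0) v = v
      rw [pt_zero, h1]; exact hpK v hv) hv0 m
    simp only [pt_N hN] at this
    exact this
  -- first deformation
  have d1 := det_path K (p (1, 0)) hp hpK (fun r => Gp (fun k => p (σ r, pt m 1 k)) m)
    (Gp_cont (fun (r : I) k => p (σ r, pt m 1 k)) (fun k => by fun_prop) m)
    (fun r v hv hv0 => by
      have := key (σ r) 1 v hv hv0
      rw [h2, hb0] at this
      exact this)
    (by
      rw [det_id K _ hp hpK]
      · exact one_pos
      · intro v hv
        refine Gp_fix _ (fun n => ?_) m
        rw [unitInterval.symm_zero, h3]; exact hpK v hv)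
  have d2 := det_path K (p (1, 0)) hp hpK (fun s => u s * Gp (fun k => p (0, pt m s k)) m)
    (hu.mul (Gp_cont (fun (s : I) k => p (0, pt m s k)) (fun k => by
      have := pt_cont m k
      fun_prop) m))
    (fun s v hv hv0 => by
      have := key 0 s v hv hv0
      rw [mul_apply_eq_comp]
      refine ⟨?_, fun h => this.2 (ui _ _ h)⟩
      rw [← this.1, hup]; exact hp _)
    (by
      rw [det_id K _ hp hpK]
      · exact one_pos
      · intro v hv
        rw [u0, one_mul]
        refine Gp_fix _ (fun n => ?_) m
        rw [pt_zero', h1]; exact hpK v hv)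
  simp only [u1, neg_one_mul, unitInterval.symm_one] at d1 d2
  rw [det_neg' K _ hp _ hK] at d2
  linarith
end
end Sk
end

section
set_option autoImplicit false
set_option linter.unusedSectionVars false
open Metric Set unitInterval Module Quaternion

namespace Sk
theorem ee_pi : (ee Real.pi : ℍ[ℝ]) = -1 := by
  rw [ee_coe]; ext <;> simp

theorem sinv (x : Sph ℍ[ℝ]) : ((x⁻¹ : Sph ℍ[ℝ]) : ℍ[ℝ]) = star (x : ℍ[ℝ]) := by
  rw [Metric.unitSphere.coe_inv, Quaternion.inv_def, Quaternion.normSq_eq_norm_mul_self]; simp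

/-- constant map to the sphere -/
noncomputable abbrev ks (u : Sph ℍ[ℝ]) : C(Sph ℍ[ℝ], Sph ℍ[ℝ]) := ContinuousMap.const _ u

/-- the inversion -/
noncomputable def sb : Bg := ⟨(ContinuousMap.id _)⁻¹, by
  rw [mem_Bg]; show (1 : Sph ℍ[ℝ])⁻¹ = 1; exact inv_one⟩

/-- conjugates of the inversion -/
noncomputable def cj (u : Sph ℍ[ℝ]) : Bg := ⟨(ks u)⁻¹ * sb.1 * ks u, by
  rw [mem_Bg]; show u⁻¹ * (1 : Sph ℍ[ℝ])⁻¹ * u = 1; simp⟩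

theorem cj_apply (u x : Sph ℍ[ℝ]) : (cj u).1 x = u⁻¹ * x⁻¹ * u := rfl

theorem cj_cont : Continuous cj := by
  refine Continuous.subtype_mk ?_ _
  have : Continuous ks := ContinuousMap.continuous_const'
  exact (this.inv.mul continuous_const).mul this

/-- the loop -/
noncomputable def lp : Path sb sb where
  toFun t := cj (ee (Real.pi * t))
  continuous_toFun := cj_cont.comp (ee_cont.comp (by fun_prop))
  source' := by
    apply Subtype.ext; ext1 x
    rw [cj_apply]; simp [ee_zero]; rfl
  target' := by
    apply Subtype.ext; ext1 x
    rw [cj_apply]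
    apply Subtype.ext
    rw [Metric.unitSphere.coe_mul, Metric.unitSphere.coe_mul, sinv (ee _)]
    simp [ee_pi]; rfl

/-- underlying quaternion valued map -/
noncomputable def un (f : Bg) : C(Sph ℍ[ℝ], ℍ[ℝ]) := (⟨Subtype.val, continuous_subtype_val⟩ : C(Sph ℍ[ℝ], ℍ[ℝ])).comp f.1
theorem un_cont : Continuous un := (ContinuousMap.continuous_postcomp _).comp continuous_subtype_val
theorem un_apply (f : Bg) (x) : un f x = (f.1 x : ℍ[ℝ]) := rfl
theorem un_sb : un sb = evQ (star xQ) := by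
  ext1 x
  rw [un_apply, evQ_star, ContinuousMap.star_apply, evQ_x, ← sinv]; rfl

theorem lp_not : ¬ lp.Homotopic (Path.refl sb) := by
  rintro ⟨H⟩
  let F : I × I → C(Sph ℍ[ℝ], ℍ[ℝ]) := fun y => un (H y)
  have hF : Continuous F := un_cont.comp H.continuous
  obtain ⟨n, p, hc, hi, hm, he⟩ := exists_Pi hF (fun y x => by
    show ‖(((H y).1 x : Sph ℍ[ℝ]) : ℍ[ℝ])‖ = 1
    simp)
  obtain ⟨K, hK, hodd, hKm⟩ := oddK n
  have hcon : ∀ y y', F y = F y' → ∀ v, p y v = p y' v := by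
    intro y y' h v
    have := he y y' 1 (by rw [h]; ext1 x; simp) v
    have e : el (kc 1) = 1 := el_one
    rw [e] at this
    exact this
  have b1 : ∀ r, F (r, 0) = un sb := fun r => by simp [F]
  have b2 : ∀ r, F (r, 1) = un sb := fun r => by simp [F]
  have b3 : ∀ t, F (1, t) = un sb := fun t => by simp [F]
  have b4 : ∀ t, F (0, t) = un (cj (ee (Real.pi * t))) := fun t => by
    show un (H (0, t)) = _
    rw [H.apply_zero]; rfl
  refine top_lemma K p hc hi hodd (fun v => ?_) (fun r => hcon _ _ ?_) (fun r => hcon _ _ ?_) (fun r => hcon _ _ ?_)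
    (fun s => el (kc (ee (Real.pi * s)))) ?_ ?_ ?_ ?_ ?_
  · rw [hm, hKm, b1, un_sb]
  · rw [b1, b1]
  · rw [b2, b1]
  · rw [b3, b1]
  · refine el.continuous.comp ?_
    exact ContinuousMap.continuous_const'.comp (continuous_subtype_val.comp (ee_cont.comp (by fun_prop)))
  · rw [← el_one]
    congr 1
    ext1 x
    simp [ee_zero]
  · rw [← el_one, ← map_neg]
    congr 1
    ext1 x
    simp [ee_pi]
  · intro s v h
    have := el_norm (kc (ee (Real.pi * s))) (fun x => by simp) v
    rw [h, norm_zero] at this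
    exact norm_eq_zero.1 this.symm
  · intro s v
    refine he _ _ _ ?_ v
    rw [b4, b1]
    ext1 x
    show (ee (Real.pi * s) : ℍ[ℝ]) * ((cj (ee (Real.pi * s))).1 x : ℍ[ℝ]) = ((sb.1 x : Sph ℍ[ℝ]) : ℍ[ℝ]) * (ee (Real.pi * s) : ℍ[ℝ])
    rw [← Metric.unitSphere.coe_mul, ← Metric.unitSphere.coe_mul, cj_apply]
    congr 1
    rw [mul_assoc, mul_inv_cancel_left]; rfl

theorem pi_sb : Nonempty (FundamentalGroup Bg sb ≃* Multiplicative (ZMod 2)) := by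
  obtain ⟨e⟩ := lmulH (sb : Bg) 1
  obtain ⟨c, hc⟩ := Bg_two
  have hne : cls lp ≠ 1 := by
    rw [← cls_refl]
    intro h
    exact lp_not (cls_eq.1 h)
  have hlp : e (cls lp) = c := (hc _).resolve_left fun h => hne (e.injective (h.trans e.map_one.symm))
  have hcard : Nat.card (FundamentalGroup Bg sb) = 2 := by
    rw [Nat.card_eq_two_iff]
    refine ⟨1, cls lp, hne.symm, ?_⟩
    ext a
    simp only [mem_insert_iff, mem_singleton_iff, mem_univ, iff_true]
    rcases hc (e a) with h | h
    · left; exact e.injective (h.trans e.map_one.symm)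
    · right; exact e.injective (h.trans hlp.symm)
  haveI : Fact (Nat.Prime 2) := ⟨Nat.prime_two⟩
  exact ⟨mulEquivOfPrimeCardEq hcard (by simp)⟩

theorem pi_Bg (f : Bg) : Nonempty (FundamentalGroup Bg f ≃* Multiplicative (ZMod 2)) := by
  obtain ⟨e⟩ := lmulH (f : Bg) sb
  obtain ⟨e'⟩ := pi_sb
  exact ⟨e.trans e'⟩
end Sk
end

section
set_option autoImplicit false
open Metric Set unitInterval Module Quaternion
namespace Sk
/-- identification of the two models of the sphere -/
noncomputable def sphH : Metric.sphere (0 : EuclideanSpace ℝ (Fin 4)) 1 ≃ₜ Sph ℍ[ℝ] where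
  toFun x := ⟨Quaternion.linearIsometryEquivTuple.symm x, by simp [-Quaternion.linearIsometryEquivTuple_symm_apply]⟩
  invFun x := ⟨Quaternion.linearIsometryEquivTuple x, by simp [-Quaternion.linearIsometryEquivTuple_apply]⟩
  left_inv x := by apply Subtype.ext; simp only [LinearIsometryEquiv.apply_symm_apply]
  right_inv x := by apply Subtype.ext; simp only [LinearIsometryEquiv.symm_apply_apply]
  continuous_toFun := continuous_induced_rng.2 (Quaternion.linearIsometryEquivTuple.symm.continuous.comp continuous_subtype_val)
  continuous_invFun := continuous_induced_rng.2 (Quaternion.linearIsometryEquivTuple.continuous.comp continuous_subtype_val)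

theorem sphH_N : sphH NPole = 1 := by
  apply Subtype.ext
  show Quaternion.linearIsometryEquivTuple.symm (EuclideanSpace.single 0 1) = 1
  ext <;> simp [Quaternion.linearIsometryEquivTuple_symm_apply]

theorem sphH_one : sphH.symm 1 = NPole := by rw [← sphH_N, Homeomorph.symm_apply_apply]

/-- the identification as a continuous map -/
noncomputable def sHa : C(Metric.sphere (0 : EuclideanSpace ℝ (Fin 4)) 1, Sph ℍ[ℝ]) := ⟨sphH, sphH.continuous⟩
/-- its inverse as a continuous map -/
noncomputable def sHb : C(Sph ℍ[ℝ], Metric.sphere (0 : EuclideanSpace ℝ (Fin 4)) 1) := ⟨sphH.symm, sphH.symm.continuous⟩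

/-- the based mapping space as a topological group -/
noncomputable def bmH : BasedMaps ≃ₜ Bg where
  toFun f := ⟨(sHa.comp f.1).comp sHb, by
    rw [mem_Bg]
    show sphH (f.1 (sphH.symm 1)) = 1
    rw [sphH_one, f.2, sphH_N]⟩
  invFun f := ⟨(sHb.comp f.1).comp sHa, by
    show sphH.symm (f.1 (sphH NPole)) = NPole
    rw [sphH_N, (mem_Bg f.1).1 f.2, sphH_one]⟩
  left_inv f := by
    apply Subtype.ext; ext1 x
    show sphH.symm (sphH (f.1 (sphH.symm (sphH x)))) = f.1 x
    simp
  right_inv f := by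
    apply Subtype.ext; ext1 x
    show sphH (sphH.symm (f.1 (sphH (sphH.symm x)))) = f.1 x
    simp
  continuous_toFun := continuous_induced_rng.2 (((ContinuousMap.continuous_precomp sHb).comp (ContinuousMap.continuous_postcomp sHa)).comp
    continuous_subtype_val)
  continuous_invFun := continuous_induced_rng.2 (((ContinuousMap.continuous_precomp sHa).comp (ContinuousMap.continuous_postcomp sHb)).comp
    continuous_subtype_val)
end Sk
end

/-- For every based map `f : S³ → S³`, the fundamental group
`π₁(Map_*(S³,S³), f)` is isomorphic to `ℤ/2ℤ`. -/
theorem fundamentalGroup_basedMaps_iso_zmod_two (f : BasedMaps) :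
    Nonempty (FundamentalGroup BasedMaps f ≃* Multiplicative (ZMod 2)) := by
  obtain ⟨e⟩ := Sk.homeo_pi1 Sk.bmH f _ rfl
  obtain ⟨e'⟩ := Sk.pi_Bg (Sk.bmH f)
  exact ⟨e.trans e'⟩
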